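/- Let X be a connected affine homogeneous space of a linear algebraic group G over ℂ. If X is not isomorphic to the affine line ℂ nor to an algebraic torus (ℂ*)^k, then X has the algebraic density property: the Lie algebra generated by the complete algebraic vector fields on X coincides with the space of all algebraic vector fields on X. -/

import Mathlib

/-!
STATEMENT 0: Let X be a connected affine homogeneous space of a linear algebraic group G
over ℂ.  If X is not isomorphic to the affine line ℂ nor to an algebraic torus (ℂ*)^k,
then X has the algebraic density property (ADP).

Modelling conventions: an affine variety X is given by its coordinate ring `A = ℂ[X]`
(a finitely generated integral smooth ℂ-algebra); its points are the ℂ-algebra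
homomorphisms `A →ₐ[ℂ] ℂ`.  An algebraic vector field is a ℂ-derivation of `A`, and such
a field is complete if through every point there is an entire (holomorphic in t ∈ ℂ)
integral curve of the field.  A linear algebraic group is a Zariski closed subgroup of
`GL_n(ℂ)`; connectedness is taken in the classical topology (equivalent to Zariski
connectedness for algebraic subgroups).  An algebraic action of G on X is an action by
algebra automorphisms of `A` which is locally finite with regular matrix coefficients;
homogeneity = transitivity on ℂ-points.  The affine line has coordinate ring `ℂ[t]`
(= `Polynomial ℂ`) and the torus (ℂ*)^k has coordinate ring the Laurent polynomial ring
(= `AddMonoidAlgebra ℂ (Fin k → ℤ)`); "not isomorphic" is expressed via coordinate rings.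
-/

noncomputable section

/-- A complete algebraic vector field: through every ℂ-point there is an entire
integral curve of the field. -/
def IsCompleteField {A : Type*} [CommRing A] [Algebra ℂ A] (ξ : Derivation ℂ A A) : Prop :=
  ∀ p : A →ₐ[ℂ] ℂ, ∃ γ : ℂ → (A →ₐ[ℂ] ℂ), γ 0 = p ∧
    ∀ (a : A) (t : ℂ), HasDerivAt (fun s => (γ s) a) ((γ t) (ξ a)) t

/-- `Lie_alg(X)`: the Lie algebra generated by the complete algebraic vector fields. -/
def LieAlgGen (A : Type*) [CommRing A] [Algebra ℂ A] : LieSubalgebra ℂ (Derivation ℂ A A) :=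
  LieSubalgebra.lieSpan ℂ (Derivation ℂ A A) {ξ | IsCompleteField ξ}

/-- The algebraic density property: `Lie_alg(X) = AVF(X)`. -/
def HasADP (A : Type*) [CommRing A] [Algebra ℂ A] : Prop := LieAlgGen A = ⊤

abbrev GLn (n : ℕ) := GL (Fin n) ℂ

def glEntries {n : ℕ} (g : GLn n) : Fin n × Fin n → ℂ :=
  fun ij => (g : Matrix (Fin n) (Fin n) ℂ) ij.1 ij.2

/-- A subset of `GL_n(ℂ)` is Zariski closed in `GL_n(ℂ)` if it is cut out by polynomials
in the matrix entries. -/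
def IsZClosedInGL {n : ℕ} (s : Set (GLn n)) : Prop :=
  ∃ P : Set (MvPolynomial (Fin n × Fin n) ℂ),
    ∀ g : GLn n, g ∈ s ↔ ∀ p ∈ P, MvPolynomial.eval (glEntries g) p = 0

/-- A regular function on `GL_n(ℂ)`: a polynomial in the entries and `det⁻¹`. -/
def IsRegularOnGL {n : ℕ} (f : GLn n → ℂ) : Prop :=
  ∃ (q : MvPolynomial (Fin n × Fin n) ℂ) (m : ℕ),
    ∀ g : GLn n, f g * ((g : Matrix (Fin n) (Fin n) ℂ).det) ^ m = MvPolynomial.eval (glEntries g) q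

/-- A regular function on a closed subgroup of `GL_n(ℂ)`. -/
def IsRegularOnSubgroup {n : ℕ} (G : Subgroup (GLn n)) (c : ↥G → ℂ) : Prop :=
  ∃ f : GLn n → ℂ, IsRegularOnGL f ∧ ∀ g : ↥G, c g = f ↑g

/-- An algebraic action of the linear algebraic group `G ≤ GL_n(ℂ)` on the affine variety
with coordinate ring `A`: an action by algebra automorphisms of `A` that is locally finite
with regular matrix coefficients. -/
structure AlgebraicAction {n : ℕ} (G : Subgroup (GLn n)) (A : Type*) [CommRing A]
    [Algebra ℂ A] where
  act : ↥G →* (A ≃ₐ[ℂ] A)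
  regular : ∀ a : A, ∃ (k : ℕ) (b : Fin k → A) (c : Fin k → ↥G → ℂ),
    (∀ i, IsRegularOnSubgroup G (c i)) ∧
    ∀ g : ↥G, act g a = ∑ i, algebraMap ℂ A (c i g) * b i

/-- Transitivity of the action on ℂ-points (homogeneity). -/
def AlgebraicAction.Transitive {n : ℕ} {G : Subgroup (GLn n)} {A : Type*} [CommRing A]
    [Algebra ℂ A] (ρ : AlgebraicAction G A) : Prop :=
  ∀ p q : A →ₐ[ℂ] ℂ, ∃ g : ↥G, q = p.comp (ρ.act g).toAlgHom

/-- Coordinate ring of the algebraic torus `(ℂ*)^k`: Laurent polynomials in `k` variables. -/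
abbrev TorusRing (k : ℕ) := AddMonoidAlgebra ℂ (Fin k → ℤ)

open Finset in
theorem Derivation.pow_apply_mul {R A : Type*} [CommRing R] [CommRing A] [Algebra R A]
    (D : Derivation R A A) (n : ℕ) (a b : A) :
    ((D : A →ₗ[R] A) ^ n) (a * b) = ∑ ij ∈ antidiagonal n,
      n.choose ij.1 • (((D : A →ₗ[R] A) ^ ij.1) a * ((D : A →ₗ[R] A) ^ ij.2) b) := by
  induction n with
  | zero => simp
  | succ n ih =>
    rw [sum_antidiagonal_choose_succ_nsmul
      (M := A) (fun i j => ((D : A →ₗ[R] A) ^ i) a * ((D : A →ₗ[R] A) ^ j) b) n]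
    simp only [pow_succ', Module.End.mul_apply, ih, map_sum, map_nsmul, Derivation.coeFn_coe,
      Derivation.leibniz, smul_eq_mul, smul_add, sum_add_distrib]
    congr 1
    refine sum_congr rfl fun ij hij => ?_
    rw [mul_comm (((D : A →ₗ[R] A) ^ ij.2) b)]
    rw [n.choose_symm_of_eq_add (mem_antidiagonal.1 hij).symm]

/-- A linear endomorphism is locally finite if every vector lies in a finite-dimensional
invariant subspace. -/
def IsLocallyFinite {A : Type*} [AddCommGroup A] [Module ℂ A] (δ : A →ₗ[ℂ] A) : Prop :=
  ∀ a, ∃ W : Submodule ℂ A, FiniteDimensional ℂ W ∧ a ∈ W ∧ ∀ w ∈ W, δ w ∈ W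

section Flow

variable {A : Type*} [AddCommGroup A] [Module ℂ A]

theorem IsLocallyFinite.exists_model {δ : A →ₗ[ℂ] A} (h : IsLocallyFinite δ) (a : A) :
    ∃ (m : ℕ) (J : (Fin m → ℂ) →ₗ[ℂ] A) (T : (Fin m → ℂ) →L[ℂ] (Fin m → ℂ)) (v : Fin m → ℂ),
      J v = a ∧ ∀ x, J (T x) = δ (J x) := by
  obtain ⟨W, hW, ha, hs⟩ := h a
  let e := (Module.finBasis ℂ W).equivFun
  refine ⟨_, W.subtype ∘ₗ e.symm.toLinearMap,
    LinearMap.toContinuousLinearMap (e.toLinearMap ∘ₗ (δ.restrict hs) ∘ₗ e.symm.toLinearMap),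
    e ⟨a, ha⟩, ?_, ?_⟩
  · simp
  · intro x
    simp

theorem hasSum_exp_model {m : ℕ} (T : (Fin m → ℂ) →L[ℂ] (Fin m → ℂ)) (φ : (Fin m → ℂ) →L[ℂ] ℂ)
    (v : Fin m → ℂ) (t : ℂ) :
    HasSum (fun n : ℕ => t ^ n * (n.factorial : ℂ)⁻¹ * φ ((T ^ n) v))
      (φ (NormedSpace.exp (t • T) v)) := by
  have h := NormedSpace.exp_series_hasSum_exp' (𝕂 := ℂ) (t • T)
  have h2 := (h.mapL ((ContinuousLinearMap.apply ℂ _ v))).mapL φ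
  refine h2.congr_fun ?_
  intro n
  have key : ∀ n : ℕ, ((t • T) ^ n) v = t ^ n • (T ^ n) v := by
    intro n
    induction n with
    | zero => simp
    | succ n ih =>
      rw [pow_succ', pow_succ' T, mul_apply_eq_comp, ih,
        mul_apply_eq_comp, map_smul, smul_apply, smul_smul, pow_succ]
  rw [ContinuousLinearMap.apply_apply, smul_apply, key, map_smul, map_smul]
  simp only [smul_eq_mul]
  ring

theorem IsLocallyFinite.flow_aux {δ : A →ₗ[ℂ] A} (h : IsLocallyFinite δ) (p : A →ₗ[ℂ] ℂ) (a : A) :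
    ∃ F F' : ℂ → ℂ, (∀ t, HasDerivAt F (F' t) t) ∧
      (∀ t, HasSum (fun n : ℕ => t ^ n * (n.factorial : ℂ)⁻¹ * p ((δ ^ n) a)) (F t)) ∧
      (∀ t, HasSum (fun n : ℕ => t ^ n * (n.factorial : ℂ)⁻¹ * p ((δ ^ n) (δ a))) (F' t)) := by
  obtain ⟨m, J, T, v, hv, hT⟩ := h.exists_model a
  have hpow : ∀ n x, J ((T ^ n) x) = (δ ^ n) (J x) := by
    intro n
    induction n with
    | zero => simp
    | succ n ih => intro x; rw [pow_succ, pow_succ, Module.End.mul_apply, ← hT, ← ih]; rfl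
  set φ : (Fin m → ℂ) →L[ℂ] ℂ := LinearMap.toContinuousLinearMap (p ∘ₗ J) with hφ
  refine ⟨fun t => φ (NormedSpace.exp (t • T) v), fun t => φ (NormedSpace.exp (t • T) (T v)),
    ?_, ?_, ?_⟩
  · intro t
    have h1 := hasDerivAt_exp_smul_const T t
    have h2 := (φ.comp ((ContinuousLinearMap.apply ℂ (Fin m → ℂ) v))).hasFDerivAt.comp_hasDerivAt t h1
    exact h2
  · intro t
    convert hasSum_exp_model T φ v t using 1
    funext n
    rw [hφ, LinearMap.coe_toContinuousLinearMap', LinearMap.comp_apply, hpow, hv]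
  · intro t
    convert hasSum_exp_model T φ (T v) t using 1
    funext n
    rw [hφ, LinearMap.coe_toContinuousLinearMap', LinearMap.comp_apply, hpow, hT, hv]

end Flow

theorem IsLocallyFinite.isCompleteField {A : Type*} [CommRing A] [Algebra ℂ A]
    {δ : Derivation ℂ A A} (h : IsLocallyFinite (δ : A →ₗ[ℂ] A)) : IsCompleteField δ := by
  intro p
  choose F F' hF hS hS' using h.flow_aux p.toLinearMap
  have hadd : ∀ a b t, F (a + b) t = F a t + F b t := fun a b t =>
    (hS (a + b) t).unique (by simpa [mul_add] using (hS a t).add (hS b t))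
  have hsmul : ∀ (c : ℂ) a t, F (c • a) t = c * F a t := fun c a t =>
    (hS (c • a) t).unique (by
      have := (hS a t).mul_left c
      refine this.congr_fun ?_; intro n; simp; ring)
  have hone : ∀ t, F 1 t = 1 := fun t => (hS 1 t).unique (by
    have := hasSum_single (f := fun n : ℕ => t ^ n * (n.factorial : ℂ)⁻¹ *
      p.toLinearMap (((δ : A →ₗ[ℂ] A) ^ n) 1)) 0 (by
        intro n hn
        obtain ⟨n, rfl⟩ := Nat.exists_eq_succ_of_ne_zero hn
        simp [pow_succ])
    simpa using this)
  have hmul : ∀ a b t, F (a * b) t = F a t * F b t := by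
    intro a b t
    have h1 := tsum_mul_tsum_eq_tsum_sum_antidiagonal_of_summable_norm
      (hS a t).summable.norm (hS b t).summable.norm
    rw [(hS a t).tsum_eq, (hS b t).tsum_eq] at h1
    rw [h1, ← (hS (a * b) t).tsum_eq]
    refine tsum_congr fun n => ?_
    rw [Derivation.pow_apply_mul, map_sum, Finset.mul_sum]
    refine Finset.sum_congr rfl fun ij hij => ?_
    have hij' := Finset.HasAntidiagonal.mem_antidiagonal.1 hij
    have hch : (n.choose ij.1 : ℂ) * (ij.1.factorial : ℂ) * (ij.2.factorial : ℂ)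
        = (n.factorial : ℂ) := by
      rw [← hij', Nat.choose_symm_add]
      exact_mod_cast Nat.add_choose_mul_factorial_mul_factorial ij.1 ij.2
    have e1 : (ij.1.factorial : ℂ) ≠ 0 := by exact_mod_cast ij.1.factorial_ne_zero
    have e2 : (ij.2.factorial : ℂ) ≠ 0 := by exact_mod_cast ij.2.factorial_ne_zero
    have e3 : (n.factorial : ℂ) ≠ 0 := by exact_mod_cast n.factorial_ne_zero
    rw [map_nsmul, nsmul_eq_mul]
    simp only [AlgHom.toLinearMap_apply, map_mul]
    rw [← hij'] at *
    rw [pow_add]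
    field_simp
    rw [← hch]
    ring
  let γ : ℂ → (A →ₐ[ℂ] ℂ) := fun t =>
    AlgHom.ofLinearMap
      { toFun := fun a => F a t
        map_add' := fun a b => hadd a b t
        map_smul' := fun c a => by simpa using hsmul c a t }
      (hone t) (fun a b => hmul a b t)
  have hF' : ∀ a t, F' a t = F (δ a) t := fun a t => (hS' a t).unique (hS (δ a) t)
  refine ⟨γ, ?_, ?_⟩
  · ext a
    change F a 0 = p a
    refine (hS a 0).unique ?_
    have := hasSum_single (f := fun n : ℕ => (0:ℂ) ^ n * (n.factorial : ℂ)⁻¹ *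
      p.toLinearMap (((δ : A →ₗ[ℂ] A) ^ n) a)) 0 (by
        intro n hn
        simp [hn])
    simpa using this
  · intro a t
    have := hF a t
    rw [hF'] at this
    exact this

theorem IsCompleteField.smul_of_sq_eq_zero {A : Type*} [CommRing A] [Algebra ℂ A]
    {E : Derivation ℂ A A} (hE : IsCompleteField E) {f : A} (hf : E (E f) = 0) :
    IsCompleteField (f • E) := by
  intro p
  obtain ⟨γ, h0, hγ⟩ := hE p
  have hEf : ∀ t, γ t (E f) = p (E f) := by
    intro t
    have h1 : ∀ t, HasDerivAt (fun s => γ s (E f)) 0 t := fun t => by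
      simpa [hf] using hγ (E f) t
    have := is_const_of_deriv_eq_zero (fun t => (h1 t).differentiableAt)
      (fun t => (h1 t).deriv) t 0
    rw [this, h0]
  have hft : ∀ t, γ t f = p f + p (E f) * t := by
    intro t
    have h1 : ∀ t, HasDerivAt (fun s => γ s f - p (E f) * s) 0 t := fun t => by
      have := (hγ f t).sub ((hasDerivAt_id t).const_mul (p (E f)))
      simp only [hEf, mul_one, sub_self] at this
      exact this
    have := is_const_of_deriv_eq_zero (fun t => (h1 t).differentiableAt)
      (fun t => (h1 t).deriv) t 0
    simp only [h0, mul_zero, sub_zero] at this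
    linear_combination this
  have hτ : ∃ τ : ℂ → ℂ, τ 0 = 0 ∧ ∀ t, HasDerivAt τ (p f + p (E f) * τ t) t := by
    by_cases hc : p (E f) = 0
    · refine ⟨fun t => p f * t, by simp, fun t => ?_⟩
      simpa [hc] using (hasDerivAt_id t).const_mul (p f)
    · refine ⟨fun t => p f * (Complex.exp (p (E f) * t) - 1) / p (E f), by simp, fun t => ?_⟩
      have h1 := (((((hasDerivAt_id t).const_mul (p (E f))).cexp).sub_const 1).const_mul
        (p f)).div_const (p (E f))
      simp only [id] at h1
      have h2 : p f + p (E f) * (p f * (Complex.exp (p (E f) * t) - 1) / p (E f)) =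
          p f * (Complex.exp (p (E f) * t) * (p (E f) * 1)) / p (E f) := by
        field_simp
        ring
      rw [h2]
      exact h1
  obtain ⟨τ, hτ0, hτ⟩ := hτ
  refine ⟨fun t => γ (τ t), by simp [hτ0, h0], fun a t => ?_⟩
  have := (hγ a (τ t)).comp t (hτ t)
  simp only [Derivation.smul_apply, smul_eq_mul, map_mul, hft]
  rw [mul_comm]
  exact this

section Bilinear

open Finset

variable {M₁ M₂ M₃ : Type*} [AddCommGroup M₁] [AddCommGroup M₂] [AddCommGroup M₃]
  [Module ℂ M₁] [Module ℂ M₂] [Module ℂ M₃]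

theorem bilin_pow_apply (f : M₁ →ₗ[ℂ] M₂ →ₗ[ℂ] M₃) {S : Module.End ℂ M₁} {T : Module.End ℂ M₂}
    {U : Module.End ℂ M₃} (h : ∀ a b, U (f a b) = f (S a) b + f a (T b)) (n : ℕ) (a : M₁) (b : M₂) :
    (U ^ n) (f a b) = ∑ ij ∈ antidiagonal n, n.choose ij.1 • f ((S ^ ij.1) a) ((T ^ ij.2) b) := by
  induction n with
  | zero => simp
  | succ n ih =>
    rw [sum_antidiagonal_choose_succ_nsmul
      (M := M₃) (fun i j => f ((S ^ i) a) ((T ^ j) b)) n]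
    simp only [pow_succ', Module.End.mul_apply, ih, map_sum, map_nsmul, h, smul_add,
      sum_add_distrib]
    rw [add_comm]
    congr 1
    refine sum_congr rfl fun ij hij => ?_
    rw [n.choose_symm_of_eq_add (HasAntidiagonal.mem_antidiagonal.1 hij).symm]

theorem bilin_mem_maxGenEigenspace (f : M₁ →ₗ[ℂ] M₂ →ₗ[ℂ] M₃) {S : Module.End ℂ M₁}
    {T : Module.End ℂ M₂} {U : Module.End ℂ M₃} (h : ∀ a b, U (f a b) = f (S a) b + f a (T b))
    {μ ν : ℂ} {a : M₁} {b : M₂} (ha : a ∈ S.maxGenEigenspace μ) (hb : b ∈ T.maxGenEigenspace ν) :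
    f a b ∈ U.maxGenEigenspace (μ + ν) := by
  rw [Module.End.mem_maxGenEigenspace] at *
  obtain ⟨k, hk⟩ := ha
  obtain ⟨l, hl⟩ := hb
  have h' : ∀ a b, (U - (μ + ν) • 1) (f a b) = f ((S - μ • 1) a) b + f a ((T - ν • 1) b) := by
    intro a b
    simp only [LinearMap.sub_apply, LinearMap.smul_apply, Module.End.one_apply, h, map_sub,
      map_smul, add_smul, LinearMap.add_apply]
    abel
  refine ⟨k + l, ?_⟩
  rw [bilin_pow_apply f h']
  refine sum_eq_zero fun ij hij => ?_
  have hij := HasAntidiagonal.mem_antidiagonal.1 hij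
  rcases (by omega : k ≤ ij.1 ∨ l ≤ ij.2) with hk' | hl'
  · rw [Module.End.pow_map_zero_of_le hk' hk]; simp
  · rw [Module.End.pow_map_zero_of_le hl' hl]; simp

end Bilinear

section LocallyFinite

variable {A : Type*} [AddCommGroup A] [Module ℂ A]

theorem Module.End.le_iSup_inf_maxGenEigenspace {δ : Module.End ℂ A} {W : Submodule ℂ A}
    [FiniteDimensional ℂ W] (h : ∀ w ∈ W, δ w ∈ W) :
    W ≤ ⨆ μ, W ⊓ δ.maxGenEigenspace μ := by
  have h1 := Module.End.iSup_maxGenEigenspace_eq_top (δ.restrict h)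
  have h2 : ∀ μ, (Module.End.maxGenEigenspace (δ.restrict h) μ).map W.subtype ≤
      W ⊓ δ.maxGenEigenspace μ := by
    intro μ
    rintro _ ⟨w, hw, rfl⟩
    refine ⟨w.2, ?_⟩
    rw [SetLike.mem_coe, Module.End.mem_maxGenEigenspace] at *
    obtain ⟨k, hk⟩ := hw
    refine ⟨k, ?_⟩
    have h3 : ∀ k (w : W), (((δ - μ • 1 : Module.End ℂ A) ^ k) (w : A)) =
        (((δ.restrict h - μ • 1 : Module.End ℂ W) ^ k) w : W) := by
      intro k
      induction k with
      | zero => simp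
      | succ k ih => intro w; rw [pow_succ, pow_succ]; simp [← ih]
    change ((δ - μ • 1) ^ k) (w : A) = 0
    rw [h3, hk]
    rfl
  calc W = (⊤ : Submodule ℂ W).map W.subtype := by simp
    _ = ⨆ μ, (Module.End.maxGenEigenspace (δ.restrict h) μ).map W.subtype := by
      rw [← h1, Submodule.map_iSup]
    _ ≤ _ := iSup_mono h2

theorem IsLocallyFinite.iSup_maxGenEigenspace {δ : Module.End ℂ A} (h : IsLocallyFinite δ) :
    ⨆ μ, δ.maxGenEigenspace μ = ⊤ := by
  rw [eq_top_iff]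
  intro a _
  obtain ⟨W, hW, ha, hs⟩ := h a
  have h1 : ⨆ μ, W ⊓ δ.maxGenEigenspace μ ≤ ⨆ μ, δ.maxGenEigenspace μ :=
    iSup_mono fun μ => inf_le_right
  exact h1 (Module.End.le_iSup_inf_maxGenEigenspace hs ha)

theorem IsLocallyFinite.exists_jordan {δ : Module.End ℂ A} (h : IsLocallyFinite δ) (φ : ℂ → ℂ) :
    ∃ T : Module.End ℂ A, ∀ μ, ∀ a ∈ δ.maxGenEigenspace μ, T a = φ μ • a := by
  classical
  have hintl : DirectSum.IsInternal (fun μ => δ.maxGenEigenspace μ) :=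
    DirectSum.isInternal_submodule_of_iSupIndep_of_iSup_eq_top
      (Module.End.independent_maxGenEigenspace δ) h.iSup_maxGenEigenspace
  let e := LinearEquiv.ofBijective (DirectSum.coeLinearMap _) hintl
  let U : (DirectSum ℂ fun μ => δ.maxGenEigenspace μ) →ₗ[ℂ] A :=
    DirectSum.toModule ℂ ℂ A (fun μ => φ μ • (δ.maxGenEigenspace μ).subtype)
  refine ⟨U ∘ₗ e.symm.toLinearMap, fun μ a ha => ?_⟩
  have : e.symm a = DirectSum.lof ℂ ℂ _ μ ⟨a, ha⟩ := by
    rw [LinearEquiv.symm_apply_eq]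
    change a = DirectSum.coeLinearMap _ _
    rw [DirectSum.coeLinearMap_lof]
  simp [this, U]

theorem jordan_stable {δ T : Module.End ℂ A} {φ : ℂ → ℂ}
    (hT : ∀ μ, ∀ a ∈ δ.maxGenEigenspace μ, T a = φ μ • a) {W : Submodule ℂ A}
    [FiniteDimensional ℂ W] (h : ∀ w ∈ W, δ w ∈ W) : ∀ w ∈ W, T w ∈ W := by
  intro w hw
  have hw' := Module.End.le_iSup_inf_maxGenEigenspace h hw
  induction hw' using Submodule.iSup_induction' with
  | mem μ x hx =>
    rw [hT μ x hx.2]; exact W.smul_mem _ hx.1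
  | zero => simp
  | add x y hx hy ihx ihy =>
    have := iSup_le (fun μ => (inf_le_left : W ⊓ δ.maxGenEigenspace μ ≤ W))
    rw [map_add]
    exact W.add_mem (ihx (this hx)) (ihy (this hy))

end LocallyFinite

section Stab

variable {A : Type*} [CommRing A] [Algebra ℂ A]

/-- The Lie algebra of derivations preserving a given subspace. -/
def stabDer (V : Submodule ℂ A) : LieSubalgebra ℂ (Derivation ℂ A A) where
  carrier := {δ | ∀ v ∈ V, δ v ∈ V}
  add_mem' ha hb v hv := V.add_mem (ha v hv) (hb v hv)
  zero_mem' v _ := V.zero_mem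
  smul_mem' c _ hx v hv := V.smul_mem c (hx v hv)
  lie_mem' {x y} hx hy v hv := by
    rw [Derivation.commutator_apply]
    exact V.sub_mem (hx _ (hy v hv)) (hy _ (hx v hv))

/-- A finite-dimensional generating subspace containing the unit. -/
structure IsGenSpace (V : Submodule ℂ A) : Prop where
  fin : FiniteDimensional ℂ V
  one_mem : (1 : A) ∈ V
  adjoin : Algebra.adjoin ℂ (V : Set A) = ⊤

variable {V : Submodule ℂ A}

theorem IsGenSpace.finiteDimensional_pow (hV : IsGenSpace V) (n : ℕ) :
    FiniteDimensional ℂ (V ^ n : Submodule ℂ A) := by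
  have := hV.fin
  have h1 : V.FG := (Submodule.fg_iff_finiteDimensional V).2 this
  exact (Submodule.fg_iff_finiteDimensional _).1 (h1.pow n)

theorem stabDer_pow {δ : Derivation ℂ A A} (hδ : δ ∈ stabDer V) (n : ℕ) :
    ∀ v ∈ V ^ n, δ v ∈ V ^ n := by
  induction n with
  | zero =>
    intro v hv
    rw [pow_zero, Submodule.mem_one] at hv
    obtain ⟨c, rfl⟩ := hv
    simp
  | succ n ih =>
    intro v hv
    rw [pow_succ] at hv ⊢
    induction hv using Submodule.mul_induction_on' with
    | mem_mul_mem a ha b hb =>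
      rw [Derivation.leibniz, smul_eq_mul, smul_eq_mul, mul_comm b]
      exact add_mem (Submodule.mul_mem_mul ha (hδ b hb)) (Submodule.mul_mem_mul (ih a ha) hb)
    | add x _ y _ hx hy => rw [map_add]; exact add_mem hx hy

theorem IsGenSpace.exists_mem_pow (hV : IsGenSpace V) (a : A) : ∃ n, a ∈ V ^ n := by
  have hmono : ∀ m n, m ≤ n → V ^ m ≤ V ^ n := fun m n h =>
    pow_le_pow_right₀ (by rw [Submodule.one_le]; exact hV.one_mem) h
  have : a ∈ Algebra.adjoin ℂ (V : Set A) := hV.adjoin ▸ Algebra.mem_top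
  induction this using Algebra.adjoin_induction with
  | mem x hx => exact ⟨1, by simpa using hx⟩
  | algebraMap r => exact ⟨0, by rw [pow_zero]; exact Submodule.mem_one.2 ⟨r, rfl⟩⟩
  | add x y _ _ hx hy =>
    obtain ⟨m, hm⟩ := hx
    obtain ⟨n, hn⟩ := hy
    exact ⟨max m n, add_mem (hmono _ _ (le_max_left _ _) hm) (hmono _ _ (le_max_right _ _) hn)⟩
  | mul x y _ _ hx hy =>
    obtain ⟨m, hm⟩ := hx
    obtain ⟨n, hn⟩ := hy
    exact ⟨m + n, by rw [pow_add]; exact Submodule.mul_mem_mul hm hn⟩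

theorem IsGenSpace.isLocallyFinite (hV : IsGenSpace V) {δ : Derivation ℂ A A}
    (hδ : δ ∈ stabDer V) : IsLocallyFinite (δ : A →ₗ[ℂ] A) := fun a => by
  obtain ⟨n, hn⟩ := hV.exists_mem_pow a
  exact ⟨V ^ n, hV.finiteDimensional_pow n, hn, stabDer_pow hδ n⟩

theorem IsGenSpace.derivation_ext (hV : IsGenSpace V) {δ ε : Derivation ℂ A A}
    (h : ∀ v ∈ V, δ v = ε v) : δ = ε :=
  Derivation.ext_of_adjoin_eq_top _ hV.adjoin (fun v hv => h v hv)

theorem IsGenSpace.finiteDimensional_stabDer (hV : IsGenSpace V) :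
    FiniteDimensional ℂ (stabDer V) := by
  have := hV.fin
  let f : stabDer V →ₗ[ℂ] (V →ₗ[ℂ] V) :=
    { toFun := fun δ => ((δ : Derivation ℂ A A) : A →ₗ[ℂ] A).restrict δ.2
      map_add' := fun x y => by ext; rfl
      map_smul' := fun c x => by ext; rfl }
  refine Module.Finite.of_injective f fun x y hxy => ?_
  refine Subtype.ext (hV.derivation_ext fun v hv => ?_)
  have := congrArg (fun g => ((g ⟨v, hv⟩ : V) : A)) hxy
  exact this

theorem IsGenSpace.stabDer_le (hV : IsGenSpace V) : stabDer V ≤ LieAlgGen A := fun _ hδ =>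
  LieSubalgebra.subset_lieSpan (hV.isLocallyFinite hδ).isCompleteField

theorem Derivation.mul_mem_maxGenEigenspace (δ : Derivation ℂ A A) {μ ν : ℂ} {a b : A}
    (ha : a ∈ Module.End.maxGenEigenspace (δ : A →ₗ[ℂ] A) μ)
    (hb : b ∈ Module.End.maxGenEigenspace (δ : A →ₗ[ℂ] A) ν) :
    a * b ∈ Module.End.maxGenEigenspace (δ : A →ₗ[ℂ] A) (μ + ν) :=
  bilin_mem_maxGenEigenspace (LinearMap.mul ℂ A) (by intro a b; simp; ring) ha hb

theorem IsGenSpace.exists_jordan (hV : IsGenSpace V) {δ : Derivation ℂ A A}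
    (hδ : δ ∈ stabDer V) (φ : ℂ →+ ℂ) : ∃ E ∈ stabDer V,
      ∀ μ, ∀ a ∈ Module.End.maxGenEigenspace (δ : A →ₗ[ℂ] A) μ, E a = φ μ • a := by
  have hlf := hV.isLocallyFinite hδ
  obtain ⟨T, hT⟩ := hlf.exists_jordan φ
  have := hV.fin
  have htop := hlf.iSup_maxGenEigenspace
  have hL : ∀ a b, T (a * b) = a • T b + b • T a := by
    intro a b
    have ha : a ∈ ⨆ μ, Module.End.maxGenEigenspace (δ : A →ₗ[ℂ] A) μ := htop ▸ Submodule.mem_top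
    have hb : b ∈ ⨆ μ, Module.End.maxGenEigenspace (δ : A →ₗ[ℂ] A) μ := htop ▸ Submodule.mem_top
    induction ha using Submodule.iSup_induction' with
    | mem μ x hx =>
      induction hb using Submodule.iSup_induction' with
      | mem ν y hy =>
        rw [hT _ _ (δ.mul_mem_maxGenEigenspace hx hy), hT _ _ hx, hT _ _ hy, map_add φ]
        simp only [map_add, smul_eq_mul, Algebra.smul_def]
        ring
      | zero => simp
      | add y z _ _ hy hz =>
        rw [mul_add, map_add, hy, hz, map_add, add_smul, smul_add]; abel
    | zero => simp
    | add y z _ _ hy hz =>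
        rw [add_mul, map_add, hy, hz, map_add, add_smul, smul_add]; abel
  exact ⟨Derivation.mk' T hL, fun v hv => jordan_stable hT hδ v hv, fun μ a ha => hT μ a ha⟩

theorem Derivation.lie_smul_right (D E : Derivation ℂ A A) (a : A) :
    ⁅D, a • E⁆ = a • ⁅D, E⁆ + D a • E := by
  ext x
  simp [Derivation.commutator_apply]

theorem Derivation.lie_smul_left (D E : Derivation ℂ A A) (a : A) :
    ⁅a • D, E⁆ = a • ⁅D, E⁆ - E a • D := by
  ext x
  simp [Derivation.commutator_apply]
  ring

end Stab

section Nilpotent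

variable {A : Type*}

theorem Module.End.finite_inf_maxGenEigenspace_ne_bot [AddCommGroup A] [Module ℂ A]
    {δ : Module.End ℂ A} {W : Submodule ℂ A} [FiniteDimensional ℂ W] (h : ∀ w ∈ W, δ w ∈ W) :
    {μ | W ⊓ δ.maxGenEigenspace μ ≠ ⊥}.Finite := by
  have h1 : iSupIndep fun μ => Submodule.comap W.subtype (δ.maxGenEigenspace μ) := by
    have h2 := Module.End.independent_maxGenEigenspace δ
    intro μ
    rw [Submodule.disjoint_def]
    intro x hx hx'
    have h3 := (Submodule.disjoint_def.1 (h2 μ)) x hx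
    refine Subtype.ext (h3 ?_)
    have h4 : (⨆ j, ⨆ (_ : j ≠ μ), Submodule.comap W.subtype (δ.maxGenEigenspace j)) ≤
        Submodule.comap W.subtype (⨆ j, ⨆ (_ : j ≠ μ), δ.maxGenEigenspace j) :=
      iSup₂_le fun j hj => Submodule.comap_mono (le_iSup₂_of_le j hj le_rfl)
    exact h4 hx'
  refine (WellFoundedGT.finite_ne_bot_of_iSupIndep h1).subset ?_
  intro μ hμ hbot
  refine hμ (eq_bot_iff.2 fun x hx => ?_)
  have : (⟨x, hx.1⟩ : W) ∈ Submodule.comap W.subtype (δ.maxGenEigenspace μ) := hx.2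
  rw [hbot, Submodule.mem_bot] at this
  exact congrArg Subtype.val this

variable [CommRing A] [Algebra ℂ A]

/-- Locally nilpotent derivations. -/
def IsLND (D : Derivation ℂ A A) : Prop := ∀ a, ∃ n, ((D : A →ₗ[ℂ] A) ^ n) a = 0

theorem isLND_of_iSup {D : Derivation ℂ A A} {ι : Type*} {P : ι → Submodule ℂ A}
    (hP : ⨆ i, P i = ⊤) (h : ∀ i, ∀ a ∈ P i, ∃ n, ((D : A →ₗ[ℂ] A) ^ n) a = 0) : IsLND D := by
  intro a
  have ha : a ∈ ⨆ i, P i := hP ▸ Submodule.mem_top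
  induction ha using Submodule.iSup_induction' with
  | mem i x hx => exact h i x hx
  | zero => exact ⟨0, by simp⟩
  | add x y _ _ hx hy =>
    obtain ⟨m, hm⟩ := hx
    obtain ⟨n, hn⟩ := hy
    refine ⟨max m n, ?_⟩
    rw [map_add, Module.End.pow_map_zero_of_le (le_max_left m n) hm,
      Module.End.pow_map_zero_of_le (le_max_right m n) hn, add_zero]

variable {V : Submodule ℂ A}

theorem IsGenSpace.isLND_of_shift (hV : IsGenSpace V) {δ ε : Derivation ℂ A A}
    (hδ : δ ∈ stabDer V) (hε : ε ∈ stabDer V) {c : ℂ} (hc : c ≠ 0)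
    (hs : ∀ μ, ∀ a ∈ Module.End.maxGenEigenspace (δ : A →ₗ[ℂ] A) μ,
      ε a ∈ Module.End.maxGenEigenspace (δ : A →ₗ[ℂ] A) (μ + c)) : IsLND ε := by
  refine isLND_of_iSup (hV.isLocallyFinite hδ).iSup_maxGenEigenspace fun μ a ha => ?_
  obtain ⟨n, hn⟩ := hV.exists_mem_pow a
  have := hV.finiteDimensional_pow n
  have hfin := Module.End.finite_inf_maxGenEigenspace_ne_bot (δ := (δ : A →ₗ[ℂ] A)) (W := V ^ n)
    (stabDer_pow hδ n)
  have hmem : ∀ m : ℕ, ((ε : A →ₗ[ℂ] A) ^ m) a ∈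
      V ^ n ⊓ Module.End.maxGenEigenspace (δ : A →ₗ[ℂ] A) (μ + m * c) := by
    intro m
    induction m with
    | zero =>
      exact ⟨hn, by simpa only [Nat.cast_zero, zero_mul, add_zero, pow_zero, Module.End.one_apply,
        SetLike.mem_coe] using ha⟩
    | succ m ih =>
      rw [pow_succ', Module.End.mul_apply]
      refine ⟨stabDer_pow hε n _ ih.1, ?_⟩
      have := hs _ _ ih.2
      rw [show μ + ((m + 1 : ℕ) : ℂ) * c = μ + m * c + c by push_cast; ring]
      exact this
  have hinj : Function.Injective fun m : ℕ => μ + m * c := by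
    intro i j hij
    simpa [hc] using hij
  obtain ⟨m, hm⟩ := (hfin.preimage hinj.injOn).exists_notMem
  refine ⟨m, ?_⟩
  have h2 : V ^ n ⊓ Module.End.maxGenEigenspace (δ : A →ₗ[ℂ] A) (μ + m * c) = ⊥ := by
    simpa using hm
  have := hmem m
  rwa [h2, Submodule.mem_bot] at this

theorem IsLND.exists_local_slice {D : Derivation ℂ A A} (hD : IsLND D) (h0 : D ≠ 0) :
    ∃ s, D s ≠ 0 ∧ D (D s) = 0 := by
  classical
  obtain ⟨a, ha⟩ : ∃ a, D a ≠ 0 := by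
    by_contra! h
    exact h0 (Derivation.ext h)
  have hex := hD a
  have hn := Nat.find_spec hex
  have hlt : ∀ m < Nat.find hex, ((D : A →ₗ[ℂ] A) ^ m) a ≠ 0 := fun m hm => Nat.find_min hex hm
  obtain ⟨k, hk⟩ : ∃ k, Nat.find hex = k + 2 := by
    rcases h : Nat.find hex with _ | _ | k
    · rw [h] at hn
      simp only [pow_zero, Module.End.one_apply] at hn
      rw [hn] at ha; simp at ha
    · rw [h] at hn
      simp at hn
      exact absurd hn ha
    · exact ⟨k, rfl⟩
  rw [hk] at hn hlt
  refine ⟨((D : A →ₗ[ℂ] A) ^ k) a, ?_, ?_⟩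
  · have := hlt (k + 1) (by omega)
    rwa [pow_succ', Module.End.mul_apply] at this
  · rwa [pow_succ', pow_succ', Module.End.mul_apply, Module.End.mul_apply] at hn

theorem IsLND.eq_zero_of_ker [IsDomain A] {D Δ : Derivation ℂ A A} (hD : IsLND D) {s : A}
    (hs : D s ≠ 0) (hs2 : D (D s) = 0) (hΔ : ∀ a, D a = 0 → Δ a = 0) (hΔs : Δ s = 0) : Δ = 0 := by
  have hker : ∀ n k a, D k = 0 → ((D : A →ₗ[ℂ] A) ^ n) (k * a) = k * ((D : A →ₗ[ℂ] A) ^ n) a := by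
    intro n k
    induction n with
    | zero => simp
    | succ n ih =>
      intro a hk
      rw [pow_succ', Module.End.mul_apply, ih a hk, Module.End.mul_apply]
      simp [hk]
  have hpow : ∀ n : ℕ, ((D : A →ₗ[ℂ] A) ^ n) (s ^ n) = n.factorial * D s ^ n := by
    intro n
    induction n with
    | zero => simp
    | succ n ih =>
      rw [pow_succ, Module.End.mul_apply]
      have : (D : A →ₗ[ℂ] A) (s ^ (n + 1)) = ((n + 1 : ℕ) * D s) * s ^ n := by
        simp [Derivation.leibniz_pow]; ring
      rw [this, hker, ih, Nat.factorial_succ]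
      · push_cast; ring
      · simp [hs2]
  suffices h : ∀ n a, ((D : A →ₗ[ℂ] A) ^ n) a = 0 → Δ a = 0 by
    ext a
    obtain ⟨n, hn⟩ := hD a
    exact h n a hn
  intro n
  induction n with
  | zero => intro a ha; simp at ha; simp [ha]
  | succ n ih =>
    intro a ha
    have hc : D (((D : A →ₗ[ℂ] A) ^ n) a) = 0 := by
      rwa [pow_succ', Module.End.mul_apply] at ha
    have hk : D ((n.factorial : A) * D s ^ n) = 0 := by
      simp [hs2, Derivation.leibniz_pow]
    have h1 := ih ((n.factorial * D s ^ n) * a - (((D : A →ₗ[ℂ] A) ^ n) a) * s ^ n) (by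
      rw [map_sub, hker _ _ _ hk, hker _ _ _ hc, hpow]; ring)
    rw [map_sub, Derivation.leibniz _ (_ * _) a, Derivation.leibniz _ _ (s ^ n), hΔ _ hk, hΔ _ hc,
      Derivation.leibniz_pow, hΔs] at h1
    simp only [smul_zero, add_zero, sub_zero, smul_eq_mul, mul_zero] at h1
    refine (mul_eq_zero.1 h1).resolve_left (mul_ne_zero ?_ (pow_ne_zero _ hs))
    have : CharZero A := charZero_of_injective_algebraMap (algebraMap ℂ A).injective
    exact_mod_cast n.factorial_ne_zero

end Nilpotent

theorem Submodule.exists_smul_le_of_fg {A M : Type*} [CommRing A] [IsDomain A]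
    [AddCommGroup M] [Module A M]
    (N T : Submodule A M) (hfg : T.FG) (hT : ∀ x ∈ T, ∃ t : A, t ≠ 0 ∧ t • x ∈ N) :
    ∃ t : A, t ≠ 0 ∧ ∀ x ∈ T, t • x ∈ N := by
  obtain ⟨s, rfl⟩ := hfg
  choose! t ht htN using hT
  refine ⟨∏ x ∈ s, t x, Finset.prod_ne_zero_iff.2 fun x hx => ht x (Submodule.subset_span hx),
    fun x hx => ?_⟩
  induction hx using Submodule.span_induction with
  | mem x hx =>
    obtain ⟨c, hc⟩ := Finset.dvd_prod_of_mem t hx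
    rw [hc, mul_comm, mul_smul]
    exact N.smul_mem _ (htN x (Submodule.subset_span hx))
  | zero => simp
  | add x y _ _ hx hy => rw [smul_add]; exact N.add_mem hx hy
  | smul a x _ hx => rw [smul_comm]; exact N.smul_mem _ hx

section ModPart

variable (A : Type*) [CommRing A] [Algebra ℂ A]

/-- The largest module of derivations contained in the Lie algebra generated by complete fields. -/
def modPart : Submodule A (Derivation ℂ A A) where
  carrier := {n | ∀ a : A, a • n ∈ LieAlgGen A}
  add_mem' hx hy a := by rw [smul_add]; exact add_mem (hx a) (hy a)
  zero_mem' a := by rw [smul_zero]; exact zero_mem _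
  smul_mem' b x hx a := by rw [smul_smul]; exact hx _

variable {A}

theorem modPart_le {n : Derivation ℂ A A} (h : n ∈ modPart A) : n ∈ LieAlgGen A := by
  simpa using h 1

theorem lie_mem_modPart {m n : Derivation ℂ A A} (hm : m ∈ LieAlgGen A) (hn : n ∈ modPart A) :
    ⁅m, n⁆ ∈ modPart A := by
  intro a
  have h := Derivation.lie_smul_right m n a
  rw [eq_comm, ← eq_sub_iff_add_eq] at h
  rw [h]
  exact sub_mem (LieSubalgebra.lie_mem _ hm (hn a)) (hn _)

theorem lie_mem_modPart' {m n : Derivation ℂ A A} (hm : m ∈ LieAlgGen A) (hn : n ∈ modPart A) :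
    ⁅n, m⁆ ∈ modPart A := by
  rw [← lie_skew]
  exact neg_mem (lie_mem_modPart hm hn)

theorem apply_smul_mem_modPart {E n : Derivation ℂ A A} {f : A} (hE : E ∈ LieAlgGen A)
    (hfE : f • E ∈ LieAlgGen A) (hn : n ∈ modPart A) : n f • E ∈ modPart A := by
  intro a
  have h := Derivation.lie_smul_right (a • n) E f
  have h2 : a • n f • E = ⁅a • n, f • E⁆ - f • ⁅a • n, E⁆ := by
    rw [h, add_sub_cancel_left, smul_smul]; rfl
  rw [h2]
  refine sub_mem (LieSubalgebra.lie_mem _ (hn a) hfE) ?_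
  exact lie_mem_modPart' hE ((modPart A).smul_mem a hn) f

/-- The data extracted from a homogeneous space: a finite-dimensional Lie algebra of locally
finite derivations of full generic rank and without invariant ideals. -/
structure IsHomSetup (V : Submodule ℂ A) : Prop extends IsGenSpace V where
  rank : ∀ D : Derivation ℂ A A, ∃ t : A, t ≠ 0 ∧
    t • D ∈ Submodule.span A (stabDer V : Set (Derivation ℂ A A))
  simple : ∀ I : Ideal A, (∀ δ ∈ stabDer V, ∀ a ∈ I, δ a ∈ I) → I = ⊥ ∨ I = ⊤
  point : Nonempty (A →ₐ[ℂ] ℂ)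

variable {V : Submodule ℂ A}

theorem IsGenSpace.isNoetherian (hV : IsGenSpace V) : IsNoetherian A (Derivation ℂ A A) := by
  have := hV.fin
  have hfg : Algebra.FiniteType ℂ A := by
    obtain ⟨s, hs⟩ := (Submodule.fg_iff_finiteDimensional V).2 hV.fin
    refine ⟨⟨s, ?_⟩⟩
    rw [← Algebra.adjoin_span, hs, hV.adjoin]
  have : IsNoetherianRing A := Algebra.FiniteType.isNoetherianRing ℂ A
  let b := Module.finBasis ℂ V
  let f : Derivation ℂ A A →ₗ[A] (Fin (Module.finrank ℂ V) → A) :=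
    { toFun := fun D i => D (b i)
      map_add' := fun x y => rfl
      map_smul' := fun c x => rfl }
  refine isNoetherian_of_injective f fun x y hxy => hV.derivation_ext fun v hv => ?_
  have h1 : ((x : A →ₗ[ℂ] A) ∘ₗ V.subtype) = ((y : A →ₗ[ℂ] A) ∘ₗ V.subtype) :=
    b.ext fun i => congrFun hxy i
  exact congrArg (fun g => g ⟨v, hv⟩) h1

theorem smul_mem_lieAlgGen {E : Derivation ℂ A A} (hE : IsCompleteField E) {f : A}
    (h : E (E f) = 0) : f • E ∈ LieAlgGen A :=
  LieSubalgebra.subset_lieSpan (hE.smul_of_sq_eq_zero h)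

variable [IsDomain A]

theorem IsHomSetup.saturated (hV : IsHomSetup V) {t : A} (ht : t ≠ 0) {D : Derivation ℂ A A}
    (hD : t • D ∈ modPart A) : D ∈ modPart A := by
  have := hV.isNoetherian
  let T : Submodule A (Derivation ℂ A A) :=
    { carrier := {D | ∃ t : A, t ≠ 0 ∧ t • D ∈ modPart A}
      add_mem' := by
        rintro x y ⟨s, hs, hsx⟩ ⟨t, ht, hty⟩
        refine ⟨s * t, mul_ne_zero hs ht, ?_⟩
        rw [smul_add]
        refine add_mem ?_ ?_
        · rw [mul_comm, mul_smul]; exact Submodule.smul_mem _ _ hsx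
        · rw [mul_smul]; exact Submodule.smul_mem _ _ hty
      zero_mem' := ⟨1, one_ne_zero, by simp⟩
      smul_mem' := by
        rintro c x ⟨s, hs, hsx⟩
        exact ⟨s, hs, by rw [smul_comm]; exact Submodule.smul_mem _ _ hsx⟩ }
  have hTst : ∀ δ ∈ stabDer V, ∀ D ∈ T, ⁅δ, D⁆ ∈ T := by
    rintro δ hδ D ⟨t, ht, htD⟩
    refine ⟨t * t, mul_ne_zero ht ht, ?_⟩
    have h := Derivation.lie_smul_right δ D t
    have h2 : (t * t) • ⁅δ, D⁆ = t • ⁅δ, t • D⁆ - δ t • t • D := by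
      rw [h, smul_add, smul_smul, smul_comm t (δ t) D, add_sub_cancel_right]
    rw [h2]
    exact sub_mem (Submodule.smul_mem _ _ (lie_mem_modPart (hV.stabDer_le hδ) htD))
      (Submodule.smul_mem _ _ htD)
  let I : Ideal A :=
    { carrier := {a | ∀ D ∈ T, a • D ∈ modPart A}
      add_mem' := fun ha hb D hD => by rw [add_smul]; exact add_mem (ha D hD) (hb D hD)
      zero_mem' := fun D _ => by simp
      smul_mem' := fun c a ha D hD => by
        rw [smul_assoc]; exact Submodule.smul_mem _ _ (ha D hD) }
  have hI : I = ⊤ := by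
    refine (hV.simple I ?_).resolve_left ?_
    · intro δ hδ a ha D hD
      have h := Derivation.lie_smul_right δ D a
      have h2 : δ a • D = ⁅δ, a • D⁆ - a • ⁅δ, D⁆ := by rw [h, add_sub_cancel_left]
      rw [h2]
      exact sub_mem (lie_mem_modPart (hV.stabDer_le hδ) (ha D hD)) (ha _ (hTst δ hδ D hD))
    · obtain ⟨t, ht, h⟩ := Submodule.exists_smul_le_of_fg (modPart A) T (IsNoetherian.noetherian T)
        (fun x hx => hx)
      intro hbot
      have : t ∈ I := h
      rw [hbot] at this
      exact ht this
  have h1 : (1 : A) ∈ I := hI ▸ Submodule.mem_top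
  simpa using h1 D ⟨t, ht, hD⟩

theorem IsHomSetup.mem_of_apply_ne (hV : IsHomSetup V) {E n : Derivation ℂ A A} {f : A}
    (hE : E ∈ LieAlgGen A)
    (hfE : f • E ∈ LieAlgGen A) (hn : n ∈ modPart A) (h : n f ≠ 0) : E ∈ modPart A :=
  hV.saturated h (apply_smul_mem_modPart hE hfE hn)

theorem IsHomSetup.isLND_mem (hV : IsHomSetup V) (hN : modPart A ≠ ⊥) {D : Derivation ℂ A A}
    (hD : D ∈ stabDer V) (hnil : IsLND D) : D ∈ modPart A := by
  by_contra hcon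
  have hD0 : D ≠ 0 := fun h => hcon (h ▸ zero_mem _)
  obtain ⟨n, hn, hn0⟩ := Submodule.exists_mem_ne_zero_of_ne_bot hN
  have hc : IsCompleteField D := (hV.isLocallyFinite hD).isCompleteField
  have key : ∀ f, D (D f) = 0 → n f = 0 := fun f hf => by
    by_contra h
    exact hcon (hV.mem_of_apply_ne (hV.stabDer_le hD) (smul_mem_lieAlgGen hc hf) hn h)
  obtain ⟨s, hs, hs2⟩ := hnil.exists_local_slice hD0
  exact hn0 (hnil.eq_zero_of_ker hs hs2 (fun a ha => key a (by simp [ha])) (key s hs2))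

end ModPart

section Functionals

open nonZeroDivisors

theorem Submodule.exists_dual_ne_zero_of_saturated {A M : Type*} [CommRing A] [IsDomain A]
    [AddCommGroup M] [Module A M] [Module.Finite A M] (N : Submodule A M) {x : M}
    (hx : ∀ t : A, t ≠ 0 → t • x ∉ N) : ∃ l : M →ₗ[A] A, (∀ y ∈ N, l y = 0) ∧ l x ≠ 0 := by
  let K := FractionRing A
  let L := LocalizedModule A⁰ (M ⧸ N)
  let g : (M ⧸ N) →ₗ[A] L := LocalizedModule.mkLinearMap A⁰ (M ⧸ N)
  have hgx : g (N.mkQ x) ≠ 0 := by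
    intro h
    obtain ⟨t, ht⟩ := (IsLocalizedModule.eq_zero_iff A⁰ g).1 h
    refine hx t (nonZeroDivisors.coe_ne_zero t) ?_
    rw [← Submodule.ker_mkQ N, LinearMap.mem_ker, map_smul]
    exact ht
  obtain ⟨f, hf⟩ := Module.Projective.exists_dual_ne_zero K hgx
  let F : M →ₗ[A] K := f.restrictScalars A ∘ₗ g ∘ₗ N.mkQ
  obtain ⟨s, hs⟩ := (Module.Finite.fg_top : (⊤ : Submodule A M).FG)
  classical
  obtain ⟨d, hd⟩ := IsLocalization.exist_integer_multiples_of_finset A⁰ (s.image F)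
  have hr : ∀ m, ((d : A) • F) m ∈ LinearMap.range (Algebra.linearMap A K) := by
    intro m
    have hm : m ∈ Submodule.span A (s : Set M) := hs ▸ Submodule.mem_top
    induction hm using Submodule.span_induction with
    | mem y hy =>
      obtain ⟨b, hb⟩ := hd (F y) (Finset.mem_image_of_mem _ hy)
      exact ⟨b, hb⟩
    | zero => simp
    | add y z _ _ hy hz => rw [map_add]; exact add_mem hy hz
    | smul a y _ hy => rw [map_smul]; exact Submodule.smul_mem _ _ hy
  have hinj : Function.Injective (Algebra.linearMap A K) := IsFractionRing.injective A K
  let e := LinearEquiv.ofInjective (Algebra.linearMap A K) hinj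
  refine ⟨e.symm.toLinearMap ∘ₗ ((d : A) • F).codRestrict _ hr, fun y hy => ?_, fun h => ?_⟩
  · have : F y = 0 := by simp [F, (Submodule.Quotient.mk_eq_zero N).2 hy]
    simp only [LinearMap.comp_apply, LinearEquiv.coe_coe, EmbeddingLike.map_eq_zero_iff]
    exact Subtype.ext (by simp [this])
  · simp only [LinearMap.comp_apply, LinearEquiv.coe_coe, EmbeddingLike.map_eq_zero_iff] at h
    have h2 : (d : A) • F x = 0 := congrArg Subtype.val h
    rw [Algebra.smul_def] at h2
    rcases mul_eq_zero.1 h2 with h3 | h3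
    · exact nonZeroDivisors.coe_ne_zero d (hinj (h3.trans (map_zero _).symm))
    · exact hf h3

theorem functional_mem_of_apply_mem {A : Type*} [CommRing A] [Algebra ℂ A]
    [Algebra.FiniteType ℂ A] [Algebra.FormallySmooth ℂ A] (l : Derivation ℂ A A →ₗ[A] A)
    {E : Derivation ℂ A A} {J : Ideal A} (hE : ∀ a, E a ∈ J) : l E ∈ J := by
  obtain ⟨n, f, hf⟩ := Module.Finite.exists_fin' A (Ω[A⁄ℂ])
  obtain ⟨s, hs⟩ := LinearMap.exists_rightInverse_of_surjective f (LinearMap.range_eq_top.2 hf)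
  have hlift : ∀ ω, E.liftKaehlerDifferential ω ∈ J := by
    intro ω
    have hω : ω ∈ Submodule.span A (Set.range (KaehlerDifferential.D ℂ A)) :=
      KaehlerDifferential.span_range_derivation ℂ A ▸ Submodule.mem_top
    induction hω using Submodule.span_induction with
    | mem y hy =>
      obtain ⟨a, rfl⟩ := hy
      rw [Derivation.liftKaehlerDifferential_comp_D]
      exact hE a
    | zero => simp
    | add y z _ _ hy hz => rw [map_add]; exact add_mem hy hz
    | smul a y _ hy => rw [map_smul]; exact J.mul_mem_left _ hy
  let θ : Fin n → Derivation ℂ A A := fun i =>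
    (LinearMap.proj i ∘ₗ s).compDer (KaehlerDifferential.D ℂ A)
  have hsum : E = ∑ i, E.liftKaehlerDifferential (f (Pi.single i 1)) • θ i := by
    ext a
    have h1 : E a = E.liftKaehlerDifferential (f (s (KaehlerDifferential.D ℂ A a))) := by
      have h2 := LinearMap.congr_fun hs (KaehlerDifferential.D ℂ A a)
      rw [LinearMap.comp_apply, LinearMap.id_apply] at h2
      rw [h2, Derivation.liftKaehlerDifferential_comp_D]
    rw [h1]
    conv_lhs => rw [LinearMap.pi_apply_eq_sum_univ f]
    rw [map_sum]
    have h2 : (∑ i, E.liftKaehlerDifferential (f (Pi.single i 1)) • θ i) a =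
        ∑ i, E.liftKaehlerDifferential (f (Pi.single i 1)) * θ i a := by
      rw [← Derivation.coeFnAddMonoidHom_apply, map_sum, Finset.sum_apply]
      rfl
    rw [h2]
    refine Finset.sum_congr rfl fun i _ => ?_
    rw [map_smul, smul_eq_mul, mul_comm]
    congr 3
    ext j
    simp [Pi.single_apply, eq_comm]
  rw [hsum, map_sum]
  refine J.sum_mem fun i _ => ?_
  rw [map_smul, smul_eq_mul]
  exact J.mul_mem_right _ (hlift _)

end Functionals

section Semisimple

variable {A : Type*} [CommRing A] [Algebra ℂ A]

/-- A derivation is rationally semisimple if it is diagonalizable with rational eigenvalues. -/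
def IsRatSemisimple (E : Derivation ℂ A A) : Prop :=
  ⨆ q : ℚ, Module.End.eigenspace (E : A →ₗ[ℂ] A) (q : ℂ) = ⊤

theorem IsRatSemisimple.eq_of_eigen {E : Derivation ℂ A A} (hE : IsRatSemisimple E)
    {M : Type*} [AddCommGroup M] [Module ℂ M]
    {S T : A →ₗ[ℂ] M} (h : ∀ (q : ℚ) (a : A), E a = (q : ℂ) • a → S a = T a) : S = T := by
  ext a
  have ha : a ∈ ⨆ q : ℚ, Module.End.eigenspace (E : A →ₗ[ℂ] A) (q : ℂ) := hE ▸ Submodule.mem_top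
  induction ha using Submodule.iSup_induction' with
  | mem q x hx => exact h q x (Module.End.mem_eigenspace_iff.1 hx)
  | zero => simp
  | add x y _ _ hx hy => rw [map_add, map_add, hx, hy]

theorem Derivation.apply_mul_eigen {E : Derivation ℂ A A} {r s : ℂ} {x y : A}
    (hx : E x = r • x) (hy : E y = s • y) : E (x * y) = (r + s) • (x * y) := by
  rw [Derivation.leibniz, hx, hy, smul_eq_mul, smul_eq_mul]
  simp only [Algebra.smul_def, map_add]
  ring

theorem Derivation.apply_pow_eigen {E : Derivation ℂ A A} {r : ℂ} {x : A}
    (hx : E x = r • x) (n : ℕ) : E (x ^ n) = (n * r) • x ^ n := by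
  induction n with
  | zero => simp
  | succ n ih =>
    rw [pow_succ, Derivation.apply_mul_eigen ih hx]
    congr 1
    push_cast
    ring

theorem cross_of_opposite [IsDomain A] {E n : Derivation ℂ A A} (hn : ∀ a, E a = 0 → n a = 0)
    {r s : ℚ} (hr : r < 0) (hs : 0 < s) {x y : A} (hx : E x = (r : ℂ) • x)
    (hy : E y = (s : ℂ) • y) : (s : ℂ) • (y * n x) = (r : ℂ) • (x * n y) := by
  by_cases hx0 : x = 0
  · simp [hx0]
  by_cases hy0 : y = 0
  · simp [hy0]
  obtain ⟨i, j, hij⟩ : ∃ i j : ℕ, ((i + 1 : ℕ) : ℚ) * r + ((j + 1 : ℕ) : ℚ) * s = 0 := by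
    have h1 : 0 < s.num := Rat.num_pos.2 hs
    have h2 : r.num < 0 := Rat.num_neg.2 hr
    have h3 := r.den_pos
    have h4 := s.den_pos
    obtain ⟨u, hu⟩ : ∃ u : ℕ, s.num = u + 1 := ⟨(s.num - 1).toNat, by omega⟩
    obtain ⟨v, hv⟩ : ∃ v : ℕ, r.num = -(v + 1) := ⟨(-r.num - 1).toNat, by omega⟩
    have hA : (0:ℕ) < (u + 1) * r.den := by positivity
    have hB : (0:ℕ) < (v + 1) * s.den := by positivity
    refine ⟨(u + 1) * r.den - 1, (v + 1) * s.den - 1, ?_⟩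
    rw [Nat.sub_add_cancel hA, Nat.sub_add_cancel hB]
    have e1 : (r.den : ℚ) * r = r.num := by rw [mul_comm]; exact Rat.mul_den_eq_num r
    have e2 : (s.den : ℚ) * s = s.num := by rw [mul_comm]; exact Rat.mul_den_eq_num s
    push_cast
    rw [mul_assoc, mul_assoc, e1, e2, hu, hv]
    push_cast
    ring
  have hij' : ((i + 1 : ℕ) : ℂ) * (r : ℂ) + ((j + 1 : ℕ) : ℂ) * (s : ℂ) = 0 := by exact_mod_cast hij
  have h0 : n (x ^ (i + 1) * y ^ (j + 1)) = 0 := by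
    apply hn
    rw [Derivation.apply_mul_eigen (Derivation.apply_pow_eigen hx _)
      (Derivation.apply_pow_eigen hy _), hij', zero_smul]
  have h1 : (((i + 1 : ℕ) : ℂ)) • (y * n x) + ((j + 1 : ℕ) : ℂ) • (x * n y) = 0 := by
    have h2 : (x ^ i * y ^ j) *
        ((((i + 1 : ℕ) : ℂ)) • (y * n x) + ((j + 1 : ℕ) : ℂ) • (x * n y)) = 0 := by
      rw [← h0]
      rw [Derivation.leibniz, Derivation.leibniz_pow, Derivation.leibniz_pow]
      simp only [smul_eq_mul, nsmul_eq_mul, Nat.add_sub_cancel]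
      simp only [Algebra.smul_def, map_natCast]
      ring
    exact (mul_eq_zero.1 h2).resolve_left (mul_ne_zero (pow_ne_zero _ hx0) (pow_ne_zero _ hy0))
  have hi : ((i + 1 : ℕ) : ℂ) ≠ 0 := by exact_mod_cast Nat.succ_ne_zero i
  have h3 : ((i + 1 : ℕ) : ℂ) • ((s : ℂ) • (y * n x) - (r : ℂ) • (x * n y)) = 0 := by
    have h4 : ((i + 1 : ℕ) : ℂ) • ((s : ℂ) • (y * n x) - (r : ℂ) • (x * n y)) =
        (s : ℂ) • ((((i + 1 : ℕ) : ℂ)) • (y * n x) + ((j + 1 : ℕ) : ℂ) • (x * n y)) -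
        (((i + 1 : ℕ) : ℂ) * (r : ℂ) + ((j + 1 : ℕ) : ℂ) * (s : ℂ)) • (x * n y) := by
      module
    rw [h4, h1, hij']
    simp
  exact sub_eq_zero.1 ((smul_eq_zero.1 h3).resolve_left hi)

theorem cross_of_signs [IsDomain A] {E n : Derivation ℂ A A} (hE : IsRatSemisimple E)
    (hn : ∀ a, E a = 0 → n a = 0)
    {p q : ℚ} (hq : q < 0) (hp : 0 < p) {f g : A} (hg0 : g ≠ 0) (hf : E f = (p : ℂ) • f)
    (hg : E g = (q : ℂ) • g) : ((p : ℂ) • f) • n = n f • E := by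
  have key : ∀ a, (((p : ℂ) • f) • n) a = (n f • E) a := by
    have := hE.eq_of_eigen (S := ((((p : ℂ) • f) • n : Derivation ℂ A A) : A →ₗ[ℂ] A))
      (T := ((n f • E : Derivation ℂ A A) : A →ₗ[ℂ] A)) ?_
    · exact fun a => congrArg (fun g => g a) this
    intro r a ha
    simp only [Derivation.coeFn_coe, Derivation.smul_apply, smul_eq_mul, ha]
    rw [smul_mul_assoc, mul_smul_comm, mul_comm (n f)]
    rcases lt_trichotomy r 0 with hr | rfl | hr
    · exact cross_of_opposite hn hr hp ha hf
    · simp only [Rat.cast_zero, zero_smul] at ha ⊢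
      rw [hn a ha]; simp
    · have h1 := cross_of_opposite hn hq hp hg hf
      have h2 := cross_of_opposite hn hq hr hg ha
      have hq' : (q : ℂ) ≠ 0 := by exact_mod_cast hq.ne
      have h3 : ((q : ℂ) • g) * ((p : ℂ) • (f * n a) - (r : ℂ) • (a * n f)) = 0 := by
        have e1 : ((q : ℂ) • g) * ((p : ℂ) • (f * n a) - (r : ℂ) • (a * n f)) =
          ((p : ℂ) • f) * ((q : ℂ) • (g * n a)) - (r : ℂ) • a * ((q : ℂ) • (g * n f)) := by
            simp only [Algebra.smul_def]; ring
        rw [e1, ← h1, ← h2]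
        simp only [Algebra.smul_def]; ring
      exact sub_eq_zero.1 ((mul_eq_zero.1 h3).resolve_left
        (smul_ne_zero hq' hg0))
  exact Derivation.ext key

theorem Module.End.maxGenEigenspace_le_of_iSup_eigenspace {M : Type*} [AddCommGroup M] [Module ℂ M]
    {f : Module.End ℂ M} {ι : Type*} {c : ι → ℂ} (hf : ⨆ i, f.eigenspace (c i) = ⊤) (μ : ℂ) :
    f.maxGenEigenspace μ ≤ f.eigenspace μ := by
  intro a ha
  have h1 : (⊤ : Submodule ℂ M) ≤ f.eigenspace μ ⊔
      ⨆ ν, ⨆ (_ : ν ≠ μ), f.maxGenEigenspace ν := by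
    rw [← hf]
    refine iSup_le fun i => ?_
    by_cases hq : c i = μ
    · rw [hq]; exact le_sup_left
    · exact le_sup_of_le_right
        (le_iSup₂_of_le (c i) hq (Module.End.eigenspace_le_maxGenEigenspace))
  obtain ⟨x, hx, y, hy, hxy⟩ := Submodule.mem_sup.1 (h1 (Submodule.mem_top : a ∈ ⊤))
  have hx' := Module.End.eigenspace_le_maxGenEigenspace hx
  have hy' : y ∈ f.maxGenEigenspace μ := by
    rw [← add_sub_cancel_left x y, hxy]
    exact sub_mem ha hx'
  have := Submodule.disjoint_def.1 (Module.End.independent_maxGenEigenspace f μ) y hy' hy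
  rw [← hxy, this, add_zero]
  exact hx

end Semisimple

section Weights

variable {A : Type*} [CommRing A] [Algebra ℂ A]

theorem Derivation.apply_mem_maxGenEigenspace {δ ε : Derivation ℂ A A} {c μ : ℂ} {a : A}
    (hε : ε ∈ Module.End.maxGenEigenspace (LieAlgebra.ad ℂ (Derivation ℂ A A) δ) c)
    (ha : a ∈ Module.End.maxGenEigenspace (δ : A →ₗ[ℂ] A) μ) :
    ε a ∈ Module.End.maxGenEigenspace (δ : A →ₗ[ℂ] A) (μ + c) := by
  let f : Derivation ℂ A A →ₗ[ℂ] A →ₗ[ℂ] A :=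
    { toFun := fun D => (D : A →ₗ[ℂ] A)
      map_add' := fun _ _ => rfl
      map_smul' := fun _ _ => rfl }
  rw [add_comm]
  refine bilin_mem_maxGenEigenspace f (S := LieAlgebra.ad ℂ (Derivation ℂ A A) δ) ?_ hε ha
  intro D b
  change δ (D b) = ⁅δ, D⁆ b + D (δ b)
  rw [Derivation.commutator_apply, sub_add_cancel]

variable {V : Submodule ℂ A}

theorem IsGenSpace.isLND_of_ad (hV : IsGenSpace V) {δ ε : Derivation ℂ A A}
    (hδ : δ ∈ stabDer V) (hε : ε ∈ stabDer V) {c : ℂ} (hc : c ≠ 0)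
    (h : ε ∈ Module.End.maxGenEigenspace (LieAlgebra.ad ℂ (Derivation ℂ A A) δ) c) : IsLND ε :=
  hV.isLND_of_shift hδ hε hc fun _ _ ha => Derivation.apply_mem_maxGenEigenspace h ha

theorem IsGenSpace.stabDer_le_iSup (hV : IsGenSpace V) {δ : Derivation ℂ A A}
    (hδ : δ ∈ stabDer V) : (stabDer V).toSubmodule ≤ ⨆ c, (stabDer V).toSubmodule ⊓
      Module.End.maxGenEigenspace (LieAlgebra.ad ℂ (Derivation ℂ A A) δ) c := by
  have := hV.finiteDimensional_stabDer
  have : FiniteDimensional ℂ (stabDer V).toSubmodule := this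
  exact Module.End.le_iSup_inf_maxGenEigenspace fun w hw => LieSubalgebra.lie_mem _ hδ hw

theorem isLND_sub_of_eigen {δ S : Derivation ℂ A A}
    (htop : ⨆ μ, Module.End.maxGenEigenspace (δ : A →ₗ[ℂ] A) μ = ⊤)
    (hSe : ∀ μ, ∀ a ∈ Module.End.maxGenEigenspace (δ : A →ₗ[ℂ] A) μ, S a = μ • a) :
    IsLND (δ - S) := by
  refine isLND_of_iSup htop fun μ a ha => ?_
  obtain ⟨k, hk⟩ := (Module.End.mem_maxGenEigenspace _ _ _).1 ha
  refine ⟨k, ?_⟩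
  rw [← hk]
  suffices h : ∀ m : ℕ, (((δ - S : Derivation ℂ A A) : A →ₗ[ℂ] A) ^ m) a =
      (((δ : A →ₗ[ℂ] A) - μ • (1 : Module.End ℂ A)) ^ m) a ∧
      (((δ : A →ₗ[ℂ] A) - μ • (1 : Module.End ℂ A)) ^ m) a ∈
        Module.End.maxGenEigenspace (δ : A →ₗ[ℂ] A) μ from (h k).1
  intro m
  induction m with
  | zero => exact ⟨rfl, ha⟩
  | succ m ih =>
    rw [pow_succ', pow_succ', Module.End.mul_apply, Module.End.mul_apply, ih.1]
    have h2 := hSe _ _ ih.2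
    refine ⟨?_, ?_⟩
    · simp only [Derivation.coeFn_coe, Derivation.sub_apply, LinearMap.sub_apply]
      rw [h2]
      rfl
    · rw [LinearMap.sub_apply]
      refine sub_mem ?_ (Submodule.smul_mem _ _ ih.2)
      exact Module.End.mapsTo_maxGenEigenspace_of_comm (Commute.refl (δ : Module.End ℂ A)) μ ih.2

theorem IsRatSemisimple.neg {E : Derivation ℂ A A} (hE : IsRatSemisimple E) :
    IsRatSemisimple (-E) := by
  rw [IsRatSemisimple, eq_top_iff, ← hE]
  refine iSup_le fun q => le_iSup_of_le (-q) fun a ha => ?_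
  rw [Module.End.mem_eigenspace_iff] at *
  simp only [Derivation.coeFn_coe, Derivation.neg_apply] at *
  rw [ha]; push_cast; rw [neg_smul]

variable [IsDomain A]

theorem IsHomSetup.lie_ratSemisimple_mem (hV : IsHomSetup V) (hN : modPart A ≠ ⊥)
    {E δ : Derivation ℂ A A} (hE : E ∈ stabDer V) (hr : IsRatSemisimple E) (hδ : δ ∈ stabDer V) :
    ⁅δ, E⁆ ∈ modPart A := by
  have h := hV.stabDer_le_iSup hE hδ
  clear hδ
  induction h using Submodule.iSup_induction' with
  | mem c ε hε =>
    by_cases hc : c = 0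
    · subst hc
      have h0 : ⁅ε, E⁆ = 0 := by
        ext a
        have := hr.eq_of_eigen (S := ((⁅ε, E⁆ : Derivation ℂ A A) : A →ₗ[ℂ] A)) (T := 0) ?_
        · exact congrArg (fun g => g a) this
        intro q a ha
        have h1 := Derivation.apply_mem_maxGenEigenspace hε.2
          (Module.End.eigenspace_le_maxGenEigenspace (Module.End.mem_eigenspace_iff.2 ha))
        have h2 := Module.End.mem_eigenspace_iff.1
          (Module.End.maxGenEigenspace_le_of_iSup_eigenspace hr _ h1)
        simp only [Derivation.coeFn_coe, add_zero] at h2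
        change ⁅ε, E⁆ a = 0
        simp [Derivation.commutator_apply, h2, ha]
      rw [h0]
      exact zero_mem _
    · exact lie_mem_modPart' (hV.stabDer_le hE) (hV.isLND_mem hN hε.1 (hV.isLND_of_ad hE hε.1 hc hε.2))
  | zero => simp
  | add x y _ _ hx hy => rw [add_lie]; exact add_mem hx hy

theorem IsRatSemisimple.exists_ideal {E : Derivation ℂ A A} (hr : IsRatSemisimple E)
    (hs : ∀ (q : ℚ) (a : A), a ≠ 0 → E a = (q : ℂ) • a → 0 ≤ q) :
    ∃ J : Ideal A, J ≠ ⊤ ∧ ∀ a, E a ∈ J := by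
  let P : Submodule ℂ A := ⨆ q : {q : ℚ // 0 < q}, Module.End.eigenspace (E : A →ₗ[ℂ] A) (q : ℂ)
  have hmul : ∀ (c x : A), x ∈ P → c * x ∈ P := by
    intro c x hx
    have hc : c ∈ ⨆ q : ℚ, Module.End.eigenspace (E : A →ₗ[ℂ] A) (q : ℂ) := hr ▸ Submodule.mem_top
    induction hc using Submodule.iSup_induction' with
    | mem r c hc =>
      by_cases hc0 : c = 0
      · rw [hc0, zero_mul]; exact zero_mem _
      have hr0 := hs r c hc0 (Module.End.mem_eigenspace_iff.1 hc)
      induction hx using Submodule.iSup_induction' with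
      | mem q x hx =>
        refine Submodule.mem_iSup_of_mem ⟨r + q.1, by have := q.2; linarith⟩ ?_
        rw [Module.End.mem_eigenspace_iff] at *
        have := Derivation.apply_mul_eigen hc hx
        push_cast
        exact this
      | zero => simp
      | add x y _ _ hx hy => rw [mul_add]; exact add_mem hx hy
    | zero => simp
    | add x y _ _ hx hy => rw [add_mul]; exact add_mem hx hy
  let J : Ideal A :=
    { carrier := P
      add_mem' := fun ha hb => P.add_mem ha hb
      zero_mem' := P.zero_mem
      smul_mem' := fun c x hx => hmul c x hx }
  refine ⟨J, fun hJ => ?_, fun a => ?_⟩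
  · have h1 : (1 : A) ∈ P := show (1 : A) ∈ J from hJ ▸ Submodule.mem_top
    have h2 : (1 : A) ∈ Module.End.maxGenEigenspace (E : A →ₗ[ℂ] A) 0 :=
      Module.End.eigenspace_le_maxGenEigenspace (Module.End.mem_eigenspace_iff.2 (by simp))
    have h3 : P ≤ ⨆ ν, ⨆ (_ : ν ≠ (0 : ℂ)), Module.End.maxGenEigenspace (E : A →ₗ[ℂ] A) ν :=
      iSup_le fun q => le_iSup₂_of_le ((q : ℚ) : ℂ) (by exact_mod_cast q.2.ne')
        Module.End.eigenspace_le_maxGenEigenspace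
    exact one_ne_zero (Submodule.disjoint_def.1
      (Module.End.independent_maxGenEigenspace (E : Module.End ℂ A) (0 : ℂ)) 1 h2 (h3 h1))
  · change E a ∈ P
    have ha : a ∈ ⨆ q : ℚ, Module.End.eigenspace (E : A →ₗ[ℂ] A) (q : ℂ) := hr ▸ Submodule.mem_top
    induction ha using Submodule.iSup_induction' with
    | mem q a ha =>
      rw [Module.End.mem_eigenspace_iff] at ha
      have ha' : E a = (q : ℂ) • a := ha
      rw [ha']
      by_cases ha0 : a = 0
      · simp [ha0]
      rcases (hs q a ha0 ha').eq_or_lt with h | h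
      · simp [← h]
      · exact P.smul_mem _ (Submodule.mem_iSup_of_mem ⟨q, h⟩ (Module.End.mem_eigenspace_iff.2 ha))
    | zero => simp
    | add x y _ _ hx hy => rw [map_add]; exact add_mem hx hy

variable [Algebra.FormallySmooth ℂ A]

theorem IsHomSetup.ratSemisimple_mem_of_nonneg (hV : IsHomSetup V) (hN : modPart A ≠ ⊥)
    {E : Derivation ℂ A A} (hE : E ∈ stabDer V) (hr : IsRatSemisimple E)
    (hs : ∀ (q : ℚ) (a : A), a ≠ 0 → E a = (q : ℂ) • a → 0 ≤ q) : E ∈ modPart A := by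
  by_contra hcon
  have := hV.isNoetherian
  have : Algebra.FiniteType ℂ A := by
    obtain ⟨s, hs⟩ := (Submodule.fg_iff_finiteDimensional V).2 hV.fin
    refine ⟨⟨s, ?_⟩⟩
    rw [← Algebra.adjoin_span, hs, hV.adjoin]
  obtain ⟨J, hJ, hEJ⟩ := hr.exists_ideal hs
  obtain ⟨l, hl, hlE⟩ := Submodule.exists_dual_ne_zero_of_saturated (modPart A) (x := E)
    fun t ht h => hcon (hV.saturated ht h)
  let I : Ideal A :=
    { carrier := {b | ∃ l : Derivation ℂ A A →ₗ[A] A, (∀ n ∈ modPart A, l n = 0) ∧ l E = b}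
      add_mem' := by
        rintro _ _ ⟨l, hl, rfl⟩ ⟨m, hm, rfl⟩
        exact ⟨l + m, fun n hn => by simp [hl n hn, hm n hn], rfl⟩
      zero_mem' := ⟨0, fun _ _ => rfl, rfl⟩
      smul_mem' := by
        rintro c _ ⟨l, hl, rfl⟩
        exact ⟨c • l, fun n hn => by simp [hl n hn], rfl⟩ }
  have hI : I = ⊤ := by
    refine (hV.simple I ?_).resolve_left fun h => hlE ?_
    · rintro δ hδ _ ⟨l, hl, rfl⟩
      refine ⟨{ toFun := fun D => δ (l D) - l ⁅δ, D⁆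
                map_add' := fun x y => by simp only [lie_add, map_add]; ring
                map_smul' := fun c x => ?_ }, fun n hn => ?_, ?_⟩
      · simp only [Derivation.lie_smul_right, map_add, map_smul, smul_eq_mul, Derivation.leibniz,
          RingHom.id_apply]
        ring
      · have := hl _ (lie_mem_modPart (hV.stabDer_le hδ) hn)
        simp [hl n hn, this]
      · have := hl _ (hV.lie_ratSemisimple_mem hN hE hr hδ)
        simp [this]
    · have : l E ∈ I := ⟨l, hl, rfl⟩
      rwa [h] at this
  obtain ⟨m, -, hm⟩ : (1 : A) ∈ I := hI ▸ Submodule.mem_top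
  have := functional_mem_of_apply_mem m hEJ
  rw [hm] at this
  exact hJ ((Ideal.eq_top_iff_one J).2 this)

theorem IsHomSetup.ratSemisimple_mem (hV : IsHomSetup V) (hN : modPart A ≠ ⊥)
    {E : Derivation ℂ A A} (hE : E ∈ stabDer V) (hr : IsRatSemisimple E) : E ∈ modPart A := by
  by_cases h1 : ∀ (q : ℚ) (a : A), a ≠ 0 → E a = (q : ℂ) • a → 0 ≤ q
  · exact hV.ratSemisimple_mem_of_nonneg hN hE hr h1
  by_cases h2 : ∀ (q : ℚ) (a : A), a ≠ 0 → E a = (q : ℂ) • a → q ≤ 0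
  · rw [← neg_neg E]
    refine neg_mem (hV.ratSemisimple_mem_of_nonneg hN (neg_mem hE) hr.neg fun q a ha h => ?_)
    have := h2 (-q) a ha (by push_cast; rw [neg_smul, ← h]; simp)
    linarith
  push Not at h1 h2
  obtain ⟨q, g, hg0, hg, hq⟩ := h1
  obtain ⟨p, f, hf0, hf, hp⟩ := h2
  by_contra hcon
  obtain ⟨n, hn, hn0⟩ := Submodule.exists_mem_ne_zero_of_ne_bot hN
  have hc : IsCompleteField E := (hV.isLocallyFinite hE).isCompleteField
  have key : ∀ f, E f = 0 → n f = 0 := fun f hf => by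
    by_contra h
    exact hcon (hV.mem_of_apply_ne (hV.stabDer_le hE) (smul_mem_lieAlgGen hc (by simp [hf])) hn h)
  have hcr := cross_of_signs hr key hq hp hg0 hf hg
  have hpc : (p : ℂ) ≠ 0 := by exact_mod_cast hp.ne'
  by_cases hnf : n f = 0
  · rw [hnf, zero_smul] at hcr
    apply hn0
    ext a
    have h3 := congrArg (fun D => D a) hcr
    simp only [Derivation.smul_apply, smul_eq_mul, Derivation.zero_apply] at h3
    simpa [hpc, hf0] using h3
  · exact hcon (hV.saturated hnf (hcr ▸ (modPart A).smul_mem _ hn))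

theorem IsHomSetup.stabDer_le_modPart (hV : IsHomSetup V) (hN : modPart A ≠ ⊥)
    {δ : Derivation ℂ A A} (hδ : δ ∈ stabDer V) : δ ∈ modPart A := by
  have hlf := hV.isLocallyFinite hδ
  have htop := hlf.iSup_maxGenEigenspace
  obtain ⟨S, hS, hSe⟩ := hV.exists_jordan hδ (AddMonoidHom.id ℂ)
  have h1 : δ - S ∈ modPart A :=
    hV.isLND_mem hN (sub_mem hδ hS) (isLND_sub_of_eigen htop hSe)
  let b := Module.Basis.ofVectorSpace ℚ ℂ
  let φ : Module.Basis.ofVectorSpaceIndex ℚ ℂ → ℂ →+ ℂ := fun i =>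
    { toFun := fun x => ((b.repr x i : ℚ) : ℂ)
      map_zero' := by simp
      map_add' := by intro x y; simp }
  choose T hT hTe using fun i => hV.exists_jordan hδ (φ i)
  have hTm : ∀ i, T i ∈ modPart A := by
    intro i
    refine hV.ratSemisimple_mem hN (hT i) ?_
    rw [IsRatSemisimple, eq_top_iff, ← htop]
    refine iSup_le fun μ => le_iSup_of_le (b.repr μ i) fun a ha => ?_
    rw [Module.End.mem_eigenspace_iff]
    exact hTe i μ a ha
  have := hV.fin
  have hfin := Module.End.finite_inf_maxGenEigenspace_ne_bot (δ := (δ : A →ₗ[ℂ] A)) (W := V) hδ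
  classical
  let F := hfin.toFinset.biUnion fun μ => (b.repr μ).support
  have hsum : S = ∑ i ∈ F, (b i) • T i := by
    refine hV.derivation_ext fun v hv => ?_
    have hv' := Module.End.le_iSup_inf_maxGenEigenspace (δ := (δ : A →ₗ[ℂ] A)) hδ hv
    have hev : ∀ a, (∑ i ∈ F, (b i) • T i) a = ∑ i ∈ F, (b i) • T i a := by
      intro a
      rw [← Derivation.coeFnAddMonoidHom_apply, map_sum, Finset.sum_apply]
      rfl
    rw [hev]
    clear hv
    induction hv' using Submodule.iSup_induction' with
    | mem μ x hx =>
      by_cases hx0 : x = 0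
      · simp [hx0]
      have hμ : μ ∈ hfin.toFinset := by
        rw [Set.Finite.mem_toFinset]
        intro hbot
        exact hx0 ((Submodule.mem_bot ℂ).1 (hbot ▸ hx))
      rw [hSe μ x hx.2]
      have h3 : μ = ∑ i ∈ F, (b.repr μ i) • b i := by
        conv_lhs => rw [← b.linearCombination_repr μ]
        rw [Finsupp.linearCombination_apply, Finsupp.sum_of_support_subset]
        · exact Finset.subset_biUnion_of_mem (fun μ => (b.repr μ).support) hμ
        · simp
      change μ • x = _
      conv_lhs => rw [h3, Finset.sum_smul]
      refine Finset.sum_congr rfl fun i _ => ?_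
      rw [hTe i μ x hx.2, smul_smul]
      congr 1
      change _ = b i * ((b.repr μ i : ℚ) : ℂ)
      rw [Rat.smul_def, mul_comm]
    | zero => simp
    | add x y _ _ hx hy => simp only [map_add, smul_add, Finset.sum_add_distrib, hx, hy]
  have h4 : S ∈ modPart A := by
    rw [hsum]
    exact sum_mem fun i _ => Submodule.smul_of_tower_mem _ _ (hTm i)
  rw [← sub_add_cancel δ S]
  exact add_mem h1 h4

theorem IsHomSetup.hasADP (hV : IsHomSetup V) (hN : modPart A ≠ ⊥) : HasADP A := by
  rw [HasADP, eq_top_iff]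
  intro D _
  obtain ⟨t, ht, h⟩ := hV.rank D
  refine modPart_le (hV.saturated ht ?_)
  exact Submodule.span_le.2 (fun δ hδ => hV.stabDer_le_modPart hN hδ) h

end Weights

section JointEigen

theorem exists_joint_eigenvector {L M : Type*} [LieRing L] [LieAlgebra ℂ L]
    [AddCommGroup M] [Module ℂ M] [LieRingModule L M] [LieModule ℂ L M] [LieAlgebra.IsSolvable L]
    (U : LieSubmodule ℂ L M) [FiniteDimensional ℂ U] (hU : U ≠ ⊥) :
    ∃ χ : Module.Dual ℂ L, ∃ v ∈ U, v ≠ 0 ∧ ∀ x, ⁅x, v⁆ = χ x • v := by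
  have : Nontrivial U := by rwa [LieSubmodule.nontrivial_iff_ne_bot]
  obtain ⟨χ, h⟩ := LieModule.exists_nontrivial_weightSpace_of_isSolvable ℂ L U
  obtain ⟨⟨v, hv⟩, hv0⟩ := exists_ne (0 : LieModule.weightSpace U χ)
  rw [LieModule.mem_weightSpace] at hv
  refine ⟨χ, v, v.2, ?_, fun x => congrArg Subtype.val (hv x)⟩
  intro h0
  exact hv0 (Subtype.ext (Subtype.ext h0))

theorem Module.Dual.apply_lie_eq_zero {L M : Type*} [LieRing L] [LieAlgebra ℂ L]
    [AddCommGroup M] [Module ℂ M] [LieRingModule L M] [LieModule ℂ L M]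
    {χ : Module.Dual ℂ L} {v : M} (hv0 : v ≠ 0) (hv : ∀ x, ⁅x, v⁆ = χ x • v) (x y : L) :
    χ ⁅x, y⁆ = 0 := by
  have h := hv ⁅x, y⁆
  rw [lie_lie, hv, hv, lie_smul, lie_smul, hv, hv, smul_smul, smul_smul, mul_comm, sub_self] at h
  exact (smul_eq_zero.1 h.symm).resolve_right hv0

theorem Module.Dual.apply_derivedSeries_eq_zero {L M : Type*} [LieRing L] [LieAlgebra ℂ L]
    [AddCommGroup M] [Module ℂ M] [LieRingModule L M] [LieModule ℂ L M]
    {χ : Module.Dual ℂ L} {v : M} (hv0 : v ≠ 0) (hv : ∀ x, ⁅x, v⁆ = χ x • v) {x : L}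
    (hx : x ∈ LieAlgebra.derivedSeries ℂ L 1) : χ x = 0 := by
  replace hx : x ∈ (LieAlgebra.derivedSeries ℂ L 1).toLieSubalgebra.toSubmodule := hx
  rw [LieAlgebra.coe_derivedSeries_one_eq] at hx
  induction hx using Submodule.span_induction with
  | mem z hz =>
    obtain ⟨x, y, rfl⟩ := hz
    exact Module.Dual.apply_lie_eq_zero hv0 hv x y
  | zero => simp
  | add x y _ _ hx hy => rw [map_add, hx, hy, add_zero]
  | smul c x _ hx => rw [map_smul, hx, smul_zero]

variable {A : Type*} [CommRing A] [Algebra ℂ A] {V : Submodule ℂ A}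

theorem IsGenSpace.exists_joint_eigenvector (hV : IsGenSpace V) [LieAlgebra.IsSolvable (stabDer V)]
    (U : Submodule ℂ A) (hst : ∀ δ ∈ stabDer V, ∀ u ∈ U, δ u ∈ U) (hU : U ≠ ⊥) :
    ∃ χ : Module.Dual ℂ (stabDer V), ∃ v ∈ U, v ≠ 0 ∧ ∀ δ : stabDer V,
      (δ : Derivation ℂ A A) v = χ δ • v := by
  obtain ⟨u, hu, hu0⟩ := Submodule.exists_mem_ne_zero_of_ne_bot hU
  obtain ⟨n, hn⟩ := hV.exists_mem_pow u
  let W : LieSubmodule ℂ (stabDer V) A :=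
    { toSubmodule := U ⊓ V ^ n
      lie_mem := fun {δ m} hm => ⟨hst δ δ.2 m hm.1, stabDer_pow δ.2 n m hm.2⟩ }
  have := hV.finiteDimensional_pow n
  have hW : W ≠ ⊥ := fun h => by
    have : u ∈ W := ⟨hu, hn⟩
    rw [h] at this
    exact hu0 this
  have : FiniteDimensional ℂ W :=
    Submodule.finiteDimensional_inf_right (U : Submodule ℂ A) (V ^ n : Submodule ℂ A)
  obtain ⟨χ, v, hv, hv0, h⟩ := _root_.exists_joint_eigenvector W hW
  exact ⟨χ, v, hv.1, hv0, h⟩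

theorem IsHomSetup.isUnit_of_eigen (hV : IsHomSetup V) {k : A} (hk : k ≠ 0)
    (h : ∀ δ ∈ stabDer V, ∃ c : ℂ, δ k = c • k) : IsUnit k := by
  have := hV.simple (Ideal.span {k}) ?_
  · rw [← Ideal.span_singleton_eq_top]
    refine this.resolve_left ?_
    rwa [Ideal.span_singleton_eq_bot]
  intro δ hδ a ha
  obtain ⟨b, rfl⟩ := Ideal.mem_span_singleton'.1 ha
  obtain ⟨c, hc⟩ := h δ hδ
  rw [Derivation.leibniz, hc, smul_eq_mul, smul_eq_mul, mul_smul_comm, ← smul_mul_assoc, mul_comm k,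
    ← add_mul]
  exact Ideal.mul_mem_left _ _ (Ideal.mem_span_singleton_self k)

theorem IsGenSpace.isLND_of_mem_derivedSeries (hV : IsGenSpace V)
    [LieAlgebra.IsSolvable (stabDer V)] {D : stabDer V}
    (hD : D ∈ LieAlgebra.derivedSeries ℂ (stabDer V) 1) {χ : Module.Dual ℂ (stabDer V)}
    (hχ : ∀ δ, ⁅δ, D⁆ = χ δ • D) : IsLND (D : Derivation ℂ A A) := by
  have hχ' : ∀ δ : stabDer V, ⁅(δ : Derivation ℂ A A), (D : Derivation ℂ A A)⁆ =
    χ δ • (D : Derivation ℂ A A) := fun δ => congrArg Subtype.val (hχ δ)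
  by_cases h : ∃ δ, χ δ ≠ 0
  · obtain ⟨δ, hδ⟩ := h
    exact hV.isLND_of_ad δ.2 D.2 hδ (Module.End.eigenspace_le_maxGenEigenspace
      (Module.End.mem_eigenspace_iff.2 (hχ' δ)))
  push Not at h
  have hcomm : ∀ δ : stabDer V, ∀ a, (δ : Derivation ℂ A A) ((D : Derivation ℂ A A) a) =
      (D : Derivation ℂ A A) ((δ : Derivation ℂ A A) a) := by
    intro δ a
    have := congrArg (fun X => X a) (hχ' δ)
    simp only [h, zero_smul, Derivation.zero_apply, Derivation.commutator_apply] at this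
    exact sub_eq_zero.1 this
  refine isLND_of_iSup (hV.isLocallyFinite D.2).iSup_maxGenEigenspace fun μ a ha => ?_
  by_cases hμ : μ = 0
  · subst hμ
    obtain ⟨k, hk⟩ := (Module.End.mem_maxGenEigenspace _ _ _).1 ha
    exact ⟨k, by simpa only [zero_smul, sub_zero] using hk⟩
  by_cases hbot : Module.End.maxGenEigenspace ((D : Derivation ℂ A A) : A →ₗ[ℂ] A) μ = ⊥
  · rw [hbot] at ha
    exact ⟨0, by simpa using ha⟩
  obtain ⟨ψ, v, hv, hv0, hψ⟩ := hV.exists_joint_eigenvector _ (fun δ hδ u hu =>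
    Module.End.mapsTo_maxGenEigenspace_of_comm (f := ((D : Derivation ℂ A A) : A →ₗ[ℂ] A))
      (g := (δ : A →ₗ[ℂ] A)) (LinearMap.ext fun a => (hcomm ⟨δ, hδ⟩ a).symm) μ hu) hbot
  exfalso
  have h1 : ψ D = 0 := Module.Dual.apply_derivedSeries_eq_zero (M := A) hv0 hψ hD
  have h2 : v ∈ Module.End.maxGenEigenspace ((D : Derivation ℂ A A) : A →ₗ[ℂ] A) 0 := by
    refine Module.End.eigenspace_le_maxGenEigenspace (Module.End.mem_eigenspace_iff.2 ?_)
    have := hψ D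
    rwa [h1] at this
  exact hv0 (Submodule.disjoint_def.1
    ((Module.End.independent_maxGenEigenspace ((D : Derivation ℂ A A) : Module.End ℂ A)).pairwiseDisjoint hμ)
    v hv h2)

end JointEigen

section LocFin

variable {A : Type*} [CommRing A] [Algebra ℂ A]

/-- The subalgebra on which a derivation is locally finite. -/
def locFin (E : Derivation ℂ A A) : Subalgebra ℂ A where
  carrier := {a | ∃ W : Submodule ℂ A, FiniteDimensional ℂ W ∧ a ∈ W ∧ ∀ w ∈ W, E w ∈ W}
  mul_mem' := by
    rintro a b ⟨W, hW, ha, hs⟩ ⟨W', hW', hb, hs'⟩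
    refine ⟨W * W', ?_, Submodule.mul_mem_mul ha hb, fun w hw => ?_⟩
    · rw [← Submodule.fg_iff_finiteDimensional] at *
      exact hW.mul hW'
    · induction hw using Submodule.mul_induction_on' with
      | mem_mul_mem x hx y hy =>
        rw [Derivation.leibniz, smul_eq_mul, smul_eq_mul, mul_comm y]
        exact add_mem (Submodule.mul_mem_mul hx (hs' y hy)) (Submodule.mul_mem_mul (hs x hx) hy)
      | add x _ y _ hx hy => rw [map_add]; exact add_mem hx hy
  add_mem' := by
    rintro a b ⟨W, hW, ha, hs⟩ ⟨W', hW', hb, hs'⟩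
    refine ⟨W ⊔ W', inferInstance, add_mem (Submodule.mem_sup_left ha) (Submodule.mem_sup_right hb),
      fun w hw => ?_⟩
    obtain ⟨x, hx, y, hy, rfl⟩ := Submodule.mem_sup.1 hw
    rw [map_add]
    exact add_mem (Submodule.mem_sup_left (hs x hx)) (Submodule.mem_sup_right (hs' y hy))
  algebraMap_mem' := fun r => ⟨Submodule.span ℂ {algebraMap ℂ A r}, inferInstance,
    Submodule.mem_span_singleton_self _, fun w hw => by
      obtain ⟨c, rfl⟩ := Submodule.mem_span_singleton.1 hw
      simp⟩

theorem mem_locFin {E : Derivation ℂ A A} {a : A} : a ∈ locFin E ↔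
    ∃ W : Submodule ℂ A, FiniteDimensional ℂ W ∧ a ∈ W ∧ ∀ w ∈ W, E w ∈ W := Iff.rfl

theorem IsLND.induction_of_slice {D : Derivation ℂ A A} (hD : IsLND D) {s : A} (hs : D s = 1)
    {P : A → Prop} (h : ∀ (c : A) (n : ℕ), D c = 0 → P (c * s ^ n))
    (hadd : ∀ a b, P a → P b → P (a + b)) (a : A) : P a := by
  have hker : ∀ n k a, D k = 0 → ((D : A →ₗ[ℂ] A) ^ n) (k * a) = k * ((D : A →ₗ[ℂ] A) ^ n) a := by
    intro n k
    induction n with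
    | zero => simp
    | succ n ih =>
      intro a hk
      rw [pow_succ', Module.End.mul_apply, ih a hk, Module.End.mul_apply]
      simp [hk]
  have hpow : ∀ n : ℕ, ((D : A →ₗ[ℂ] A) ^ n) (s ^ n) = n.factorial := by
    intro n
    induction n with
    | zero => simp
    | succ n ih =>
      rw [pow_succ, Module.End.mul_apply]
      have : (D : A →ₗ[ℂ] A) (s ^ (n + 1)) = ((n + 1 : ℕ) : A) * s ^ n := by
        simp [Derivation.leibniz_pow, hs]
      rw [this, hker, ih, Nat.factorial_succ]
      · push_cast; ring
      · simp
  suffices h : ∀ n a, ((D : A →ₗ[ℂ] A) ^ n) a = 0 → P a by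
    obtain ⟨n, hn⟩ := hD a
    exact h n a hn
  intro n
  induction n with
  | zero =>
    intro a ha
    simp only [pow_zero, Module.End.one_apply] at ha
    subst ha
    simpa using h 0 0 (map_zero D)
  | succ n ih =>
    intro a ha
    let c := algebraMap ℂ A (n.factorial : ℂ)⁻¹ * ((D : A →ₗ[ℂ] A) ^ n) a
    have hc : D c = 0 := by
      rw [pow_succ', Module.End.mul_apply] at ha
      have ha' : D (((D : A →ₗ[ℂ] A) ^ n) a) = 0 := ha
      simp [c, ha']
    have h1 := ih (a - c * s ^ n) (by
      rw [map_sub, hker _ _ _ hc, hpow]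
      have : algebraMap ℂ A (n.factorial : ℂ)⁻¹ * (n.factorial : A) = 1 := by
        rw [← map_natCast (algebraMap ℂ A), ← map_mul, inv_mul_cancel₀, map_one]
        exact_mod_cast n.factorial_ne_zero
      simp only [c]
      rw [mul_right_comm, this, one_mul, sub_self])
    have := hadd _ _ h1 (h c n hc)
    rwa [sub_add_cancel] at this

end LocFin

section Slice

variable {A : Type*} [CommRing A] [Algebra ℂ A] [IsDomain A] {V : Submodule ℂ A}

theorem IsLND.nonempty_polynomial_equiv {D : Derivation ℂ A A} (hD : IsLND D) {s : A}
    (hs : D s = 1) (hK : ∀ a, D a = 0 → a ∈ (algebraMap ℂ A).range) :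
    Nonempty (A ≃ₐ[ℂ] Polynomial ℂ) := by
  refine ⟨(AlgEquiv.ofBijective (Polynomial.aeval (R := ℂ) s) ⟨?_, fun a => ?_⟩).symm⟩
  · rw [injective_iff_map_eq_zero]
    intro p
    induction hn : p.natDegree using Nat.strong_induction_on generalizing p with
    | _ n ih =>
      intro hp
      have h1 := D.map_aeval p s
      rw [hp, map_zero, hs, smul_eq_mul, mul_one] at h1
      by_cases h0 : p.natDegree = 0
      · rw [Polynomial.eq_C_of_natDegree_eq_zero h0] at hp ⊢
        rw [Polynomial.aeval_C] at hp
        rw [(map_eq_zero_iff _ (algebraMap ℂ A).injective).1 hp, map_zero]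
      · have h2 := ih _ (hn ▸ Polynomial.natDegree_derivative_lt h0) _ rfl h1.symm
        exact absurd (Polynomial.derivative_eq_zero.1 h2) h0
  · refine hD.induction_of_slice hs (P := fun a => ∃ p, Polynomial.aeval s p = a) ?_ ?_ a
    · intro c n hc
      obtain ⟨z, rfl⟩ := hK c hc
      exact ⟨Polynomial.C z * Polynomial.X ^ n, by simp⟩
    · rintro _ _ ⟨p, rfl⟩ ⟨q, rfl⟩
      exact ⟨p + q, map_add _ _ _⟩

theorem IsGenSpace.modPart_ne_bot_of_slice (hV : IsGenSpace V) {D δ : Derivation ℂ A A}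
    (hD : IsLND D) (hDV : D ∈ stabDer V) (hδ : δ ∈ stabDer V) {c : ℂ} (hc : ⁅δ, D⁆ = c • D)
    {s : A} (hs : D s = 1)
    {x : A} (hx : D x = 0) (hδx : δ x ≠ 0) : modPart A ≠ ⊥ := by
  let E := δ - δ s • D
  have hEs : E s = 0 := by simp [E, hs]
  have hEK : ∀ a, D a = 0 → E a = δ a := fun a ha => by simp [E, ha]
  have hδK : ∀ a, D a = 0 → D (δ a) = 0 := by
    intro a ha
    have h := congrArg (fun X => X a) hc
    simpa [Derivation.commutator_apply, ha] using h
  have hE : IsCompleteField E := by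
    refine IsLocallyFinite.isCompleteField fun a => mem_locFin.1 ?_
    refine hD.induction_of_slice hs (P := fun a => a ∈ locFin E) ?_ (fun a b => add_mem) a
    intro k n hk
    refine mul_mem ?_ (pow_mem ?_ n)
    · obtain ⟨W, hW, hkW, hst⟩ := hV.isLocallyFinite hδ k
      refine ⟨W ⊓ LinearMap.ker (D : A →ₗ[ℂ] A), inferInstance, ⟨hkW, hk⟩, ?_⟩
      rintro w ⟨hw1, hw2⟩
      have hw2' : D w = 0 := hw2
      rw [hEK w hw2']
      exact ⟨hst w hw1, hδK w hw2'⟩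
    · refine ⟨Submodule.span ℂ {s}, inferInstance, Submodule.mem_span_singleton_self _, ?_⟩
      intro w hw
      obtain ⟨z, rfl⟩ := Submodule.mem_span_singleton.1 hw
      simp [hEs]
  have hDc : IsCompleteField D := (hV.isLocallyFinite hDV).isCompleteField
  have key : ∀ a b, D a = 0 → E b = 0 → (a * b) • E ∈ LieAlgGen A := by
    intro a b ha hb
    have e1 := smul_mem_lieAlgGen hDc (f := a) (by simp [ha])
    have e2 := smul_mem_lieAlgGen hDc (f := a * s) (by simp [ha, hs])
    have e3 := smul_mem_lieAlgGen hE (f := b) (by simp [hb])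
    have e4 := smul_mem_lieAlgGen hE (f := b * s) (by simp [hb, hEs])
    have h1 : (a * b) • E = ⁅a • D, (b * s) • E⁆ - ⁅(a * s) • D, b • E⁆ := by
      ext y
      simp only [Derivation.commutator_apply, Derivation.smul_apply, Derivation.sub_apply,
        smul_eq_mul, Derivation.leibniz, hs, hEs]
      ring
    rw [h1]
    exact sub_mem (LieSubalgebra.lie_mem _ e1 e4) (LieSubalgebra.lie_mem _ e2 e3)
  have hEN : E ∈ modPart A := by
    intro a
    refine hD.induction_of_slice hs (P := fun a => a • E ∈ LieAlgGen A) ?_ ?_ a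
    · intro k n hk
      exact key k (s ^ n) hk (by simp [Derivation.leibniz_pow, hEs])
    · intro a b ha hb
      rw [add_smul]
      exact add_mem ha hb
  intro hbot
  rw [hbot, Submodule.mem_bot] at hEN
  apply hδx
  rw [← hEK x hx, hEN, Derivation.zero_apply]

theorem IsHomSetup.modPart_ne_bot_of_lnd (hV : IsHomSetup V) [LieAlgebra.IsSolvable (stabDer V)]
    (hline : IsEmpty (A ≃ₐ[ℂ] Polynomial ℂ)) {D : Derivation ℂ A A} (hDV : D ∈ stabDer V)
    (hD0 : D ≠ 0) (hD : IsLND D) (hχ : ∀ δ ∈ stabDer V, ∃ c : ℂ, ⁅δ, D⁆ = c • D) :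
    modPart A ≠ ⊥ := by
  have hcomm : ∀ δ ∈ stabDer V, ∃ c : ℂ, ∀ a, δ (D a) = D (δ a) + c • D a := by
    intro δ hδ
    obtain ⟨c, hc⟩ := hχ δ hδ
    refine ⟨c, fun a => ?_⟩
    have h := congrArg (fun X => X a) hc
    simp only [Derivation.commutator_apply, Derivation.smul_apply] at h
    rw [← h]; ring
  let U : Submodule ℂ A := LinearMap.range (D : A →ₗ[ℂ] A) ⊓ LinearMap.ker (D : A →ₗ[ℂ] A)
  obtain ⟨χ, k, ⟨⟨s', hs'⟩, hk⟩, hk0, hkχ⟩ := hV.toIsGenSpace.exists_joint_eigenvector U (by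
      rintro δ hδ _ ⟨⟨s, rfl⟩, h2⟩
      have h2' : D (D s) = 0 := h2
      obtain ⟨c, hc⟩ := hcomm δ hδ
      refine ⟨⟨δ s + c • s, ?_⟩, ?_⟩
      · rw [map_add, map_smul]
        exact (hc s).symm
      · have := hc (D s)
        rw [h2', map_zero, smul_zero, add_zero] at this
        exact this.symm) (by
      obtain ⟨s, hs, hs2⟩ := hD.exists_local_slice hD0
      intro hbot
      have : D s ∈ U := ⟨⟨s, rfl⟩, hs2⟩
      rw [hbot] at this
      exact hs this)
  obtain ⟨u, rfl⟩ := hV.isUnit_of_eigen hk0 fun δ hδ => ⟨_, hkχ ⟨δ, hδ⟩⟩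
  have hs'' : D s' = u := hs'
  have hk' : D (u : A) = 0 := hk
  have hu : D ((u⁻¹ : Aˣ) : A) = 0 := by
    have h := D.leibniz (u : A) ((u⁻¹ : Aˣ) : A)
    simp only [Units.mul_inv, Derivation.map_one_eq_zero, hk', smul_zero, add_zero] at h
    simpa using h.symm
  have hs : D (((u⁻¹ : Aˣ) : A) * s') = 1 := by
    simp [hu, hs'']
  by_cases h : ∃ δ ∈ stabDer V, ∃ x, D x = 0 ∧ δ x ≠ 0
  · obtain ⟨δ, hδ, x, hx, hδx⟩ := h
    obtain ⟨c, hc⟩ := hχ δ hδ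
    exact hV.modPart_ne_bot_of_slice hD hDV hδ hc hs hx hδx
  push Not at h
  exfalso
  obtain ⟨p⟩ := hV.point
  obtain ⟨e⟩ := hD.nonempty_polynomial_equiv hs fun a ha => by
    refine ⟨p a, ?_⟩
    by_contra hne
    have h1 : a - algebraMap ℂ A (p a) ≠ 0 := fun h0 => hne (sub_eq_zero.1 h0).symm
    have h2 := hV.isUnit_of_eigen h1 fun δ hδ => ⟨0, by rw [h δ hδ _ (by simp [ha]), zero_smul]⟩
    have h3 := h2.map p
    simp at h3
  exact hline.elim e

end Slice

section Torus

variable {A : Type*} [CommRing A] [Algebra ℂ A]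

/-- Joint eigenspaces of a family of derivations. -/
def jointEig {ι : Type*} (f : ι → Derivation ℂ A A) (χ : ι → ℂ) : Submodule ℂ A where
  carrier := {a | ∀ i, f i a = χ i • a}
  add_mem' ha hb i := by rw [map_add, ha i, hb i, smul_add]
  zero_mem' i := by simp
  smul_mem' c a ha i := by rw [Derivation.map_smul, ha i, smul_comm]

variable {ι : Type*} {f : ι → Derivation ℂ A A}

theorem one_mem_jointEig : (1 : A) ∈ jointEig f 0 := fun i => by simp

theorem mul_mem_jointEig {χ ψ : ι → ℂ} {a b : A} (ha : a ∈ jointEig f χ) (hb : b ∈ jointEig f ψ) :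
    a * b ∈ jointEig f (χ + ψ) := fun i => Derivation.apply_mul_eigen (ha i) (hb i)

theorem inv_mem_jointEig {χ : ι → ℂ} {u : Aˣ} (hu : (u : A) ∈ jointEig f χ) :
    ((u⁻¹ : Aˣ) : A) ∈ jointEig f (-χ) := by
  intro i
  have h := (f i).leibniz (u : A) ((u⁻¹ : Aˣ) : A)
  rw [Units.mul_inv, Derivation.map_one_eq_zero, hu i, smul_eq_mul, smul_eq_mul, mul_smul_comm,
    Units.inv_mul] at h
  have h2 : ((u⁻¹ : Aˣ) : A) * ((u : A) * f i ((u⁻¹ : Aˣ) : A) + χ i • 1) = 0 := by rw [← h, mul_zero]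
  rw [mul_add, Units.inv_mul_cancel_left, mul_smul_comm, mul_one] at h2
  rw [eq_neg_of_add_eq_zero_left h2, Pi.neg_apply, neg_smul]

/-- Pairs of a unit and its weight. -/
def weightedUnits (f : ι → Derivation ℂ A A) : Subgroup (Aˣ × Multiplicative (ι → ℂ)) where
  carrier := {p | (p.1 : A) ∈ jointEig f p.2.toAdd}
  mul_mem' ha hb := mul_mem_jointEig ha hb
  one_mem' := one_mem_jointEig
  inv_mem' ha := inv_mem_jointEig ha

theorem iSupIndep_jointEig (hf : ∀ i j, ⁅f i, f j⁆ = 0) : iSupIndep (jointEig f) := by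
  have h := Module.End.independent_iInf_maxGenEigenspace_of_forall_mapsTo
    (fun i => ((f i : A →ₗ[ℂ] A) : Module.End ℂ A)) (fun i j φ =>
      Module.End.mapsTo_maxGenEigenspace_of_comm (LinearMap.ext fun a => ?_) φ)
  · refine h.mono fun χ a ha => ?_
    simp only [Submodule.mem_iInf]
    exact fun i => Module.End.eigenspace_le_maxGenEigenspace (Module.End.mem_eigenspace_iff.2 (ha i))
  · have := congrArg (fun D => D a) (hf j i)
    simp only [Derivation.commutator_apply, Derivation.zero_apply] at this
    exact sub_eq_zero.1 this

variable {V : Submodule ℂ A} [IsDomain A]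

theorem IsHomSetup.exists_torus_equiv (hV : IsHomSetup V)
    (habel : ∀ δ ε : stabDer V, ⁅(δ : Derivation ℂ A A), (ε : Derivation ℂ A A)⁆ = 0)
    (hss : ∀ δ ∈ stabDer V, ⨆ μ, Module.End.eigenspace (δ : A →ₗ[ℂ] A) μ = ⊤) :
    ∃ k, Nonempty (A ≃ₐ[ℂ] TorusRing k) := by
  have := hV.fin
  let f : stabDer V → Derivation ℂ A A := fun δ => δ
  let g : stabDer V → Module.End ℂ V := fun δ => (f δ : A →ₗ[ℂ] A).restrict δ.2
  have hcomm : ∀ i j, Commute (g i) (g j) := fun i j => LinearMap.ext fun a => Subtype.ext (by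
    have := congrArg (fun D => D (a : A)) (habel i j)
    simp only [Derivation.commutator_apply, Derivation.zero_apply] at this
    exact sub_eq_zero.1 this)
  have hmaps : ∀ i j φ, Set.MapsTo (g i) ((g j).maxGenEigenspace φ) ((g j).maxGenEigenspace φ) :=
    fun i j φ => Module.End.mapsTo_maxGenEigenspace_of_comm (hcomm j i) φ
  let W : (stabDer V → ℂ) → Submodule ℂ V := fun χ => ⨅ i, (g i).maxGenEigenspace (χ i)
  have hWtop : ⨆ χ, W χ = ⊤ := Module.End.iSup_iInf_maxGenEigenspace_eq_top_of_forall_mapsTo g hmaps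
    fun i => Module.End.iSup_maxGenEigenspace_eq_top (g i)
  have hWfin : {χ | W χ ≠ ⊥}.Finite := WellFoundedGT.finite_ne_bot_of_iSupIndep
    (Module.End.independent_iInf_maxGenEigenspace_of_forall_mapsTo g hmaps)
  have hWj : ∀ χ, ∀ v ∈ W χ, (v : A) ∈ jointEig f χ := by
    intro χ v hv δ
    have h1 := (Submodule.mem_iInf _).1 hv δ
    obtain ⟨k, hk⟩ := (Module.End.mem_maxGenEigenspace _ _ _).1 h1
    have h2 : ∀ k : ℕ, ((((g δ - χ δ • 1) ^ k) v : V) : A) =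
        (((f δ : A →ₗ[ℂ] A) - χ δ • (1 : Module.End ℂ A)) ^ k) v := by
      intro k
      induction k with
      | zero => rfl
      | succ k ih =>
        rw [pow_succ', pow_succ', Module.End.mul_apply, Module.End.mul_apply, ← ih]
        rfl
    have h3 : (v : A) ∈ Module.End.maxGenEigenspace (f δ : A →ₗ[ℂ] A) (χ δ) := by
      rw [Module.End.mem_maxGenEigenspace]
      exact ⟨k, by rw [← h2, hk]; rfl⟩
    exact Module.End.mem_eigenspace_iff.1
      (Module.End.maxGenEigenspace_le_of_iSup_eigenspace (c := id) (hss δ δ.2) _ h3)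
  have hunit : ∀ χ, ∀ a ∈ jointEig f χ, a ≠ 0 → IsUnit a := fun χ a ha ha0 =>
    hV.isUnit_of_eigen ha0 fun δ hδ => ⟨_, ha ⟨δ, hδ⟩⟩
  obtain ⟨p⟩ := hV.point
  have hzero : ∀ a ∈ jointEig f 0, a = algebraMap ℂ A (p a) := by
    intro a ha
    by_contra hne
    have h1 : a - algebraMap ℂ A (p a) ∈ jointEig f 0 := fun i => by
      have := ha i
      simp at this
      simp [this]
    have h3 := (hunit 0 _ h1 (sub_ne_zero.2 hne)).map p
    simp at h3
  let Λ : AddSubgroup (stabDer V → ℂ) := AddSubgroup.closure {χ | W χ ≠ ⊥}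
  have hΛ : ∀ χ ∈ Λ, ∃ u : Aˣ, (u : A) ∈ jointEig f χ := by
    intro χ hχ
    induction hχ using AddSubgroup.closure_induction with
    | mem χ hχ =>
      obtain ⟨v, hv, hv0⟩ := Submodule.exists_mem_ne_zero_of_ne_bot hχ
      obtain ⟨u, hu⟩ := hunit χ v (hWj χ v hv) (fun h => hv0 (Subtype.ext h))
      exact ⟨u, hu ▸ hWj χ v hv⟩
    | zero => exact ⟨1, one_mem_jointEig⟩
    | add χ ψ _ _ h1 h2 =>
      obtain ⟨u, hu⟩ := h1
      obtain ⟨v, hv⟩ := h2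
      exact ⟨u * v, by rw [Units.val_mul]; exact mul_mem_jointEig hu hv⟩
    | neg χ _ h1 =>
      obtain ⟨u, hu⟩ := h1
      exact ⟨u⁻¹, inv_mem_jointEig hu⟩
  have : AddGroup.FG Λ := by
    rw [AddGroup.fg_iff_addSubgroup_fg]
    exact ⟨hWfin.toFinset, by simp [Λ]⟩
  have : Module.Finite ℤ Λ := Module.Finite.iff_addGroup_fg.2 this
  have : Module.IsTorsionFree ℤ (stabDer V → ℂ) := inferInstance
  have : Module.IsTorsionFree ℤ Λ := inferInstance
  let b := Module.finBasis ℤ Λ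
  choose u hu using fun i => hΛ (b i) (b i).2
  let q : Fin (Module.finrank ℤ Λ) → Aˣ × Multiplicative (stabDer V → ℂ) :=
    fun i => (u i, Multiplicative.ofAdd (b i : stabDer V → ℂ))
  let Q : Multiplicative (Fin (Module.finrank ℤ Λ) → ℤ) →* Aˣ × Multiplicative (stabDer V → ℂ) :=
    { toFun := fun m => ∏ i, q i ^ (m.toAdd i)
      map_one' := by simp
      map_mul' := fun m n => by simp [zpow_add, Finset.prod_mul_distrib] }
  have hQ : ∀ m, Q m ∈ weightedUnits f := fun m => by
    change ∏ i, q i ^ (m.toAdd i) ∈ weightedUnits f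
    exact Subgroup.prod_mem _ fun i _ => Subgroup.zpow_mem _ (hu i : q i ∈ weightedUnits f) _
  have hQ2 : ∀ m, (Q m).2.toAdd = (b.equivFun.symm m.toAdd : Λ) := by
    intro m
    simp [Q, q, Module.Basis.equivFun_symm_apply, Prod.snd_prod, toAdd_prod]
  let F : Multiplicative (Fin (Module.finrank ℤ Λ) → ℤ) →* A :=
    (Units.coeHom A).comp ((MonoidHom.fst _ _).comp Q)
  have hF : ∀ m, F m ∈ jointEig f (b.equivFun.symm m.toAdd : Λ) := fun m => by
    have := hQ m
    have h2 : F m ∈ jointEig f (Q m).2.toAdd := this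
    rwa [hQ2] at h2
  let φ := AddMonoidAlgebra.lift ℂ A _ F
  have hinj : Function.Injective φ := by
    have hli : LinearIndependent ℂ (fun m => F (Multiplicative.ofAdd m)) := by
      refine iSupIndep.linearIndependent (fun m => jointEig f (b.equivFun.symm m : Λ)) ?_
        (fun m => hF (Multiplicative.ofAdd m)) fun m => Units.ne_zero _
      exact (iSupIndep_jointEig habel).comp
        (Subtype.val_injective.comp b.equivFun.symm.injective)
    rw [injective_iff_map_eq_zero]
    intro x hx
    have h1 : Finsupp.linearCombination ℂ (fun m => F (Multiplicative.ofAdd m)) x.coeff = 0 := by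
      rw [← hx, Finsupp.linearCombination_apply, AddMonoidAlgebra.lift_apply']
      simp only [Algebra.smul_def]
    have h2 := (linearIndependent_iff.1 hli) _ h1
    ext m
    simp [h2]
  have hsurj : Function.Surjective φ := by
    rw [← AlgHom.range_eq_top, eq_top_iff, ← hV.adjoin]
    refine Algebra.adjoin_le fun v hv => ?_
    have h1 : (⟨v, hv⟩ : V) ∈ ⨆ χ, W χ := hWtop ▸ Submodule.mem_top
    suffices h : ∀ x : V, x ∈ ⨆ χ, W χ → (x : A) ∈ φ.range from h _ h1
    intro x hx
    induction hx using Submodule.iSup_induction' with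
    | mem χ x hx =>
      by_cases hx0 : x = 0
      · rw [hx0]; exact zero_mem φ.range
      have hχ : χ ∈ Λ := AddSubgroup.subset_closure fun h => hx0 (by
        rw [h] at hx; exact (Submodule.mem_bot ℂ).1 hx)
      let m := b.equivFun ⟨χ, hχ⟩
      have hm := hQ (Multiplicative.ofAdd m)
      have h3 := inv_mem_jointEig hm
      have h4 := mul_mem_jointEig (hWj χ x hx) h3
      rw [hQ2] at h4
      simp only [m, toAdd_ofAdd, LinearEquiv.symm_apply_apply, add_neg_cancel] at h4
      have h5 := hzero _ h4
      refine ⟨AddMonoidAlgebra.single m (p (x * (((Q (Multiplicative.ofAdd m)).1⁻¹ : Aˣ) : A))), ?_⟩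
      have h6 : φ (AddMonoidAlgebra.single m (p (x * (((Q (Multiplicative.ofAdd m)).1⁻¹ : Aˣ) : A)))) =
        algebraMap ℂ A (p (x * (((Q (Multiplicative.ofAdd m)).1⁻¹ : Aˣ) : A))) *
          ((Q (Multiplicative.ofAdd m)).1 : A) := by
        simp [φ, F, AddMonoidAlgebra.lift_single, Algebra.smul_def]
      change φ _ = _
      rw [h6, ← h5, Units.inv_mul_cancel_right]
    | zero => exact zero_mem φ.range
    | add x y _ _ hx hy => exact add_mem hx hy
  exact ⟨_, ⟨(AlgEquiv.ofBijective φ ⟨hinj, hsurj⟩).symm⟩⟩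

end Torus

section Solvable

variable {A : Type*} [CommRing A] [Algebra ℂ A] {V : Submodule ℂ A} [IsDomain A]

theorem IsHomSetup.modPart_ne_bot_of_isSolvable (hV : IsHomSetup V)
    [LieAlgebra.IsSolvable (stabDer V)]
    (hline : IsEmpty (A ≃ₐ[ℂ] Polynomial ℂ))
    (htorus : ∀ k : ℕ, IsEmpty (A ≃ₐ[ℂ] TorusRing k)) : modPart A ≠ ⊥ := by
  by_cases hd : LieAlgebra.derivedSeries ℂ (stabDer V) 1 = ⊥
  · have habel : ∀ δ ε : stabDer V, ⁅(δ : Derivation ℂ A A), (ε : Derivation ℂ A A)⁆ = 0 := by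
      intro δ ε
      have h1 : ⁅δ, ε⁆ ∈ (LieAlgebra.derivedSeries ℂ (stabDer V) 1).toLieSubalgebra.toSubmodule := by
        rw [LieAlgebra.coe_derivedSeries_one_eq]
        exact Submodule.subset_span ⟨δ, ε, rfl⟩
      rw [hd] at h1
      exact congrArg Subtype.val ((Submodule.mem_bot ℂ).1 h1)
    by_cases hn : ∃ D ∈ stabDer V, D ≠ 0 ∧ IsLND D
    · obtain ⟨D, hD, hD0, hn⟩ := hn
      exact hV.modPart_ne_bot_of_lnd hline hD hD0 hn fun δ hδ =>
        ⟨0, by rw [habel ⟨δ, hδ⟩ ⟨D, hD⟩, zero_smul]⟩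
    push Not at hn
    obtain ⟨k, ⟨e⟩⟩ := hV.exists_torus_equiv habel fun δ hδ => by
      have htop := (hV.isLocallyFinite hδ).iSup_maxGenEigenspace
      obtain ⟨S, hS, hSe⟩ := hV.exists_jordan hδ (AddMonoidHom.id ℂ)
      have h0 : δ - S = 0 := by
        by_contra h0
        exact hn _ (sub_mem hδ hS) h0 (isLND_sub_of_eigen htop hSe)
      rw [eq_top_iff, ← htop]
      refine iSup_mono fun μ a ha => ?_
      rw [Module.End.mem_eigenspace_iff, sub_eq_zero.1 h0]
      exact hSe μ a ha
    exact ((htorus k).false e).elim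
  · have := hV.finiteDimensional_stabDer
    obtain ⟨χ, D, hD, hD0, hχ⟩ := exists_joint_eigenvector
      (LieAlgebra.derivedSeries ℂ (stabDer V) 1) hd
    exact hV.modPart_ne_bot_of_lnd hline D.2 (fun h => hD0 (Subtype.ext h))
      (hV.isLND_of_mem_derivedSeries hD hχ)
      fun δ hδ => ⟨χ ⟨δ, hδ⟩, congrArg Subtype.val (hχ ⟨δ, hδ⟩)⟩

end Solvable

section GradedLift

theorem Module.End.exists_mem_maxGenEigenspace_apply_eq {M N : Type*} [AddCommGroup M] [Module ℂ M]
    [AddCommGroup N] [Module ℂ N] {f : Module.End ℂ M} {g : Module.End ℂ N}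
    (hf : ⨆ μ, f.maxGenEigenspace μ = ⊤) (T : M →ₗ[ℂ] N) (d : ℂ)
    (hT : ∀ c, ∀ m ∈ f.maxGenEigenspace c, T m ∈ g.maxGenEigenspace (c + d)) {u : M} {c : ℂ}
    (hu : T u ∈ g.maxGenEigenspace (c + d)) : ∃ u' ∈ f.maxGenEigenspace c, T u' = T u := by
  have h1 : u ∈ f.maxGenEigenspace c ⊔ ⨆ j, ⨆ (_ : j ≠ c), f.maxGenEigenspace j := by
    have h2 : ⨆ μ, f.maxGenEigenspace μ ≤
        f.maxGenEigenspace c ⊔ ⨆ j, ⨆ (_ : j ≠ c), f.maxGenEigenspace j := by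
      refine iSup_le fun μ => ?_
      by_cases h : μ = c
      · rw [h]; exact le_sup_left
      · exact le_sup_of_le_right (le_iSup₂_of_le μ h le_rfl)
    rw [hf] at h2
    exact h2 Submodule.mem_top
  obtain ⟨a, ha, b, hb, rfl⟩ := Submodule.mem_sup.1 h1
  refine ⟨a, ha, ?_⟩
  have h3 : T b ∈ g.maxGenEigenspace (c + d) := by
    have := sub_mem hu (hT c a ha)
    rwa [map_add, add_sub_cancel_left] at this
  have h4 : (⨆ j, ⨆ (_ : j ≠ c), f.maxGenEigenspace j) ≤
      (⨆ j, ⨆ (_ : j ≠ c + d), g.maxGenEigenspace j).comap T := by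
    refine iSup₂_le fun j hj m hm => ?_
    exact Submodule.mem_iSup_of_mem (j + d)
      (Submodule.mem_iSup_of_mem (fun h => hj (add_right_cancel h)) (hT j m hm))
  have h5 := (Submodule.disjoint_def.1 (Module.End.independent_maxGenEigenspace g (c + d))) _ h3
    (h4 hb)
  rw [map_add, h5, add_zero]

end GradedLift

section HonestSl2

variable {M : Type*} [AddCommGroup M] [Module ℂ M] {H E F : Module.End ℂ M}

theorem Module.End.pow_succ_mul_of_sl2 (hHE : H * E = E * H + (2 : ℂ) • E) (hEF : E * F = F * E + H)
    (n : ℕ) : E ^ (n + 1) * F = F * E ^ (n + 1) + ((n : ℂ) + 1) • (E ^ n * (H + (n : ℂ) • 1)) := by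
  have hH : ∀ n : ℕ, H * E ^ n = E ^ n * H + (2 * n : ℂ) • E ^ n := by
    intro n
    induction n with
    | zero => simp
    | succ n ih =>
      rw [pow_succ, ← mul_assoc, ih, add_mul, mul_assoc, hHE, mul_add, smul_mul_assoc,
        mul_smul_comm, mul_assoc]
      push_cast
      module
  induction n with
  | zero => simp [hEF]
  | succ n ih =>
    rw [pow_succ' E (n + 1), mul_assoc, ih, mul_add, ← mul_assoc E F, hEF, add_mul, hH,
      mul_smul_comm, ← mul_assoc E (E ^ n), ← pow_succ', mul_assoc F, ← pow_succ']
    simp only [mul_add, mul_smul_comm, mul_one]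
    push_cast
    module

theorem Module.End.maxGenEigenspace_apply_of_ad {X : Module.End ℂ M} {c : ℂ}
    (hX : H * X = X * H + c • X) {ν : ℂ} {v : M} (hv : v ∈ H.maxGenEigenspace ν) :
    X v ∈ H.maxGenEigenspace (ν + c) := by
  rw [Module.End.mem_maxGenEigenspace] at hv ⊢
  obtain ⟨k, hk⟩ := hv
  refine ⟨k, ?_⟩
  have h1 : (H - (ν + c) • 1) * X = X * (H - ν • 1) := by
    rw [sub_mul, mul_sub, hX]
    simp only [smul_mul_assoc, mul_smul_comm, one_mul, mul_one]
    module
  have h2 : ∀ k : ℕ, (H - (ν + c) • 1) ^ k * X = X * (H - ν • 1) ^ k := by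
    intro k
    induction k with
    | zero => simp
    | succ k ih => rw [pow_succ, mul_assoc, h1, ← mul_assoc, ih, mul_assoc, ← pow_succ]
  have := LinearMap.congr_fun (h2 k) v
  rw [Module.End.mul_apply, Module.End.mul_apply, hk, map_zero] at this
  exact this

theorem Module.End.mem_range_of_sl2 [FiniteDimensional ℂ M]
    (hHE : H * E = E * H + (2 : ℂ) • E) (hHF : H * F = F * H + (-2 : ℂ) • F)
    (hEF : E * F = F * E + H) {ν : ℂ} (hν : ∀ n : ℕ, ν ≠ -n) {v : M}
    (hv : v ∈ H.maxGenEigenspace ν) : v ∈ LinearMap.range E := by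
  have key : ∀ n : ℕ, ∀ v ∈ H.maxGenEigenspace ν, (E ^ n) v = 0 → v ∈ LinearMap.range E := by
    intro n
    induction n with
    | zero =>
      intro v _ h
      rw [pow_zero, Module.End.one_apply] at h
      rw [h]; exact zero_mem _
    | succ n ih =>
      intro v hv h
      let S : Submodule ℂ M := H.maxGenEigenspace ν ⊓ LinearMap.ker (E ^ (n + 1))
      have hSH : ∀ w ∈ S, (H + (n : ℂ) • 1) w ∈ S := by
        intro w hw
        refine ⟨?_, ?_⟩
        · have := Module.End.mapsTo_maxGenEigenspace_of_comm
            (show Commute H (H + (n : ℂ) • 1) by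
              exact (Commute.refl H).add_right ((Commute.one_right H).smul_right _)) ν
          exact this hw.1
        · have hH : ∀ n : ℕ, E ^ n * H = H * E ^ n - (2 * n : ℂ) • E ^ n := by
            intro n
            induction n with
            | zero => simp
            | succ n ih =>
              rw [pow_succ, mul_assoc, show E * H = H * E - (2 : ℂ) • E by rw [hHE]; abel, mul_sub,
                ← mul_assoc, ih, sub_mul, smul_mul_assoc, mul_smul_comm, mul_assoc]
              push_cast
              module
          have h1 := LinearMap.congr_fun (hH (n + 1)) w
          have h2 : (E ^ (n + 1)) w = 0 := hw.2
          rw [Module.End.mul_apply, LinearMap.sub_apply, LinearMap.smul_apply, Module.End.mul_apply,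
            h2, map_zero, smul_zero, sub_zero] at h1
          change (E ^ (n + 1)) ((H + (n : ℂ) • 1) w) = 0
          rw [LinearMap.add_apply, map_add, h1, LinearMap.smul_apply,
            Module.End.one_apply, map_smul, h2, smul_zero, add_zero]
      have hinj : Function.Injective ((H + (n : ℂ) • 1).restrict hSH) := by
        rw [← LinearMap.ker_eq_bot, LinearMap.ker_eq_bot']
        rintro ⟨w, hw⟩ hw0
        have h3 : (H + (n : ℂ) • 1) w = 0 := congrArg Subtype.val hw0
        have h4 : w ∈ H.maxGenEigenspace (-n : ℂ) := by
          refine Module.End.eigenspace_le_maxGenEigenspace ?_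
          rw [Module.End.mem_eigenspace_iff, neg_smul]
          rw [LinearMap.add_apply, LinearMap.smul_apply, Module.End.one_apply] at h3
          exact eq_neg_of_add_eq_zero_left h3
        have h5 := (Module.End.independent_maxGenEigenspace H).pairwiseDisjoint (hν n)
        exact Subtype.ext ((Submodule.disjoint_def.1 h5) w hw.1 h4)
      obtain ⟨⟨w, hw⟩, hwv⟩ := LinearMap.surjective_of_injective hinj ⟨v, hv, h⟩
      have hwv' : (H + (n : ℂ) • 1) w = v := congrArg Subtype.val hwv
      have hn : ((n : ℂ) + 1) ≠ 0 := by exact_mod_cast n.succ_ne_zero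
      have h2 : (E ^ (n + 1)) w = 0 := hw.2
      have h6 := LinearMap.congr_fun (Module.End.pow_succ_mul_of_sl2 hHE hEF n) w
      rw [Module.End.mul_apply, LinearMap.add_apply, LinearMap.smul_apply, Module.End.mul_apply, h2,
        map_zero, zero_add, Module.End.mul_apply, hwv', pow_succ, Module.End.mul_apply] at h6
      have h7 : v - ((n : ℂ) + 1)⁻¹ • E (F w) ∈ LinearMap.range E := by
        refine ih _ (sub_mem hv (Submodule.smul_mem _ _ ?_)) ?_
        · have h8 := Module.End.maxGenEigenspace_apply_of_ad hHE
            (Module.End.maxGenEigenspace_apply_of_ad hHF hw.1)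
          simpa using h8
        · rw [map_sub, map_smul, h6, smul_smul, inv_mul_cancel₀ hn, one_smul, sub_self]
      have h9 := add_mem h7 (Submodule.smul_mem _ ((n : ℂ) + 1)⁻¹ (LinearMap.mem_range_self E (F w)))
      rwa [sub_add_cancel] at h9
  have hfin := Module.End.finite_inf_maxGenEigenspace_ne_bot (δ := H) (W := ⊤) (fun _ _ => trivial)
  have hmem : ∀ m : ℕ, (E ^ m) v ∈ H.maxGenEigenspace (ν + m * 2) := by
    intro m
    induction m with
    | zero => simpa using hv
    | succ m ih =>
      rw [pow_succ', Module.End.mul_apply,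
        show ν + ((m + 1 : ℕ) : ℂ) * 2 = ν + m * 2 + 2 by push_cast; ring]
      exact Module.End.maxGenEigenspace_apply_of_ad hHE ih
  have hinj : Function.Injective fun m : ℕ => ν + m * 2 := by
    intro i j hij
    simpa using hij
  obtain ⟨m, hm⟩ := (hfin.preimage hinj.injOn).exists_notMem
  have h2 : H.maxGenEigenspace (ν + m * 2) = ⊥ := by simpa using hm
  refine key m v hv ?_
  have := hmem m
  rwa [h2, Submodule.mem_bot] at this

end HonestSl2

section LiftSl2

variable {L : Type*} [LieRing L] [LieAlgebra ℂ L]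

/-- A triple that is an `sl₂`-triple modulo the radical. -/
structure IsSl2TripleModRadical (h e f : L) : Prop where
  e_mem : e ∈ (LieAlgebra.ad ℂ L h).maxGenEigenspace 2
  f_mem : f ∈ (LieAlgebra.ad ℂ L h).maxGenEigenspace (-2)
  h_e : ⁅h, e⁆ - (2 : ℂ) • e ∈ LieAlgebra.radical ℂ L ⊓ LieAlgebra.derivedSeries ℂ L 1
  h_f : ⁅h, f⁆ - (-2 : ℂ) • f ∈ LieAlgebra.radical ℂ L ⊓ LieAlgebra.derivedSeries ℂ L 1
  e_f : ⁅e, f⁆ - h ∈ LieAlgebra.radical ℂ L ⊓ LieAlgebra.derivedSeries ℂ L 1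
  h_mem : h ∈ LieAlgebra.derivedSeries ℂ L 1

theorem Module.End.maxGenEigenspace_neg {M : Type*} [AddCommGroup M] [Module ℂ M]
    (H : Module.End ℂ M) (μ : ℂ) : (-H).maxGenEigenspace μ = H.maxGenEigenspace (-μ) := by
  have h : ∀ k : ℕ, (-H - μ • 1) ^ k = (-1) ^ k * (H - (-μ) • 1) ^ k := by
    intro k
    rw [← neg_one_mul H, ← (Commute.neg_one_left _).mul_pow]
    congr 1
    simp only [neg_mul, one_mul, neg_smul]
    abel
  ext v
  simp only [Module.End.mem_maxGenEigenspace, h, Module.End.mul_apply]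
  refine exists_congr fun k => ?_
  rcases neg_one_pow_eq_or (Module.End ℂ M) k with h | h <;> simp [h]

theorem IsSl2TripleModRadical.symm {h e f : L} (t : IsSl2TripleModRadical h e f) :
    IsSl2TripleModRadical (-h) f e where
  e_mem := by rw [map_neg, Module.End.maxGenEigenspace_neg]; exact t.f_mem
  f_mem := by rw [map_neg, Module.End.maxGenEigenspace_neg, neg_neg]; exact t.e_mem
  h_e := by
    have := neg_mem t.h_f
    rwa [neg_sub', ← neg_lie, ← neg_smul, neg_neg] at this
  h_f := by
    have := neg_mem t.h_e
    rwa [neg_sub', ← neg_lie, ← neg_smul] at this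
  e_f := by
    have := neg_mem t.e_f
    rwa [neg_sub', lie_skew] at this
  h_mem := neg_mem t.h_mem

theorem LieAlgebra.lie_mem_derivedSeries_one (x y : L) : ⁅x, y⁆ ∈ LieAlgebra.derivedSeries ℂ L 1 :=
  LieSubmodule.lie_mem_lie (LieSubmodule.mem_top x) (LieSubmodule.mem_top y)

theorem LieModule.toEnd_lie_eq {M : Type*} [AddCommGroup M] [Module ℂ M]
    [LieRingModule L M] [LieModule ℂ L M] (x y : L) : LieModule.toEnd ℂ L M ⁅x, y⁆ =
      LieModule.toEnd ℂ L M x * LieModule.toEnd ℂ L M y -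
        LieModule.toEnd ℂ L M y * LieModule.toEnd ℂ L M x := by
  ext m
  exact lie_lie x y m

theorem LieModule.trace_toEnd_eq_zero_of_mem_derivedSeries {M : Type*} [AddCommGroup M] [Module ℂ M]
    [LieRingModule L M] [LieModule ℂ L M] {x : L} (hx : x ∈ LieAlgebra.derivedSeries ℂ L 1) :
    LinearMap.trace ℂ M (LieModule.toEnd ℂ L M x) = 0 := by
  replace hx : x ∈ (LieAlgebra.derivedSeries ℂ L 1).toLieSubalgebra.toSubmodule := hx
  rw [LieAlgebra.coe_derivedSeries_one_eq] at hx
  induction hx using Submodule.span_induction with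
  | mem x hx =>
    obtain ⟨a, b, rfl⟩ := hx
    rw [LieModule.toEnd_lie_eq, map_sub, LinearMap.trace_mul_comm,
      sub_self]
  | zero => simp
  | add x y _ _ hx hy => rw [map_add, map_add, hx, hy, add_zero]
  | smul c x _ hx => rw [map_smul, map_smul, hx, smul_zero]

theorem LieModule.lie_mem_maxGenEigenspace {M : Type*} [AddCommGroup M] [Module ℂ M]
    [LieRingModule L M] [LieModule ℂ L M] {h e : L} {c μ : ℂ}
    (he : e ∈ (LieAlgebra.ad ℂ L h).maxGenEigenspace c) {m : M}
    (hm : m ∈ (LieModule.toEnd ℂ L M h).maxGenEigenspace μ) :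
    ⁅e, m⁆ ∈ (LieModule.toEnd ℂ L M h).maxGenEigenspace (μ + c) := by
  rw [add_comm]
  exact bilin_mem_maxGenEigenspace (LieModule.toEnd ℂ L M : L →ₗ[ℂ] Module.End ℂ M)
    (fun a b => by simp) he hm

theorem IsSl2TripleModRadical.mem_range_toEnd [FiniteDimensional ℂ L] {h e f : L}
    (t : IsSl2TripleModRadical h e f) (k : ℕ) {M : Type*} [AddCommGroup M] [Module ℂ M]
    [LieRingModule L M] [LieModule ℂ L M] [FiniteDimensional ℂ M]
    (hk : Module.finrank ℂ M = k) {ν : ℂ}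
    (hν : ∀ n : ℕ, ν ≠ -n) {v : M} (hv : v ∈ (LieModule.toEnd ℂ L M h).maxGenEigenspace ν) :
    ∃ w : M, ⁅e, w⁆ = v := by
  induction k using Nat.strong_induction_on generalizing M with
  | _ k ih =>
  rcases subsingleton_or_nontrivial M with hM | hM
  · exact ⟨0, Subsingleton.elim _ _⟩
  obtain ⟨χ, hχ⟩ := LieModule.exists_nontrivial_weightSpace_of_isSolvable ℂ
    (LieAlgebra.radical ℂ L) M
  let U : LieSubmodule ℂ L M := LieModule.weightSpaceOfIsLieTower ℂ M χ
  have hU : ∀ z : LieAlgebra.radical ℂ L, ∀ u ∈ U, ⁅(z : L), u⁆ = χ z • u := by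
    intro z u hu
    have hu' : u ∈ LieModule.weightSpace M χ := hu
    exact (LieModule.mem_weightSpace χ u).1 hu' z
  have hUnt : Nontrivial U := hχ
  have hzero : ∀ z ∈ LieAlgebra.radical ℂ L ⊓ LieAlgebra.derivedSeries ℂ L 1,
      LieModule.toEnd ℂ L U z = 0 := by
    intro z hz
    have h1 : LieModule.toEnd ℂ L U z = χ ⟨z, hz.1⟩ • 1 := by
      ext u
      exact hU ⟨z, hz.1⟩ u u.2
    have h2 := LieModule.trace_toEnd_eq_zero_of_mem_derivedSeries (M := U) hz.2
    rw [h1, map_smul, LinearMap.trace_one, smul_eq_mul] at h2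
    have h3 : (Module.finrank ℂ U : ℂ) ≠ 0 := by
      exact_mod_cast (Module.finrank_pos (R := ℂ) (M := U)).ne'
    rw [h1, (mul_eq_zero.1 h2).resolve_right h3, zero_smul]
  let H := LieModule.toEnd ℂ L U h
  let E := LieModule.toEnd ℂ L U e
  let F := LieModule.toEnd ℂ L U f
  have hHE : H * E = E * H + (2 : ℂ) • E := by
    have := hzero _ t.h_e
    rw [map_sub, map_smul, LieModule.toEnd_lie_eq, sub_eq_zero,
      sub_eq_iff_eq_add'] at this
    exact this
  have hHF : H * F = F * H + (-2 : ℂ) • F := by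
    have := hzero _ t.h_f
    rw [map_sub, map_smul, LieModule.toEnd_lie_eq, sub_eq_zero,
      sub_eq_iff_eq_add'] at this
    exact this
  have hEF : E * F = F * E + H := by
    have := hzero _ t.e_f
    rw [map_sub, LieModule.toEnd_lie_eq, sub_eq_zero,
      sub_eq_iff_eq_add'] at this
    exact this
  have hlt : Module.finrank ℂ (M ⧸ U) < k := by
    have h1 := Submodule.finrank_quotient_add_finrank U.toSubmodule
    have h2 := Module.finrank_pos (R := ℂ) (M := U)
    change Module.finrank ℂ (M ⧸ U.toSubmodule) < k
    change 0 < Module.finrank ℂ U.toSubmodule at h2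
    omega
  let π : M →ₗ⁅ℂ,L⁆ M ⧸ U := LieSubmodule.Quotient.mk' U
  have hπ : ∀ c, ∀ m ∈ (LieModule.toEnd ℂ L M h).maxGenEigenspace c,
      π m ∈ (LieModule.toEnd ℂ L (M ⧸ U) h).maxGenEigenspace c := by
    intro c m hm
    have := bilin_mem_maxGenEigenspace (S := (0 : Module.End ℂ ℂ)) (μ := 0) (a := (1 : ℂ))
      (U := LieModule.toEnd ℂ L (M ⧸ U) h) (LinearMap.lsmul ℂ (M →ₗ[ℂ] M ⧸ U) |>.flip π)
      (fun a b => by simp) (by rw [Module.End.mem_maxGenEigenspace]; exact ⟨1, by simp⟩) hm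
    simpa using this
  have : FiniteDimensional ℂ (M ⧸ U) := inferInstanceAs (FiniteDimensional ℂ (M ⧸ U.toSubmodule))
  obtain ⟨w, hw⟩ := ih _ hlt (M := M ⧸ U) rfl (hπ ν v hv)
  obtain ⟨w, rfl⟩ := LieSubmodule.Quotient.surjective_mk' U w
  obtain ⟨u, hu, huw⟩ := Module.End.exists_mem_maxGenEigenspace_apply_eq
    (Module.End.iSup_maxGenEigenspace_eq_top (LieModule.toEnd ℂ L M h))
    ((π : M →ₗ[ℂ] M ⧸ U) ∘ₗ LieModule.toEnd ℂ L M e) 2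
    (fun c m hm => hπ _ _ (LieModule.lie_mem_maxGenEigenspace t.e_mem hm)) (u := w) (c := ν - 2)
    (by
      rw [sub_add_cancel]
      convert hπ ν v hv using 1
      rw [← hw]
      exact LieModuleHom.map_lie π e w)
  have huv : v - ⁅e, u⁆ ∈ U := by
    have h1 : π ⁅e, u⁆ = π ⁅e, w⁆ := huw
    have h2 : π ⁅e, w⁆ = π v := (LieModuleHom.map_lie π e w).trans hw
    refine (LieSubmodule.Quotient.mk_eq_zero (N := U)).1 ?_
    rw [map_sub, sub_eq_zero]
    exact (h1.trans h2).symm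
  have hgen : v - ⁅e, u⁆ ∈ (LieModule.toEnd ℂ L M h).maxGenEigenspace ν := by
    have := LieModule.lie_mem_maxGenEigenspace t.e_mem hu
    rw [sub_add_cancel] at this
    exact sub_mem hv this
  have hgenU : (⟨v - ⁅e, u⁆, huv⟩ : U) ∈ H.maxGenEigenspace ν := by
    rw [Module.End.mem_maxGenEigenspace] at hgen ⊢
    obtain ⟨k, hk⟩ := hgen
    refine ⟨k, Subtype.ext ?_⟩
    have h1 : ∀ k : ℕ, ∀ x : U, (((H - ν • 1) ^ k) x : M) =
        ((LieModule.toEnd ℂ L M h - ν • 1) ^ k) x := by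
      intro k
      induction k with
      | zero => intro x; rfl
      | succ k ih => intro x; rw [pow_succ, pow_succ, Module.End.mul_apply, ih]; rfl
    rw [h1, hk]; rfl
  obtain ⟨y, hy⟩ := Module.End.mem_range_of_sl2 hHE hHF hEF hν hgenU
  refine ⟨u + y, ?_⟩
  have h1 : ⁅e, (y : M)⁆ = v - ⁅e, u⁆ := congrArg Subtype.val hy
  rw [lie_add, h1, add_sub_cancel]

end LiftSl2

section LeviTriple

variable {L : Type*} [LieRing L] [LieAlgebra ℂ L] [FiniteDimensional ℂ L]

theorem LieAlgebra.hasTrivialRadical_quotient_radical :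
    LieAlgebra.HasTrivialRadical ℂ (L ⧸ LieAlgebra.radical ℂ L) := by
  refine LieAlgebra.hasTrivialRadical_of_no_solvable_ideals fun I hI => ?_
  let π := LieSubmodule.Quotient.mk' (LieAlgebra.radical ℂ L)
  let π' : L →ₗ⁅ℂ⁆ L ⧸ LieAlgebra.radical ℂ L := 
    { π with map_lie' := fun {x y} => LieSubmodule.Quotient.mk_bracket _ x y }
  have hker : ∀ x, π' x = 0 ↔ x ∈ LieAlgebra.radical ℂ L := fun x => LieSubmodule.Quotient.mk_eq_zero _
  let J : LieIdeal ℂ L := I.comap π'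
  have h1 : ∀ k, LieAlgebra.derivedSeriesOfIdeal ℂ L k J ≤
      (LieAlgebra.derivedSeriesOfIdeal ℂ _ k I).comap π' := by
    intro k
    induction k with
    | zero => exact le_rfl
    | succ k ih =>
      rw [LieAlgebra.derivedSeriesOfIdeal_succ, LieAlgebra.derivedSeriesOfIdeal_succ]
      exact (LieSubmodule.mono_lie ih ih).trans (LieIdeal.comap_bracket_le π')
  obtain ⟨k, hk⟩ := (LieAlgebra.isSolvable_iff ℂ I).1 hI
  rw [LieIdeal.derivedSeries_eq_bot_iff] at hk
  obtain ⟨l, hl⟩ := (LieAlgebra.isSolvable_iff ℂ (LieAlgebra.radical ℂ L)).1 inferInstance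
  rw [LieIdeal.derivedSeries_eq_bot_iff] at hl
  have h2 : LieAlgebra.derivedSeriesOfIdeal ℂ L k J ≤ LieAlgebra.radical ℂ L := by
    intro x hx
    have := h1 k hx
    rw [hk, LieIdeal.mem_comap, LieSubmodule.mem_bot] at this
    exact (hker x).1 this
  have h3 : LieAlgebra.IsSolvable J := by
    refine (LieAlgebra.isSolvable_iff ℂ J).2 ⟨l + k, ?_⟩
    rw [LieIdeal.derivedSeries_eq_bot_iff, LieAlgebra.derivedSeriesOfIdeal_add, eq_bot_iff, ← hl]
    exact LieAlgebra.derivedSeriesOfIdeal_mono h2 l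
  rw [LieIdeal.solvable_iff_le_radical] at h3
  rw [eq_bot_iff]
  intro y hy
  obtain ⟨x, rfl⟩ := LieSubmodule.Quotient.surjective_mk' _ y
  exact (LieSubmodule.mem_bot _).2 ((hker x).2 (h3 hy))

theorem LieAlgebra.IsKilling.exists_isSl2Triple {Q : Type*} [LieRing Q] [LieAlgebra ℂ Q]
    [FiniteDimensional ℂ Q] [LieAlgebra.IsKilling ℂ Q] [Nontrivial Q] :
    ∃ h e f : Q, IsSl2Triple h e f := by
  obtain ⟨x, hx⟩ := LieAlgebra.exists_isCartanSubalgebra_engel ℂ Q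
  let H := LieSubalgebra.engel ℂ x
  have : H.IsCartanSubalgebra := hx
  by_cases h : ∃ α : LieModule.Weight ℂ H Q, α.IsNonZero
  · obtain ⟨α, hα⟩ := h
    obtain ⟨h, e, f, t, -⟩ := LieAlgebra.IsKilling.exists_isSl2Triple_of_weight_isNonZero hα
    exact ⟨h, e, f, t⟩
  · exfalso
    push Not at h
    have h1 := LieAlgebra.IsKilling.span_weight_isNonZero_eq_top ℂ Q H
    have h2 : {α : LieModule.Weight ℂ H Q | α.IsNonZero} = ∅ := by
      ext α; simp [h α]
    rw [h2, Set.image_empty, Submodule.span_empty] at h1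
    have h3 : Subsingleton (Module.Dual ℂ H) := (Submodule.subsingleton_iff ℂ).1
      ⟨fun a b => (by
        rw [eq_bot_iff.2 (le_top.trans_eq h1.symm : a ≤ ⊥),
          eq_bot_iff.2 (le_top.trans_eq h1.symm : b ≤ ⊥)])⟩
    have h4 : Subsingleton H := 
      ⟨fun a b => sub_eq_zero.1 ((Module.forall_dual_apply_eq_zero_iff ℂ (a - b)).1 fun φ => by
        rw [Subsingleton.elim φ 0]
        rfl)⟩
    obtain ⟨y, hy⟩ := exists_ne (0 : Q)
    have h5 : y ∈ H.normalizer := by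
      rw [LieSubalgebra.mem_normalizer_iff]
      intro z hz
      have : z = 0 := congrArg Subtype.val (Subsingleton.elim (⟨z, hz⟩ : H) 0)
      rw [this, lie_zero]
      exact zero_mem H
    rw [LieSubalgebra.IsCartanSubalgebra.self_normalizing] at h5
    exact hy (congrArg Subtype.val (Subsingleton.elim (⟨y, h5⟩ : H) 0))

theorem exists_isSl2TripleModRadical (hL : ¬ LieAlgebra.IsSolvable L) :
    ∃ h e f : L, IsSl2TripleModRadical h e f ∧ e ≠ 0 ∧ f ≠ 0 := by
  have := LieAlgebra.hasTrivialRadical_quotient_radical (L := L)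
  let R := LieAlgebra.radical ℂ L
  have hnt : Nontrivial (L ⧸ R) := by
    by_contra hn
    rw [not_nontrivial_iff_subsingleton] at hn
    have h1 : R = ⊤ := by
      rw [eq_top_iff]
      intro x _
      exact (LieSubmodule.Quotient.mk_eq_zero R).1 (Subsingleton.elim _ _)
    have h2 : LieAlgebra.IsSolvable (⊤ : LieIdeal ℂ L) :=
      (LieAlgebra.LieIdeal.solvable_iff_le_radical ℂ L _).2 h1.ge
    obtain ⟨k, hk⟩ := (LieAlgebra.isSolvable_iff ℂ (⊤ : LieIdeal ℂ L)).1 h2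
    rw [LieIdeal.derivedSeries_eq_bot_iff] at hk
    exact hL ((LieAlgebra.isSolvable_iff ℂ L).2 ⟨k, hk⟩)
  have : FiniteDimensional ℂ (L ⧸ R) := inferInstanceAs (FiniteDimensional ℂ (L ⧸ R.toSubmodule))
  obtain ⟨h₁, e₁, f₁, t⟩ := LieAlgebra.IsKilling.exists_isSl2Triple (Q := L ⧸ R)
  let π : L →ₗ⁅ℂ⁆ L ⧸ R := 
    { LieSubmodule.Quotient.mk' R with map_lie' := fun {x y} => LieSubmodule.Quotient.mk_bracket _ x y }
  have hπs : Function.Surjective π := LieSubmodule.Quotient.surjective_mk' R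
  have hker : ∀ x, π x = 0 ↔ x ∈ R := fun x => LieSubmodule.Quotient.mk_eq_zero _
  obtain ⟨e₀, he₀⟩ := hπs e₁
  obtain ⟨f₀, hf₀⟩ := hπs f₁
  let h : L := ⁅e₀, f₀⁆
  have hh : π h = h₁ := by rw [LieHom.map_lie, he₀, hf₀, t.lie_e_f]
  have hπ : ∀ c, ∀ m ∈ (LieAlgebra.ad ℂ L h).maxGenEigenspace c,
      (π : L →ₗ[ℂ] L ⧸ R) m ∈ (LieAlgebra.ad ℂ (L ⧸ R) h₁).maxGenEigenspace (c + 0) := by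
    intro c m hm
    have := bilin_mem_maxGenEigenspace (S := (0 : Module.End ℂ ℂ)) (μ := 0) (a := (1 : ℂ))
      (U := LieAlgebra.ad ℂ (L ⧸ R) h₁) (LinearMap.lsmul ℂ (L →ₗ[ℂ] L ⧸ R) |>.flip π)
      (fun a b => by simp [← hh]) (by rw [Module.End.mem_maxGenEigenspace]; exact ⟨1, by simp⟩) hm
    simpa using this
  have hlift : ∀ (c : ℂ) (x : L), ⁅h₁, π x⁆ = c • π x →
      ∃ y ∈ (LieAlgebra.ad ℂ L h).maxGenEigenspace c, π y = π x := by
    intro c x hx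
    refine Module.End.exists_mem_maxGenEigenspace_apply_eq
      (Module.End.iSup_maxGenEigenspace_eq_top (LieAlgebra.ad ℂ L h)) (π : L →ₗ[ℂ] L ⧸ R) 0 hπ ?_
    rw [add_zero]
    exact Module.End.eigenspace_le_maxGenEigenspace (Module.End.mem_eigenspace_iff.2 hx)
  obtain ⟨e, he, hee⟩ := hlift 2 e₀ (by rw [he₀, t.lie_h_e_smul ℂ])
  obtain ⟨f, hf, hff⟩ := hlift (-2) f₀ (by rw [hf₀, t.lie_lie_smul_f ℂ, neg_smul])
  rw [he₀] at hee
  rw [hf₀] at hff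
  have hder : ∀ c : ℂ, c ≠ 0 → ∀ x ∈ (LieAlgebra.ad ℂ L h).maxGenEigenspace c,
      x ∈ LieAlgebra.derivedSeries ℂ L 1 := by
    intro c hc x hx
    rw [Module.End.mem_maxGenEigenspace] at hx
    obtain ⟨k, hk⟩ := hx
    induction k generalizing x with
    | zero =>
      rw [pow_zero, Module.End.one_apply] at hk
      rw [hk]; exact zero_mem _
    | succ k ih =>
      rw [pow_succ, Module.End.mul_apply] at hk
      have h1 := ih _ hk
      have h2 : x = c⁻¹ • (⁅h, x⁆ - (LieAlgebra.ad ℂ L h - c • 1) x) := by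
        rw [LinearMap.sub_apply, LinearMap.smul_apply, Module.End.one_apply, LieAlgebra.ad_apply,
          sub_sub_cancel, smul_smul, inv_mul_cancel₀ hc, one_smul]
      rw [h2]
      exact SMulMemClass.smul_mem _ (sub_mem (LieAlgebra.lie_mem_derivedSeries_one _ _) h1)
  have h2 : (2 : ℂ) ≠ 0 := two_ne_zero
  refine ⟨h, e, f, ⟨he, hf, ⟨?_, ?_⟩, ⟨?_, ?_⟩, ⟨?_, ?_⟩, LieAlgebra.lie_mem_derivedSeries_one _ _⟩,
    ?_, ?_⟩
  · refine (hker _).1 ?_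
    rw [map_sub, LieHom.map_lie, hh, map_smul, hee, t.lie_h_e_smul ℂ, sub_self]
  · exact sub_mem (LieAlgebra.lie_mem_derivedSeries_one _ _) (SMulMemClass.smul_mem _ (hder 2 h2 e he))
  · refine (hker _).1 ?_
    rw [map_sub, LieHom.map_lie, hh, map_smul, hff, t.lie_lie_smul_f ℂ, neg_smul, sub_self]
  · exact sub_mem (LieAlgebra.lie_mem_derivedSeries_one _ _)
      (SMulMemClass.smul_mem _ (hder (-2) (neg_ne_zero.2 h2) f hf))
  · refine (hker _).1 ?_
    rw [map_sub, LieHom.map_lie, hee, hff, hh, t.lie_e_f, sub_self]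
  · exact sub_mem (LieAlgebra.lie_mem_derivedSeries_one _ _) (LieAlgebra.lie_mem_derivedSeries_one _ _)
  · rintro rfl
    exact t.e_ne_zero (by rw [← hee, map_zero])
  · rintro rfl
    exact t.f_ne_zero (by rw [← hff, map_zero])

end LeviTriple

section Sl2Half

variable {A : Type*} [CommRing A] [Algebra ℂ A]

theorem Derivation.lie_smul_smul_sub (ξ ξ' : Derivation ℂ A A) (b z b' : A) :
    ⁅b • ξ, (z * b') • ξ'⁆ - ⁅(b * z) • ξ, b' • ξ'⁆ = (b * b') • (ξ z • ξ' + ξ' z • ξ) := by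
  ext a
  simp only [Derivation.sub_apply, Derivation.commutator_apply, Derivation.smul_apply,
    Derivation.add_apply, Derivation.leibniz, smul_eq_mul]
  ring

theorem Derivation.smul_ne_zero_of_ne [IsDomain A] {a : A} {D : Derivation ℂ A A} (ha : a ≠ 0)
    (hD : D ≠ 0) : a • D ≠ 0 := by
  contrapose! hD
  ext x
  have := congrArg (fun D : Derivation ℂ A A => D x) hD
  simpa [ha] using this

/-- The data of a grading derivation `E` and a raising operator `e` with properties inherited from
the representation theory of `sl₂`. -/
structure IsSl2Half (E e : Derivation ℂ A A) : Prop where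
  complete_E : IsCompleteField E
  complete_e : IsCompleteField e
  lnd : IsLND e
  E_e : ∀ a, E (e a) = e (E a) + (2 : ℂ) • e a
  surj : ∀ ν : ℂ, (∀ n : ℕ, ν ≠ -n) → ∀ a, E a = ν • a → ∃ b, E b = (ν - 2) • b ∧ e b = a
  pos : ∃ a, a ≠ 0 ∧ E a = (2 : ℂ) • a

variable {E e f : Derivation ℂ A A}

theorem IsSl2Half.apply_e (h : IsSl2Half E e) {a : A} {ν : ℂ} (ha : E a = ν • a) :
    E (e a) = (ν + 2) • e a := by
  rw [h.E_e, ha, Derivation.map_smul, add_smul]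

theorem IsSl2Half.lie_eq (h : IsSl2Half E e) : ⁅e, E⁆ = -((2 : ℂ) • e) := by
  ext a
  rw [Derivation.commutator_apply, h.E_e, sub_add_cancel_left]
  rfl

theorem IsSl2Half.e_mem (h : IsSl2Half E e) : e ∈ LieAlgGen A :=
  LieSubalgebra.subset_lieSpan h.complete_e

theorem IsSl2Half.e_smul_mem (h : IsSl2Half E e) {a : A} (ha : e (e a) = 0) :
    a • e ∈ LieAlgGen A := smul_mem_lieAlgGen h.complete_e ha

theorem IsSl2Half.mixed_mem (h : IsSl2Half E e) (j : ℕ) {φ : A} (hφ : E φ = (2 * j : ℂ) • φ) :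
    e φ • E - ((2 * j + 2 : ℂ) • φ) • e ∈ LieAlgGen A := by
  induction j generalizing φ with
  | zero =>
    have h0 : E φ = 0 := by simpa using hφ
    have h1 : φ • E ∈ LieAlgGen A := smul_mem_lieAlgGen h.complete_E (by rw [h0, map_zero])
    convert (LieAlgGen A).lie_mem h.e_mem h1 using 1
    rw [Derivation.lie_smul_right, h.lie_eq]
    ext a
    simp [Algebra.smul_def]
    ring
  | succ j ih =>
    obtain ⟨ψ, hψ, rfl⟩ := h.surj (2 * ((j + 1 : ℕ) : ℂ)) (fun n hn => by
      have h1 : ((2 * (j + 1) + n : ℕ) : ℂ) = 0 := by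
        push_cast at hn ⊢; rw [hn]; ring
      norm_cast at h1
      omega) φ hφ
    have h1 : E ψ = (2 * j : ℂ) • ψ := by
      rw [hψ]; congr 1; push_cast; ring
    convert (LieAlgGen A).lie_mem h.e_mem (ih h1) using 1
    rw [lie_sub, Derivation.lie_smul_right, Derivation.lie_smul_right, h.lie_eq, lie_self]
    ext a
    simp [Algebra.smul_def]
    ring

theorem IsSl2Half.exists_last (h : IsSl2Half E e) {a : A} (ha : a ≠ 0) {ν : ℂ} (hν : E a = ν • a) :
    ∃ (i : ℕ) (b : A), E b = (ν + 2 * i) • b ∧ b ≠ 0 ∧ e b = 0 := by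
  classical
  have hex := h.lnd a
  have hE : ∀ i : ℕ, E (((e : A →ₗ[ℂ] A) ^ i : Module.End ℂ A) a) =
      (ν + 2 * i) • ((e : A →ₗ[ℂ] A) ^ i : Module.End ℂ A) a := by
    intro i
    induction i with
    | zero => simpa using hν
    | succ i ih =>
      rw [pow_succ', Module.End.mul_apply]
      change E (e _) = _ • e _
      rw [h.apply_e ih]
      congr 1
      push_cast
      ring
  obtain ⟨i, hi⟩ : ∃ i, Nat.find hex = i + 1 := by
    refine Nat.exists_eq_succ_of_ne_zero fun h0 => ?_
    have := Nat.find_spec hex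
    rw [h0, pow_zero] at this
    exact ha this
  refine ⟨i, _, hE i, Nat.find_min hex (by omega), ?_⟩
  have := Nat.find_spec hex
  rw [hi, pow_succ', Module.End.mul_apply] at this
  exact this

/-- An element of weight zero not killed by `e`, and one of even weight killed by `e ^ 2`
but not by `e`. -/
theorem IsSl2Half.exists_elements (h : IsSl2Half E e) :
    (∃ z, E z = 0 ∧ e z ≠ 0) ∧
      ∃ (i : ℕ) (g : A), E g = (2 * i : ℂ) • g ∧ e g ≠ 0 ∧ e (e g) = 0 := by
  obtain ⟨a, ha0, ha⟩ := h.pos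
  obtain ⟨i, b, hb, hb0, heb⟩ := h.exists_last ha0 ha
  have hpos : ∀ (j : ℕ) (n : ℕ), (2 + 2 * j : ℂ) ≠ -n := fun j n hn => by
    have h1 : ((2 + 2 * j + n : ℕ) : ℂ) = 0 := by
      push_cast; rw [hn]; ring
    norm_cast at h1
    omega
  obtain ⟨z, hz, rfl⟩ := h.surj 2 (by simpa using hpos 0) a ha
  obtain ⟨g, hg, rfl⟩ := h.surj (2 + 2 * i) (hpos i) b hb
  exact ⟨⟨z, by simpa using hz, ha0⟩, i, g, by rw [hg]; congr 1; ring, hb0, heb⟩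

theorem IsSl2Half.mul_smul_mem (h : IsSl2Half E e) {i j : ℕ} {g φ : A}
    (hg : E g = (2 * i : ℂ) • g) (hg2 : e (e g) = 0) (hφ : E φ = (2 * j : ℂ) • φ) :
    φ • e g • e ∈ LieAlgGen A := by
  have h1 := h.mixed_mem j hφ
  have h2 := (LieAlgGen A).lie_mem h1 (h.e_smul_mem hg2)
  have hE : E (e φ) = (2 * j + 2 : ℂ) • e φ := h.apply_e hφ
  have h3 := h.mixed_mem (i + j + 1) (φ := g * e φ) (by
    rw [Derivation.apply_mul_eigen hg hE]; congr 1; push_cast; ring)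
  have hEg : E (e g) = (2 * i + 2 : ℂ) • e g := h.apply_e hg
  have h4 := h.mixed_mem (i + j + 1) (φ := φ * e g) (by
    rw [Derivation.apply_mul_eigen hφ hEg]; congr 1; push_cast; ring)
  have h5 := sub_mem (add_mem h2 h3) h4
  have h6 : ⁅e φ • E - ((2 * j + 2 : ℂ) • φ) • e, g • e⁆ +
      (e (g * e φ) • E - ((2 * ((i + j + 1 : ℕ) : ℂ) + 2) • (g * e φ)) • e) -
      (e (φ * e g) • E - ((2 * ((i + j + 1 : ℕ) : ℂ) + 2) • (φ * e g)) • e) =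
      (2 * i + 2 : ℂ) • (φ • e g • e) := by
    ext a
    simp only [Derivation.sub_apply, Derivation.commutator_apply, Derivation.smul_apply,
      Derivation.add_apply, Derivation.leibniz, smul_eq_mul, map_sub, Derivation.map_smul, hg,
      hg2, h.E_e]
    simp only [Algebra.smul_def, map_add, map_mul, map_natCast, map_ofNat]
    push_cast
    ring
  rw [h6] at h5
  have hi : (2 * i + 2 : ℂ) ≠ 0 := by
    have : ((2 * i + 2 : ℕ) : ℂ) ≠ 0 := by norm_cast
    simpa using this
  have := (LieAlgGen A).smul_mem (2 * i + 2 : ℂ)⁻¹ h5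
  rwa [smul_smul, inv_mul_cancel₀ hi, one_smul] at this

theorem modPart_ne_bot_of_sl2 [IsDomain A] (he : IsSl2Half E e) (hf : IsSl2Half (-E) f)
    (htop : ⨆ μ, Module.End.eigenspace (E : A →ₗ[ℂ] A) μ = ⊤)
    (hintl : ∀ (ν : ℂ) (a : A), a ≠ 0 → E a = ν • a → ∃ m : ℤ, ν = m) : modPart A ≠ ⊥ := by
  have : CharZero A := charZero_of_injective_algebraMap (algebraMap ℂ A).injective
  obtain ⟨⟨z, hz, hez⟩, i, g, hg, hk, hg2⟩ := he.exists_elements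
  obtain ⟨-, i', g', hg', hk', hg2'⟩ := hf.exists_elements
  obtain ⟨a₀, ha₀, -⟩ := hf.pos
  have hf0 : f ≠ 0 := by
    rintro rfl
    exact hk' rfl
  let η : Derivation ℂ A A := e z • f + f z • e
  let ζ : Derivation ℂ A A := (e g * f g') • η
  have hη0 : η ≠ 0 := by
    intro h0
    by_cases hfz : f z = 0
    · have : η = e z • f := by simp [η, hfz]
      rw [this] at h0
      exact (Derivation.smul_ne_zero_of_ne hez hf0) h0
    · have := congrArg (fun D : Derivation ℂ A A => D z) h0
      simp only [η, Derivation.add_apply, Derivation.smul_apply, smul_eq_mul,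
        Derivation.zero_apply] at this
      have h2 : 2 * (e z * f z) = 0 := by rw [← this]; ring
      exact mul_ne_zero two_ne_zero (mul_ne_zero hez hfz) h2
  have hζ0 : ζ ≠ 0 := Derivation.smul_ne_zero_of_ne (mul_ne_zero hk hk') hη0
  have hpos : ∀ (j : ℕ) (b : A), E b = (2 * j : ℂ) • b → b • e g • e ∈ LieAlgGen A := fun j b hb =>
    he.mul_smul_mem hg hg2 hb
  have hneg : ∀ (j : ℕ) (b : A), E b = (-(2 * j) : ℂ) • b → b • f g' • f ∈ LieAlgGen A :=
    fun j b hb => hf.mul_smul_mem (j := j) hg' hg2' (by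
      rw [Derivation.neg_apply, hb, neg_smul, neg_neg])
  have hpn : ∀ (j j' : ℕ) (b b' : A), E b = (2 * j : ℂ) • b → E b' = (-(2 * j') : ℂ) • b' →
      (b * b') • ζ ∈ LieAlgGen A := by
    intro j j' b b' hb hb'
    have hz' : E z = (0 : ℂ) • z := by rw [hz, zero_smul]
    have h1 := (LieAlgGen A).lie_mem (hpos j b hb) (hneg j' (z * b') (by
      rw [Derivation.apply_mul_eigen hz' hb', zero_add]))
    have h2 := (LieAlgGen A).lie_mem (hpos j (b * z) (by
      rw [Derivation.apply_mul_eigen hb hz', add_zero])) (hneg j' b' hb')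
    have h3 := sub_mem h1 h2
    rw [Derivation.lie_smul_smul_sub] at h3
    convert h3 using 1
    ext a
    simp only [ζ, η, Derivation.add_apply, Derivation.smul_apply, smul_eq_mul]
    ring
  have hev : ∀ (m : ℤ) (b : A), E b = (2 * m : ℂ) • b → b • ζ ∈ LieAlgGen A := by
    intro m b hb
    obtain ⟨j, rfl | rfl⟩ := m.eq_nat_or_neg
    · have := hpn j 0 b 1 (by simpa using hb) (by simp)
      rwa [mul_one] at this
    · have := hpn 0 j 1 b (by simp) (by simpa using hb)
      rwa [one_mul] at this
  have hsum : ∀ θ : Derivation ℂ A A, (∀ (m : ℤ) (b : A), E b = (m : ℂ) • b → b • θ ∈ LieAlgGen A) →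
      θ ∈ modPart A := by
    intro θ hθ b
    have hb : b ∈ ⨆ μ, Module.End.eigenspace (E : A →ₗ[ℂ] A) μ := htop ▸ Submodule.mem_top
    induction hb using Submodule.iSup_induction' with
    | mem μ b hb =>
      have hb' : E b = μ • b := Module.End.mem_eigenspace_iff.1 hb
      by_cases hb0 : b = 0
      · rw [hb0, zero_smul]; exact zero_mem _
      obtain ⟨m, rfl⟩ := hintl μ b hb0 hb'
      exact hθ m b hb'
    | zero => rw [zero_smul]; exact zero_mem _
    | add x y _ _ hx hy => rw [add_smul]; exact add_mem hx hy
  by_cases hodd : ∃ (m : ℤ) (p : A), p ≠ 0 ∧ E p = (2 * m + 1 : ℂ) • p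
  · obtain ⟨m, p, hp0, hp⟩ := hodd
    obtain ⟨l, q, hq, hq0, heq⟩ := he.exists_last hp0 hp
    let θ : Derivation ℂ A A := ζ g • e + e g • ζ
    have hθ0 : θ ≠ 0 := by
      intro h0
      by_cases hζg : ζ g = 0
      · have : θ = e g • ζ := by simp [θ, hζg]
        rw [this] at h0
        exact (Derivation.smul_ne_zero_of_ne hk hζ0) h0
      · have := congrArg (fun D : Derivation ℂ A A => D g) h0
        simp only [θ, Derivation.add_apply, Derivation.smul_apply, smul_eq_mul,
          Derivation.zero_apply] at this
        have h2 : 2 * (ζ g * e g) = 0 := by rw [← this]; ring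
        exact mul_ne_zero two_ne_zero (mul_ne_zero hζg hk) h2
    have hker : ∀ (m : ℤ) (b r : A), E b = (2 * m : ℂ) • b → e r = 0 →
        (b * r) • θ ∈ LieAlgGen A := by
      intro m b r hb hr
      have h1 := (LieAlgGen A).lie_mem (hev m b hb) (he.e_smul_mem (a := g * r) (by
        simp [hr, hg2]))
      have h2 := (LieAlgGen A).lie_mem (hev (m + i) (b * g) (by
        rw [Derivation.apply_mul_eigen hb hg]; congr 1; push_cast; ring))
        (he.e_smul_mem (a := r) (by simp [hr]))
      have h3 := sub_mem h1 h2
      rw [Derivation.lie_smul_smul_sub ζ e b g r] at h3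
      exact h3
    have hmem : (q * q) • θ ∈ modPart A := by
      refine hsum _ fun n b hb => ?_
      obtain ⟨c, rfl | rfl⟩ := n.even_or_odd'
      · rw [smul_smul]
        refine hker c b (q * q) (by simpa using hb) (by simp [heq])
      · rw [smul_smul, ← mul_assoc]
        refine hker (c + m + l + 1) (b * q) q ?_ heq
        rw [Derivation.apply_mul_eigen hb hq]
        congr 1
        push_cast
        ring
    exact fun hbot => Derivation.smul_ne_zero_of_ne (mul_ne_zero hq0 hq0) hθ0 (by
      rw [hbot] at hmem; exact (Submodule.mem_bot A).1 hmem)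
  · push Not at hodd
    have hmem : ζ ∈ modPart A := by
      refine hsum _ fun n b hb => ?_
      by_cases hb0 : b = 0
      · rw [hb0, zero_smul]; exact zero_mem _
      obtain ⟨c, rfl | rfl⟩ := n.even_or_odd'
      · exact hev c b (by simpa using hb)
      · exact absurd (by simpa using hb) (hodd c b hb0)
    exact fun hbot => hζ0 (by rw [hbot] at hmem; exact (Submodule.mem_bot A).1 hmem)

end Sl2Half

section MaxGen

variable {M N : Type*} [AddCommGroup M] [Module ℂ M] [AddCommGroup N] [Module ℂ N]

theorem Module.End.mem_maxGenEigenspace_iff_of_injective {S : Module.End ℂ M} {T : Module.End ℂ N}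
    {j : M →ₗ[ℂ] N} (hj : Function.Injective j) (h : ∀ x, j (S x) = T (j x)) {μ : ℂ} {x : M} :
    j x ∈ T.maxGenEigenspace μ ↔ x ∈ S.maxGenEigenspace μ := by
  have hk : ∀ (k : ℕ) x, j (((S - μ • 1) ^ k) x) = ((T - μ • 1) ^ k) (j x) := by
    intro k
    induction k with
    | zero => intro x; simp
    | succ k ih =>
      intro x
      rw [pow_succ, pow_succ, Module.End.mul_apply, Module.End.mul_apply, ih]
      congr 1
      simp [h]
  rw [Module.End.mem_maxGenEigenspace, Module.End.mem_maxGenEigenspace]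
  refine exists_congr fun k => ?_
  rw [← hk, map_eq_zero_iff j hj]

theorem Module.End.exists_hasEigenvalue_re_pos [FiniteDimensional ℂ M] {T : Module.End ℂ M}
    (htr : LinearMap.trace ℂ M T = 0) {ν : ℂ} (hν : T.HasEigenvalue ν) (hν0 : ν.re ≠ 0) :
    ∃ μ, T.HasEigenvalue μ ∧ 0 < μ.re := by
  classical
  by_contra! hneg
  let b := Module.finBasis ℂ M
  have hroot : ∀ μ, μ ∈ T.charpoly.roots ↔ T.HasEigenvalue μ := fun μ => by
    rw [Module.End.hasEigenvalue_iff_isRoot_charpoly, Polynomial.mem_roots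
      (LinearMap.charpoly_monic T).ne_zero]
  have h1 : T.charpoly.roots.sum = 0 := by
    rw [← LinearMap.charpoly_toMatrix T b, ← Matrix.trace_eq_sum_roots_charpoly,
      ← LinearMap.trace_eq_matrix_trace, htr]
  obtain ⟨s, hs⟩ := Multiset.exists_cons_of_mem ((hroot ν).2 hν)
  rw [hs, Multiset.sum_cons] at h1
  have h2 : 0 ≤ (s.map fun μ => -μ.re).sum := by
    refine Multiset.sum_nonneg fun x hx => ?_
    obtain ⟨μ, hμ, rfl⟩ := Multiset.mem_map.1 hx
    have := hneg μ ((hroot μ).1 (hs ▸ Multiset.mem_cons_of_mem hμ))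
    linarith
  have h3 : (s.map fun μ => -μ.re).sum = -s.sum.re := by
    exact (map_multiset_sum (-Complex.reAddGroupHom) s).symm
  have h4 := congrArg Complex.re h1
  rw [Complex.add_re, Complex.zero_re] at h4
  have h5 := hneg ν hν
  exact hν0 (by linarith)

end MaxGen

section SemisimplePart

variable {A : Type*} [CommRing A] [Algebra ℂ A] {V : Submodule ℂ A}

/-- The powers of a generating subspace, as Lie submodules. -/
def powLieSubmodule (V : Submodule ℂ A) (n : ℕ) : LieSubmodule ℂ (stabDer V) A :=
  { V ^ n with lie_mem := fun {δ m} hm => stabDer_pow δ.2 n m hm }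

theorem mem_powLieSubmodule {n : ℕ} {a : A} : a ∈ powLieSubmodule V n ↔ a ∈ V ^ n := Iff.rfl

theorem mem_maxGenEigenspace_powLieSubmodule {n : ℕ} {δ : stabDer V} {μ : ℂ}
    {m : powLieSubmodule V n} :
    (m : A) ∈ Module.End.maxGenEigenspace ((δ : Derivation ℂ A A) : A →ₗ[ℂ] A) μ ↔
      m ∈ (LieModule.toEnd ℂ (stabDer V) (powLieSubmodule V n) δ).maxGenEigenspace μ :=
  Module.End.mem_maxGenEigenspace_iff_of_injective
    (j := (powLieSubmodule V n).toSubmodule.subtype) Subtype.val_injective (fun _ => rfl)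

theorem mem_maxGenEigenspace_stabDer {δ ε : stabDer V} {μ : ℂ} :
    (ε : Derivation ℂ A A) ∈ (LieAlgebra.ad ℂ (Derivation ℂ A A) δ).maxGenEigenspace μ ↔
      ε ∈ (LieAlgebra.ad ℂ (stabDer V) δ).maxGenEigenspace μ :=
  Module.End.mem_maxGenEigenspace_iff_of_injective
    (j := (stabDer V).toSubmodule.subtype) Subtype.val_injective (fun _ => rfl)

variable {h e f : stabDer V} {E : Derivation ℂ A A}

theorem IsGenSpace.mem_maxGenEigenspace_of_apply_eq (hV : IsGenSpace V)
    (hEh : ∀ μ, ∀ a ∈ Module.End.maxGenEigenspace ((h : Derivation ℂ A A) : A →ₗ[ℂ] A) μ,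
      E a = μ • a) {μ : ℂ} {a : A} (ha : E a = μ • a) :
    a ∈ Module.End.maxGenEigenspace ((h : Derivation ℂ A A) : A →ₗ[ℂ] A) μ := by
  obtain ⟨b, hb, hab⟩ := Module.End.exists_mem_maxGenEigenspace_apply_eq
    (f := ((h : Derivation ℂ A A) : A →ₗ[ℂ] A)) (g := (E : A →ₗ[ℂ] A))
    (hV.isLocallyFinite h.2).iSup_maxGenEigenspace (LinearMap.id : A →ₗ[ℂ] A) 0
    (fun c m hm => by
      rw [add_zero]
      exact Module.End.eigenspace_le_maxGenEigenspace (Module.End.mem_eigenspace_iff.2 (hEh c m hm)))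
    (u := a) (c := μ) (by
      rw [add_zero]
      exact Module.End.eigenspace_le_maxGenEigenspace (Module.End.mem_eigenspace_iff.2 ha))
  exact (show b = a from hab) ▸ hb

theorem IsSl2TripleModRadical.exists_preimage (hV : IsGenSpace V)
    (t : IsSl2TripleModRadical h e f) {n : ℕ} {ν : ℂ} (hν : ∀ k : ℕ, ν ≠ -k) {a : A}
    (han : a ∈ V ^ n)
    (ha : a ∈ Module.End.maxGenEigenspace ((h : Derivation ℂ A A) : A →ₗ[ℂ] A) ν) :
    ∃ b ∈ V ^ n, b ∈ Module.End.maxGenEigenspace ((h : Derivation ℂ A A) : A →ₗ[ℂ] A) (ν - 2) ∧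
      (e : Derivation ℂ A A) b = a := by
  have := hV.finiteDimensional_stabDer
  have hfd : FiniteDimensional ℂ (powLieSubmodule V n) := hV.finiteDimensional_pow n
  let v : powLieSubmodule V n := ⟨a, han⟩
  have hv : v ∈ (LieModule.toEnd ℂ (stabDer V) (powLieSubmodule V n) h).maxGenEigenspace ν :=
    mem_maxGenEigenspace_powLieSubmodule.1 ha
  obtain ⟨w, hw⟩ := t.mem_range_toEnd _ rfl hν hv
  obtain ⟨w', hw', hww⟩ := Module.End.exists_mem_maxGenEigenspace_apply_eq
    (f := LieModule.toEnd ℂ (stabDer V) (powLieSubmodule V n) h)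
    (g := LieModule.toEnd ℂ (stabDer V) (powLieSubmodule V n) h)
    (Module.End.iSup_maxGenEigenspace_eq_top _)
    (LieModule.toEnd ℂ (stabDer V) (powLieSubmodule V n) e) 2
    (fun c m hm => LieModule.lie_mem_maxGenEigenspace t.e_mem hm)
    (u := w) (c := ν - 2) (by
      rw [LieModule.toEnd_apply_apply, hw, sub_add_cancel]; exact hv)
  refine ⟨w', w'.2, mem_maxGenEigenspace_powLieSubmodule.2 hw', ?_⟩
  have : (LieModule.toEnd ℂ (stabDer V) (powLieSubmodule V n) e) w' = v := by
    rw [hww, LieModule.toEnd_apply_apply, hw]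
  exact congrArg Subtype.val this

theorem IsSl2TripleModRadical.exists_int (hV : IsGenSpace V) (t : IsSl2TripleModRadical h e f)
    {ν : ℂ} {a : A} (ha0 : a ≠ 0)
    (ha : a ∈ Module.End.maxGenEigenspace ((h : Derivation ℂ A A) : A →ₗ[ℂ] A) ν) :
    ∃ m : ℤ, ν = m := by
  by_contra! hm
  obtain ⟨n, hn⟩ := hV.exists_mem_pow a
  have hfd : FiniteDimensional ℂ (V ^ n : Submodule ℂ A) := hV.finiteDimensional_pow n
  have hex : ∀ k : ℕ, ∃ b ∈ V ^ n, b ≠ 0 ∧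
      b ∈ Module.End.maxGenEigenspace ((h : Derivation ℂ A A) : A →ₗ[ℂ] A) (ν - 2 * k) := by
    intro k
    induction k with
    | zero => exact ⟨a, hn, ha0, by simpa using ha⟩
    | succ k ih =>
      obtain ⟨b, hb, hb0, hbm⟩ := ih
      obtain ⟨c, hc, hcm, rfl⟩ := t.exists_preimage hV (ν := ν - 2 * k) (fun l hl => by
        refine hm (2 * k - l) ?_
        push_cast
        linear_combination hl) hb hbm
      refine ⟨c, hc, ?_, ?_⟩
      · rintro rfl; exact hb0 (map_zero _)
      · convert hcm using 2; push_cast; ring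
  have hfin := Module.End.finite_inf_maxGenEigenspace_ne_bot
    (δ := ((h : Derivation ℂ A A) : A →ₗ[ℂ] A)) (W := V ^ n) (stabDer_pow h.2 n)
  refine Set.infinite_of_injective_forall_mem (f := fun k : ℕ => ν - 2 * (k : ℂ)) ?_ ?_ hfin
  · intro k l hkl
    simpa using hkl
  · intro k hbot
    obtain ⟨b, hb, hb0, hbm⟩ := hex k
    exact hb0 ((Submodule.mem_bot ℂ).1 (hbot ▸ ⟨hb, hbm⟩))

theorem IsSl2TripleModRadical.exists_pos [IsDomain A] (hV : IsGenSpace V)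
    (t : IsSl2TripleModRadical h e f) (he : e ≠ 0) :
    ∃ a : A, a ≠ 0 ∧
      a ∈ Module.End.maxGenEigenspace ((h : Derivation ℂ A A) : A →ₗ[ℂ] A) 2 := by
  have := hV.finiteDimensional_stabDer
  have hfd : FiniteDimensional ℂ (powLieSubmodule V 1) := hV.finiteDimensional_pow 1
  let T := LieModule.toEnd ℂ (stabDer V) (powLieSubmodule V 1) h
  have hev : ∀ μ, T.HasEigenvalue μ → ∃ a : A, a ≠ 0 ∧
      a ∈ Module.End.maxGenEigenspace ((h : Derivation ℂ A A) : A →ₗ[ℂ] A) μ := by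
    intro μ hμ
    obtain ⟨v, hv⟩ := hμ.exists_hasEigenvector
    exact ⟨v, fun h0 => hv.2 (Subtype.ext h0), mem_maxGenEigenspace_powLieSubmodule.2
      (Module.End.eigenspace_le_maxGenEigenspace hv.1)⟩
  have hne : ∃ ν, T.HasEigenvalue ν ∧ ν.re ≠ 0 := by
    by_contra! hall
    have hz : T.maxGenEigenspace 0 = ⊤ := by
      rw [eq_top_iff, ← Module.End.iSup_maxGenEigenspace_eq_top T]
      refine iSup_le fun μ => ?_
      by_cases hμ : T.HasEigenvalue μ
      · obtain ⟨a, ha0, ha⟩ := hev μ hμ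
        obtain ⟨m, rfl⟩ := t.exists_int hV ha0 ha
        have := hall _ hμ
        rw [Complex.intCast_re] at this
        norm_cast at this
        rw [this, Int.cast_zero]
      · have : T.maxGenEigenspace μ = ⊥ := by
          by_contra hb
          exact hμ (Module.End.HasUnifEigenvalue.lt zero_lt_one (k := ⊤) hb)
        rw [this]
        exact bot_le
    refine he (Subtype.ext (hV.derivation_ext fun v hv => ?_))
    have hv1 : v ∈ V ^ 1 := by rwa [pow_one]
    have h0 : ∀ w ∈ V, w ∈ Module.End.maxGenEigenspace ((h : Derivation ℂ A A) : A →ₗ[ℂ] A) 0 := by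
      intro w hw
      have : (⟨w, by rwa [mem_powLieSubmodule, pow_one]⟩ : powLieSubmodule V 1) ∈
        T.maxGenEigenspace 0 := hz ▸ Submodule.mem_top
      exact mem_maxGenEigenspace_powLieSubmodule.2 this
    have h2 := Derivation.apply_mem_maxGenEigenspace (mem_maxGenEigenspace_stabDer.2 t.e_mem)
      (h0 v hv)
    have h3 := h0 _ (e.2 v hv)
    rw [zero_add] at h2
    have hd := (Module.End.independent_maxGenEigenspace
      ((h : Derivation ℂ A A) : A →ₗ[ℂ] A)).pairwiseDisjoint (two_ne_zero : (2 : ℂ) ≠ 0)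
    exact Submodule.disjoint_def.1 hd _ h2 h3
  obtain ⟨ν, hν, hν0⟩ := hne
  obtain ⟨μ, hμ, hμ0⟩ := Module.End.exists_hasEigenvalue_re_pos
    (LieModule.trace_toEnd_eq_zero_of_mem_derivedSeries t.h_mem) hν hν0
  obtain ⟨a, ha0, ha⟩ := hev μ hμ
  obtain ⟨m, rfl⟩ := t.exists_int hV ha0 ha
  rw [Complex.intCast_re] at hμ0
  norm_cast at hμ0
  obtain ⟨k, rfl⟩ := Int.eq_succ_of_zero_lt hμ0
  clear hμ hμ0 hev
  induction k using Nat.strong_induction_on generalizing a with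
  | _ k ih =>
    match k with
    | 0 =>
      refine ⟨a * a, mul_ne_zero ha0 ha0, ?_⟩
      convert Derivation.mul_mem_maxGenEigenspace _ ha ha using 2
      norm_num
    | 1 => exact ⟨a, ha0, by convert ha using 2; norm_num⟩
    | k + 2 =>
      obtain ⟨n, hn⟩ := hV.exists_mem_pow a
      obtain ⟨b, -, hb, rfl⟩ := t.exists_preimage hV (fun l hl => by
        have : ((k + 2 + 1 + l : ℕ) : ℂ) = 0 := by
          push_cast at hl ⊢
          rw [hl]; ring
        norm_cast at this
        omega) hn ha
      refine ih k (by omega) b (fun h0 => ha0 (by rw [h0, map_zero])) ?_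
      convert hb using 2
      push_cast
      ring

theorem IsSl2TripleModRadical.isSl2Half [IsDomain A] (hV : IsGenSpace V)
    (t : IsSl2TripleModRadical h e f) (he : e ≠ 0) (hE : E ∈ stabDer V)
    (hEh : ∀ μ, ∀ a ∈ Module.End.maxGenEigenspace ((h : Derivation ℂ A A) : A →ₗ[ℂ] A) μ,
      E a = μ • a) : IsSl2Half E (e : Derivation ℂ A A) := by
  have htop := (hV.isLocallyFinite h.2).iSup_maxGenEigenspace
  have hshift : ∀ μ, ∀ a ∈ Module.End.maxGenEigenspace ((h : Derivation ℂ A A) : A →ₗ[ℂ] A) μ,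
      (e : Derivation ℂ A A) a ∈
        Module.End.maxGenEigenspace ((h : Derivation ℂ A A) : A →ₗ[ℂ] A) (μ + 2) :=
    fun μ a ha => Derivation.apply_mem_maxGenEigenspace
      (mem_maxGenEigenspace_stabDer.2 t.e_mem) ha
  refine ⟨(hV.isLocallyFinite hE).isCompleteField, (hV.isLocallyFinite e.2).isCompleteField,
    hV.isLND_of_shift h.2 e.2 two_ne_zero hshift, ?_, ?_, ?_⟩
  · intro a
    have ha : a ∈ (⊤ : Submodule ℂ A) := Submodule.mem_top
    rw [← htop] at ha
    induction ha using Submodule.iSup_induction' with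
    | mem μ a ha =>
      rw [hEh _ _ (hshift μ a ha), hEh _ _ ha, Derivation.map_smul, add_smul]
    | zero => simp
    | add x y _ _ hx hy =>
      simp only [map_add, smul_add, hx, hy]
      abel
  · intro ν hν a ha
    obtain ⟨n, hn⟩ := hV.exists_mem_pow a
    obtain ⟨b, -, hb, hba⟩ := t.exists_preimage hV hν hn (hV.mem_maxGenEigenspace_of_apply_eq hEh ha)
    exact ⟨b, hEh _ _ hb, hba⟩
  · obtain ⟨a, ha0, ha⟩ := t.exists_pos hV he
    exact ⟨a, ha0, hEh _ _ ha⟩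

theorem IsGenSpace.modPart_ne_bot_of_not_isSolvable [IsDomain A] (hV : IsGenSpace V)
    (hL : ¬ LieAlgebra.IsSolvable (stabDer V)) : modPart A ≠ ⊥ := by
  have := hV.finiteDimensional_stabDer
  obtain ⟨h, e, f, t, he, hf⟩ := exists_isSl2TripleModRadical hL
  obtain ⟨E, hE, hEh⟩ := hV.exists_jordan h.2 (AddMonoidHom.id ℂ)
  have hEh' : ∀ μ, ∀ a ∈ Module.End.maxGenEigenspace ((h : Derivation ℂ A A) : A →ₗ[ℂ] A) μ,
      E a = μ • a := hEh
  refine modPart_ne_bot_of_sl2 (t.isSl2Half hV he hE hEh')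
    (t.symm.isSl2Half hV hf (neg_mem hE) fun μ a ha => ?_) ?_ ?_
  · have h1 : a ∈ Module.End.maxGenEigenspace
        (-((h : Derivation ℂ A A) : A →ₗ[ℂ] A) : Module.End ℂ A) μ := ha
    rw [Module.End.maxGenEigenspace_neg] at h1
    rw [Derivation.neg_apply, hEh' _ _ h1, neg_smul, neg_neg]
  · rw [eq_top_iff, ← (hV.isLocallyFinite h.2).iSup_maxGenEigenspace]
    exact iSup_mono fun μ a ha => Module.End.mem_eigenspace_iff.2 (hEh' μ a ha)
  · intro ν a ha0 ha
    exact t.exists_int hV ha0 (hV.mem_maxGenEigenspace_of_apply_eq hEh' ha)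

end SemisimplePart

section Extension

theorem Algebra.FormallySmooth.exists_section {R L T : Type*} [CommRing R] [CommRing L] [CommRing T]
    [Algebra R L] [Algebra.FormallySmooth R L] (S : R →+* T) (π : T →+* L)
    (hπ : ∀ r, π (S r) = algebraMap R L r) (hs : Function.Surjective π)
    (hker : ∀ x y, π x = 0 → π y = 0 → x * y = 0) :
    ∃ s : L →+* T, (∀ x, π (s x) = x) ∧ ∀ r, s (algebraMap R L r) = S r := by
  let : Algebra R T := S.toAlgebra
  let π' : T →ₐ[R] L := { π with commutes' := hπ }
  have hnil : IsNilpotent (RingHom.ker (π' : T →+* L)) := by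
    refine ⟨2, ?_⟩
    rw [Ideal.zero_eq_bot, eq_bot_iff, pow_two, Ideal.mul_le]
    intro x hx y hy
    exact hker x y hx hy
  let s := Algebra.FormallySmooth.liftOfSurjective (AlgHom.id R L) π' hs hnil
  refine ⟨s, fun x => ?_, fun r => s.commutes r⟩
  exact Algebra.FormallySmooth.liftOfSurjective_apply (AlgHom.id R L) π' hs hnil x

theorem Derivation.exists_extend_of_formallySmooth {R L : Type*} [CommRing R] [Algebra ℂ R]
    [CommRing L] [Algebra ℂ L] [Algebra R L] [IsScalarTower ℂ R L]
    [Algebra.FormallySmooth R L] (D : Derivation ℂ R R) :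
    ∃ D' : Derivation ℂ L L, ∀ r, D' (algebraMap R L r) = algebraMap R L (D r) := by
  let S : R →+* TrivSqZeroExt L L :=
    { toFun := fun r => TrivSqZeroExt.inl (algebraMap R L r) + TrivSqZeroExt.inr (algebraMap R L (D r))
      map_one' := by ext <;> simp
      map_zero' := by ext <;> simp
      map_add' := fun x y => by ext <;> simp [-DualNumber.inr_eq_smul_eps]
      map_mul' := fun x y => by
        ext
        · simp
        · simp [-DualNumber.inr_eq_smul_eps, mul_comm] }
  obtain ⟨s, hs, hsS⟩ := Algebra.FormallySmooth.exists_section (R := R) (L := L) S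
    (TrivSqZeroExt.fstHom L L L : TrivSqZeroExt L L →+* L) (fun r => by simp [S])
    (fun x => ⟨TrivSqZeroExt.inl x, by simp⟩) (fun x y hx hy => by
      change x.fst = 0 at hx
      change y.fst = 0 at hy
      ext <;> simp [hx, hy])
  have hfst : ∀ x, (s x).fst = x := hs
  have hC : ∀ c : ℂ, (s (algebraMap ℂ L c)).snd = 0 := fun c => by
    rw [IsScalarTower.algebraMap_apply ℂ R L, hsS]
    simp [S]
  let Dl : L →ₗ[ℂ] L :=
    { toFun := fun x => (s x).snd
      map_add' := fun x y => by simp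
      map_smul' := fun c x => by
        rw [Algebra.smul_def, map_mul, TrivSqZeroExt.snd_mul, hC, hfst]
        simp [Algebra.smul_def] }
  refine ⟨Derivation.mk' Dl fun x y => ?_, fun r => ?_⟩
  · change (s (x * y)).snd = x • (s y).snd + y • (s x).snd
    rw [map_mul, TrivSqZeroExt.snd_mul, hfst, hfst]
    simp [mul_comm]
  · change (s _).snd = _
    rw [hsS]
    simp [S, -DualNumber.inr_eq_smul_eps]

theorem Algebra.FormallySmooth.fractionRing_of_injective {R B : Type*} [CommRing R]
    [IsDomain R] [CommRing B]
    [IsDomain B] [Algebra ℂ R] [Algebra ℂ B] [Algebra.FiniteType ℂ B] [Algebra R B]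
    [IsScalarTower ℂ R B] [FaithfulSMul R B] : Algebra.FormallySmooth R (FractionRing B) := by
  let : Algebra (FractionRing R) (FractionRing B) := FractionRing.liftAlgebra R _
  have := FractionRing.isScalarTower_liftAlgebra R (FractionRing B)
  have : IsScalarTower ℂ (FractionRing R) (FractionRing B) := by
    refine IsScalarTower.of_algebraMap_eq fun c => ?_
    rw [IsScalarTower.algebraMap_apply ℂ R (FractionRing R), ← IsScalarTower.algebraMap_apply R,
      ← IsScalarTower.algebraMap_apply]
  have : CharZero R := charZero_of_injective_algebraMap (algebraMap ℂ R).injective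
  have : CharZero (FractionRing R) := inferInstance
  have h1 : Algebra.EssFiniteType B (FractionRing B) := .of_isLocalization _ (nonZeroDivisors B)
  have h2 : Algebra.EssFiniteType ℂ (FractionRing B) := .comp ℂ B _
  have : Algebra.EssFiniteType (FractionRing R) (FractionRing B) := .of_comp ℂ _ _
  have : Algebra.FormallySmooth R (FractionRing R) := .of_isLocalization (nonZeroDivisors R)
  exact .comp R (FractionRing R) (FractionRing B)

theorem Derivation.exists_smul_mem_range {B L : Type*} [CommRing B] [IsDomain B] [Algebra ℂ B]
    [Algebra.FiniteType ℂ B] [Field L] [Algebra B L] [Algebra ℂ L] [IsScalarTower ℂ B L]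
    [IsFractionRing B L] (D : Derivation ℂ L L) :
    ∃ b : B, b ≠ 0 ∧ ∃ D' : Derivation ℂ B B, ∀ x,
      algebraMap B L (D' x) = algebraMap B L b * D (algebraMap B L x) := by
  obtain ⟨s, hs⟩ := Algebra.FiniteType.out (R := ℂ) (A := B)
  classical
  obtain ⟨b, hb⟩ := IsLocalization.exist_integer_multiples_of_finset (nonZeroDivisors B)
    (s.image fun x => D (algebraMap B L x))
  have hinj : Function.Injective (algebraMap B L) := IsFractionRing.injective B L
  have hall : ∀ x : B, ∃ y : B, algebraMap B L y = algebraMap B L b * D (algebraMap B L x) := by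
    intro x
    have hx : x ∈ Algebra.adjoin ℂ (s : Set B) := hs ▸ Algebra.mem_top
    induction hx using Algebra.adjoin_induction with
    | mem x hx =>
      obtain ⟨y, hy⟩ := hb _ (Finset.mem_image_of_mem _ hx)
      exact ⟨y, by rw [hy, Algebra.smul_def]⟩
    | algebraMap r => exact ⟨0, by rw [← IsScalarTower.algebraMap_apply, D.map_algebraMap]; simp⟩
    | add x y _ _ hx hy =>
      obtain ⟨u, hu⟩ := hx
      obtain ⟨v, hv⟩ := hy
      exact ⟨u + v, by simp only [map_add, mul_add, hu, hv]⟩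
    | mul x y _ _ hx hy =>
      obtain ⟨u, hu⟩ := hx
      obtain ⟨v, hv⟩ := hy
      refine ⟨x * v + y * u, ?_⟩
      simp only [map_add, map_mul, hu, hv, D.leibniz, smul_eq_mul]
      ring
  choose d hd using hall
  refine ⟨b, nonZeroDivisors.coe_ne_zero b, Derivation.mk'
    { toFun := d
      map_add' := fun x y => hinj ?_
      map_smul' := fun c x => hinj ?_ } fun x y => hinj ?_, hd⟩
  · simp only [map_add, hd, mul_add]
  · rw [RingHom.id_apply, Algebra.smul_def, Algebra.smul_def, map_mul, hd, hd, map_mul,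
      ← IsScalarTower.algebraMap_apply, D.leibniz, D.map_algebraMap, smul_zero, add_zero,
      smul_eq_mul]
    ring
  · change algebraMap B L (d (x * y)) = algebraMap B L (x • d y + y • d x)
    simp only [map_add, map_mul, hd, D.leibniz, smul_eq_mul]
    ring

/-- Derivations extend along injective maps of domains, up to a denominator. -/
theorem AlgHom.exists_extend_derivation {R B : Type*} [CommRing R] [IsDomain R] [CommRing B]
    [IsDomain B] [Algebra ℂ R] [Algebra ℂ B] [Algebra.FiniteType ℂ B] {o : R →ₐ[ℂ] B}
    (ho : Function.Injective o) (D : Derivation ℂ R R) :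
    ∃ b : B, b ≠ 0 ∧ ∃ D' : Derivation ℂ B B, ∀ x, D' (o x) = b * o (D x) := by
  let : Algebra R B := o.toRingHom.toAlgebra
  have : IsScalarTower ℂ R B := .of_algebraMap_eq fun c => (o.commutes c).symm
  have : FaithfulSMul R B := (faithfulSMul_iff_algebraMap_injective R B).2 ho
  have := Algebra.FormallySmooth.fractionRing_of_injective (R := R) (B := B)
  obtain ⟨D₁, hD₁⟩ := Derivation.exists_extend_of_formallySmooth (L := FractionRing B) D
  obtain ⟨b, hb, D₂, hD₂⟩ := Derivation.exists_smul_mem_range (B := B) D₁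
  refine ⟨b, hb, D₂, fun x => IsFractionRing.injective B (FractionRing B) ?_⟩
  have h1 : algebraMap B (FractionRing B) (o x) = algebraMap R (FractionRing B) x :=
    (IsScalarTower.algebraMap_apply R B (FractionRing B) x).symm
  have h2 : algebraMap B (FractionRing B) (o (D x)) = algebraMap R (FractionRing B) (D x) :=
    (IsScalarTower.algebraMap_apply R B (FractionRing B) (D x)).symm
  rw [hD₂, h1, hD₁, map_mul, h2]

theorem exists_algHom_apply_ne_zero {B : Type*} [CommRing B] [IsDomain B] [Algebra ℂ B]
    [Algebra.FiniteType ℂ B] {b : B} (hb : b ≠ 0) : ∃ χ : B →ₐ[ℂ] ℂ, χ b ≠ 0 := by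
  let C := Localization.Away b
  have : Nontrivial C := (IsLocalization.injective C
    (powers_le_nonZeroDivisors_of_noZeroDivisors hb)).nontrivial
  have : Algebra.FiniteType B C := IsLocalization.finiteType_of_monoid_fg (Submonoid.powers b) C
  have : Algebra.FiniteType ℂ C := .trans (R := ℂ) (S := B) inferInstance inferInstance
  obtain ⟨M, hM⟩ := Ideal.exists_maximal C
  let := Ideal.Quotient.field M
  have : Algebra.FiniteType ℂ (C ⧸ M) := inferInstance
  have := finite_of_finite_type_of_isJacobsonRing ℂ (C ⧸ M)
  have : Algebra.IsAlgebraic ℂ (C ⧸ M) := inferInstance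
  let ψ : (C ⧸ M) →ₐ[ℂ] ℂ := IsAlgClosed.lift
  let χ : B →ₐ[ℂ] ℂ := ψ.comp ((Ideal.Quotient.mkₐ ℂ M).comp (IsScalarTower.toAlgHom ℂ B C))
  refine ⟨χ, fun h => ?_⟩
  have h1 : IsUnit (algebraMap B C b) := IsLocalization.Away.algebraMap_isUnit b
  have h2 : IsUnit (χ b) := (h1.map (Ideal.Quotient.mkₐ ℂ M)).map ψ
  rw [h] at h2
  exact not_isUnit_zero h2

theorem exists_algHom_apply_eq_zero {B : Type*} [CommRing B] [Algebra ℂ B]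
    [Algebra.FiniteType ℂ B] {I : Ideal B} (hI : I ≠ ⊤) : ∃ χ : B →ₐ[ℂ] ℂ, ∀ b ∈ I, χ b = 0 := by
  obtain ⟨M, hM, hIM⟩ := Ideal.exists_le_maximal I hI
  let := Ideal.Quotient.field M
  have := finite_of_finite_type_of_isJacobsonRing ℂ (B ⧸ M)
  let ψ : (B ⧸ M) →ₐ[ℂ] ℂ := IsAlgClosed.lift
  refine ⟨ψ.comp (Ideal.Quotient.mkₐ ℂ M), fun b hb => ?_⟩
  have : Ideal.Quotient.mkₐ ℂ M b = 0 := Ideal.Quotient.eq_zero_iff_mem.2 (hIM hb)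
  rw [AlgHom.comp_apply, this, map_zero]

end Extension

section Action

open MvPolynomial in
theorem MvPolynomial.exists_C_mem_of_pderiv_mem {k : ℕ} {J : Set (MvPolynomial (Fin k) ℂ)}
    (hJ : ∀ x ∈ J, ∀ i, pderiv i x ∈ J) {x : MvPolynomial (Fin k) ℂ} (hx : x ∈ J) (hx0 : x ≠ 0) :
    ∃ c : ℂ, c ≠ 0 ∧ C c ∈ J := by
  induction hn : x.totalDegree using Nat.strong_induction_on generalizing x with
  | _ n ih =>
    by_cases hall : ∀ i, pderiv i x = 0
    · have hxC : x = C (coeff 0 x) := by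
        ext m
        rw [coeff_C]
        split_ifs with h0
        · rw [← h0]
        · obtain ⟨i, hi⟩ : ∃ i, m i ≠ 0 := by
            by_contra! h
            exact h0 (Finsupp.ext fun i => (h i).symm)
          have h1 : m - Finsupp.single i 1 + Finsupp.single i 1 = m :=
            tsub_add_cancel_of_le (Finsupp.single_le_iff.2 (Nat.one_le_iff_ne_zero.2 hi))
          have h2 := coeff_pderiv (i := i) x (m - Finsupp.single i 1)
          rw [hall i, coeff_zero, h1] at h2
          rcases mul_eq_zero.1 h2.symm with h3 | h3
          · exact h3
          · exact absurd h3 (Nat.cast_add_one_ne_zero _)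
      refine ⟨coeff 0 x, fun h => hx0 ?_, hxC ▸ hx⟩
      rw [hxC, h, C_0]
    · push Not at hall
      obtain ⟨i, hi⟩ := hall
      refine ih _ ?_ (hJ x hx i) hi rfl
      obtain ⟨m, hm, hdeg⟩ := Finset.exists_mem_eq_sup (pderiv i x).support
        (support_nonempty.2 hi) fun m => m.sum fun _ e => e
      have hm' : m + Finsupp.single i 1 ∈ x.support := by
        rw [mem_support_iff, coeff_pderiv] at hm
        exact mem_support_iff.2 (left_ne_zero_of_mul hm)
      have h1 := le_totalDegree hm'
      rw [Finsupp.sum_add_index' (fun _ => rfl) (fun _ _ _ => rfl),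
        Finsupp.sum_single_index rfl] at h1
      change (pderiv i x).totalDegree = _ at hdeg
      omega

variable {A : Type*} [CommRing A] [Algebra ℂ A] {V : Submodule ℂ A}
  {Γ : Type*} [Group Γ] {act : Γ →* (A ≃ₐ[ℂ] A)} {O : Subalgebra ℂ (Γ → ℂ)}

variable (act O) in
/-- A transitive action by algebra automorphisms, with matrix coefficients in a finitely generated
algebra of functions whose points are the elements of the group. -/
structure IsHomAction : Prop where
  regular : ∀ a : A, ∃ (k : ℕ) (b : Fin k → A) (c : Fin k → O),
    ∀ g, act g a = ∑ i, (c i : Γ → ℂ) g • b i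
  fg : Algebra.FiniteType ℂ O
  points : ∀ φ : O →ₐ[ℂ] ℂ, ∃ g : Γ, ∀ c : O, φ c = (c : Γ → ℂ) g
  trans : ∀ p q : A →ₐ[ℂ] ℂ, ∃ g : Γ, ∀ a, q a = p (act g a)

theorem IsHomAction.exists_isGenSpace (h : IsHomAction act O) [Algebra.FiniteType ℂ A] :
    ∃ V : Submodule ℂ A, IsGenSpace V ∧ ∀ g, ∀ v ∈ V, act g v ∈ V := by
  classical
  obtain ⟨s, hs⟩ := Algebra.FiniteType.out (R := ℂ) (A := A)
  let W : A → Submodule ℂ A := fun a => Submodule.span ℂ (Set.range fun g => act g a)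
  have hW : ∀ a, FiniteDimensional ℂ (W a) := by
    intro a
    obtain ⟨k, b, c, hc⟩ := h.regular a
    have : FiniteDimensional ℂ (Submodule.span ℂ (Set.range b)) :=
      FiniteDimensional.span_of_finite ℂ (Set.finite_range b)
    refine Submodule.finiteDimensional_of_le (S₂ := Submodule.span ℂ (Set.range b)) ?_
    rw [Submodule.span_le]
    rintro _ ⟨g, rfl⟩
    change act g a ∈ _
    rw [hc]
    exact sum_mem fun i _ => Submodule.smul_mem _ _ (Submodule.subset_span ⟨i, rfl⟩)
  have hmem : ∀ a, a ∈ W a := fun a => Submodule.subset_span ⟨1, by simp⟩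
  let S : Finset A := insert 1 s
  have hle : ∀ a ∈ S, W a ≤ ⨆ a : S, W a := fun a ha => le_iSup (fun a : S => W a) ⟨a, ha⟩
  refine ⟨⨆ a : S, W a, ⟨inferInstance, hle 1 (Finset.mem_insert_self _ _) (hmem 1), ?_⟩, ?_⟩
  · rw [eq_top_iff, ← hs]
    exact Algebra.adjoin_mono fun a ha => hle a (Finset.mem_insert_of_mem ha) (hmem a)
  · intro g v hv
    have : (⨆ a : S, W a) ≤ (⨆ a : S, W a).comap (act g : A →ₗ[ℂ] A) := by
      refine iSup_le fun a => ?_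
      rw [Submodule.span_le]
      rintro _ ⟨x, rfl⟩
      refine hle a a.2 (Submodule.subset_span ⟨g * x, ?_⟩)
      simp
    exact this hv

theorem eq_of_forall_dual_eq {x y : A} (h : ∀ l : A →ₗ[ℂ] ℂ, l x = l y) : x = y :=
  (Module.forall_dual_apply_eq_zero_iff ℂ (x - y)).1 (fun l => by rw [map_sub, h, sub_self]) |>
    sub_eq_zero.1

theorem IsHomAction.exists_stabDer (h : IsHomAction act O) (hV : ∀ g, ∀ v ∈ V, act g v ∈ V)
    (q : Γ) (v : O →ₗ[ℂ] ℂ)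
    (hv : ∀ c d : O, v (c * d) = (c : Γ → ℂ) q * v d + (d : Γ → ℂ) q * v c) :
    ∃ δ ∈ stabDer V, ∀ (l : A →ₗ[ℂ] ℂ) (a : A) (c : O), (∀ x, (c : Γ → ℂ) x = l (act x a)) →
      v c = l (act q (δ a)) := by
  have hmem : ∀ (l : A →ₗ[ℂ] ℂ) (a : A), ∃ c : O, ∀ x, (c : Γ → ℂ) x = l (act x a) := by
    intro l a
    obtain ⟨k, b, c, hc⟩ := h.regular a
    refine ⟨∑ i, l (b i) • c i, fun x => ?_⟩
    rw [hc]
    simp [mul_comm]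
  have hex : ∀ a, ∃ w : A, ∀ (l : A →ₗ[ℂ] ℂ) (c : O), (∀ x, (c : Γ → ℂ) x = l (act x a)) →
      v c = l w := by
    intro a
    obtain ⟨k, b, c, hc⟩ := h.regular a
    refine ⟨∑ i, v (c i) • b i, fun l d hd => ?_⟩
    have : d = ∑ i, l (b i) • c i := by
      ext x
      rw [hd, hc]
      simp [mul_comm]
    rw [this]
    simp [mul_comm]
  choose w hw using hex
  have hadd : ∀ a b, w (a + b) = w a + w b := fun a b => eq_of_forall_dual_eq fun l => by
    obtain ⟨c, hc⟩ := hmem l a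
    obtain ⟨d, hd⟩ := hmem l b
    rw [← hw (a + b) l (c + d) (fun x => by simp [hc, hd]), map_add, map_add, hw a l c hc,
      hw b l d hd]
  have hsmul : ∀ (r : ℂ) a, w (r • a) = r • w a := fun r a => eq_of_forall_dual_eq fun l => by
    obtain ⟨c, hc⟩ := hmem l a
    rw [← hw (r • a) l (r • c) (fun x => by simp [hc]), map_smul, map_smul, hw a l c hc]
  have hmul : ∀ a b, w (a * b) = act q a * w b + act q b * w a := fun a b =>
    eq_of_forall_dual_eq fun l => by
      obtain ⟨k, b₁, c₁, hc₁⟩ := h.regular a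
      obtain ⟨k', b₂, c₂, hc₂⟩ := h.regular b
      have h1 : ∀ m : A →ₗ[ℂ] ℂ, m (w a) = ∑ i, m (b₁ i) * v (c₁ i) := fun m => by
        rw [← hw a m (∑ i, m (b₁ i) • c₁ i) (fun x => by rw [hc₁]; simp [mul_comm])]
        simp
      have h2 : ∀ m : A →ₗ[ℂ] ℂ, m (w b) = ∑ i, m (b₂ i) * v (c₂ i) := fun m => by
        rw [← hw b m (∑ i, m (b₂ i) • c₂ i) (fun x => by rw [hc₂]; simp [mul_comm])]
        simp
      rw [← hw (a * b) l (∑ i, ∑ j, l (b₁ i * b₂ j) • (c₁ i * c₂ j)) (fun x => by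
        rw [map_mul, hc₁, hc₂, Finset.sum_mul_sum]
        simp only [AddSubmonoidClass.coe_finsetSum, Finset.sum_apply, map_sum]
        refine Finset.sum_congr rfl fun i _ => Finset.sum_congr rfl fun j _ => ?_
        rw [smul_mul_smul_comm]
        simp [mul_comm])]
      have h3 := h2 (l ∘ₗ LinearMap.mulLeft ℂ (act q a))
      have h4 := h1 (l ∘ₗ LinearMap.mulLeft ℂ (act q b))
      simp only [LinearMap.comp_apply, LinearMap.mulLeft_apply] at h3 h4
      rw [map_add, h3, h4, hc₁, hc₂]
      simp only [map_sum, map_smul, hv, Finset.sum_mul, smul_eq_mul, smul_mul_assoc]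
      simp only [mul_add, Finset.sum_add_distrib]
      rw [Finset.sum_comm]
      refine congrArg₂ _ (Finset.sum_congr rfl fun i _ => Finset.sum_congr rfl fun j _ => ?_)
        (Finset.sum_congr rfl fun i _ => Finset.sum_congr rfl fun j _ => ?_)
      · ring
      · rw [mul_comm (b₂ j)]
        ring
  have hwV : ∀ a ∈ V, w a ∈ V := by
    intro a ha
    by_contra hwa
    obtain ⟨l, hl, hlV⟩ := Submodule.exists_le_ker_of_notMem hwa
    refine hl ?_
    rw [← hw a l 0 (fun x => ?_), map_zero]
    have := hlV (hV x a ha)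
    simpa using this.symm
  refine ⟨Derivation.mk'
    { toFun := fun a => act q⁻¹ (w a)
      map_add' := fun a b => by rw [hadd, map_add]
      map_smul' := fun r a => by rw [hsmul, map_smul]; rfl } fun a b => ?_, ?_, ?_⟩
  · have h1 : ∀ a, act q⁻¹ (act q a) = a := fun a => by
      rw [← AlgEquiv.mul_apply, ← map_mul, inv_mul_cancel, map_one, AlgEquiv.one_apply]
    change act q⁻¹ (w (a * b)) = a • act q⁻¹ (w b) + b • act q⁻¹ (w a)
    rw [hmul, map_add, map_mul, map_mul, h1, h1, smul_eq_mul, smul_eq_mul]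
  · exact fun a ha => hV _ _ (hwV a ha)
  · intro l a c hc
    change v c = l (act q (act q⁻¹ (w a)))
    rw [← AlgEquiv.mul_apply, ← map_mul, mul_inv_cancel, map_one, AlgEquiv.one_apply]
    exact hw a l c hc

end Action

section Homogeneous

universe v

variable {A : Type*} [CommRing A] [Algebra ℂ A] {V : Submodule ℂ A}
  {Γ : Type v} [Group Γ] {act : Γ →* (A ≃ₐ[ℂ] A)} {O : Subalgebra ℂ (Γ → ℂ)}

theorem IsHomAction.exists_orbitMap (h : IsHomAction act O) [IsDomain A] [Algebra.FiniteType ℂ A]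
    (p : A →ₐ[ℂ] ℂ) :
    ∃ o : A →ₐ[ℂ] O, Function.Injective o ∧ ∀ a x, (o a : Γ → ℂ) x = p (act x a) := by
  have hmem : ∀ a, (fun x => p (act x a)) ∈ O := by
    intro a
    obtain ⟨k, b, c, hc⟩ := h.regular a
    have : (fun x => p (act x a)) = ((∑ i, p (b i) • c i : O) : Γ → ℂ) := by
      ext x
      rw [hc]
      simp [mul_comm]
    rw [this]
    exact Subtype.property _
  let o : A →ₐ[ℂ] O := AlgHom.codRestrict
    (AlgHom.pi fun x => p.comp (act x).toAlgHom) O hmem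
  have ho : ∀ a x, (o a : Γ → ℂ) x = p (act x a) := fun a x => rfl
  refine ⟨o, ?_, ho⟩
  rw [injective_iff_map_eq_zero]
  intro a ha
  by_contra ha0
  obtain ⟨χ, hχ⟩ := exists_algHom_apply_ne_zero ha0
  obtain ⟨x, hx⟩ := h.trans p χ
  apply hχ
  rw [hx, ← ho, ha]
  rfl

theorem IsHomAction.exists_stabDer_of_orbitMap (h : IsHomAction act O) [IsDomain A]
    (hV : ∀ g, ∀ v ∈ V, act g v ∈ V) {p : A →ₐ[ℂ] ℂ} {o : A →ₐ[ℂ] O}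
    (hop : ∀ a x, (o a : Γ → ℂ) x = p (act x a)) {B : Type*} [CommRing B] [IsDomain B]
    [Algebra ℂ B] [Algebra.FiniteType ℂ B] (π : O →ₐ[ℂ] B)
    (hinj : Function.Injective (π.comp o)) (D : Derivation ℂ A A) :
    ∃ b : B, b ≠ 0 ∧ ∀ χ : B →ₐ[ℂ] ℂ,
      ∃ δ ∈ stabDer V, ∀ a, χ (π (o (δ a))) = χ b * χ (π (o (D a))) := by
  obtain ⟨b, hb, D', hD'⟩ := AlgHom.exists_extend_derivation hinj D
  refine ⟨b, hb, fun χ => ?_⟩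
  obtain ⟨q, hq⟩ := h.points (χ.comp π)
  have hq' : ∀ c : O, χ (π c) = (c : Γ → ℂ) q := hq
  obtain ⟨δ, hδ, hδv⟩ := h.exists_stabDer hV q
    (χ.toLinearMap ∘ₗ (D' : B →ₗ[ℂ] B) ∘ₗ π.toLinearMap)
    (fun c d => by
      rw [← hq', ← hq']
      change χ (D' (π (c * d))) = χ (π c) * χ (D' (π d)) + χ (π d) * χ (D' (π c))
      rw [map_mul, D'.leibniz, map_add, smul_eq_mul, smul_eq_mul, map_mul, map_mul])
  refine ⟨δ, hδ, fun a => ?_⟩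
  have h1 : χ (D' (π (o a))) = p (act q (δ a)) := hδv p.toLinearMap a (o a) (hop a)
  have h2 : D' (π (o a)) = b * π (o (D a)) := hD' a
  rw [hq', hop, ← h1, h2, map_mul]

theorem Ideal.IsPrime.exists_algHom {R : Type v} [CommRing R] [Algebra ℂ R]
    [Algebra.FiniteType ℂ R] {P : Ideal R} (hP : P.IsPrime) :
    ∃ (B : Type v) (_ : CommRing B) (_ : IsDomain B) (_ : Algebra ℂ B)
      (_ : Algebra.FiniteType ℂ B) (π : R →ₐ[ℂ] B), ∀ x, π x = 0 ↔ x ∈ P :=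
  ⟨R ⧸ P, inferInstance, inferInstance, inferInstance,
    Algebra.FiniteType.of_surjective (Ideal.Quotient.mkₐ ℂ P) (Ideal.Quotient.mkₐ_surjective ℂ P),
    Ideal.Quotient.mkₐ ℂ P, fun _ => Ideal.Quotient.eq_zero_iff_mem⟩

theorem IsHomAction.exists_domain (h : IsHomAction act O) [IsDomain A] [Algebra.FiniteType ℂ A]
    (hV : ∀ g, ∀ v ∈ V, act g v ∈ V) (p : A →ₐ[ℂ] ℂ) :
    ∃ (B : Type v) (_ : CommRing B) (_ : IsDomain B) (_ : Algebra ℂ B)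
      (_ : Algebra.FiniteType ℂ B) (o : A →ₐ[ℂ] B), Function.Injective o ∧
      ∀ D : Derivation ℂ A A, ∃ b : B, b ≠ 0 ∧ ∀ χ : B →ₐ[ℂ] ℂ,
        ∃ δ ∈ stabDer V, ∀ a, χ (o (δ a)) = χ b * χ (o (D a)) := by
  obtain ⟨o, ho, hop⟩ := h.exists_orbitMap p
  have := h.fg
  have hdisj : Disjoint ((⊥ : Ideal O) : Set O) ((nonZeroDivisors A).map o : Submonoid O) := by
    rw [Set.disjoint_left]
    rintro x hx ⟨a, ha, rfl⟩
    have h0 : a = 0 := ho (by rw [map_zero]; exact hx)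
    exact nonZeroDivisors.ne_zero ha h0
  obtain ⟨P, hP, -, hPd⟩ := Ideal.exists_le_prime_disjoint ⊥ _ hdisj
  obtain ⟨B, _, _, _, _, π, hπ⟩ := hP.exists_algHom
  have hinj : Function.Injective (π.comp o) := by
    rw [injective_iff_map_eq_zero]
    intro a ha
    by_contra ha0
    exact Set.disjoint_left.1 hPd ((hπ _).1 ha) ⟨a, mem_nonZeroDivisors_of_ne_zero ha0, rfl⟩
  exact ⟨B, ‹_›, ‹_›, ‹_›, ‹_›, π.comp o, hinj, h.exists_stabDer_of_orbitMap hV hop π hinj⟩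

theorem IsHomAction.rank (h : IsHomAction act O) [IsDomain A] [Algebra.FiniteType ℂ A]
    (hV : ∀ g, ∀ v ∈ V, act g v ∈ V) (D : Derivation ℂ A A) :
    ∃ t : A, t ≠ 0 ∧ t • D ∈ Submodule.span A (stabDer V : Set (Derivation ℂ A A)) := by
  classical
  by_contra! hcon
  obtain ⟨p, -⟩ := exists_algHom_apply_ne_zero (one_ne_zero (α := A))
  obtain ⟨B, _, _, _, _, o, ho, H⟩ := h.exists_domain hV p
  have := h.fg
  obtain ⟨s, hs⟩ := Algebra.FiniteType.out (R := ℂ) (A := A)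
  let ev : Derivation ℂ A A →ₗ[A] (s → A) :=
    { toFun := fun E f => E f
      map_add' := fun _ _ => rfl
      map_smul' := fun _ _ => rfl }
  have hev : Function.Injective ev := by
    intro E F hEF
    refine Derivation.ext_of_adjoin_eq_top (s : Set A) hs fun f hf => ?_
    exact congrFun hEF ⟨f, hf⟩
  obtain ⟨l, hl, hlD⟩ := Submodule.exists_dual_ne_zero_of_saturated
    ((Submodule.span A (stabDer V : Set (Derivation ℂ A A))).map ev) (x := ev D) (by
      rintro t ht ⟨E, hE, hEt⟩
      rw [← map_smul] at hEt
      exact hcon t ht (hev hEt ▸ hE))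
  obtain ⟨b, hb, hbχ⟩ := H D
  obtain ⟨χ, hχ⟩ := exists_algHom_apply_ne_zero
    (mul_ne_zero hb (fun h0 => hlD (ho (h0.trans (map_zero o).symm))))
  obtain ⟨δ, hδ, hδχ⟩ := hbχ χ
  have h1 : l (ev δ) = 0 := hl _ ⟨δ, Submodule.subset_span hδ, rfl⟩
  rw [LinearMap.pi_apply_eq_sum_univ] at h1
  apply hχ
  have h2 := congrArg (fun y => χ (o y)) h1
  simp only [map_sum, map_mul, smul_eq_mul, map_zero] at h2
  rw [LinearMap.pi_apply_eq_sum_univ l (ev D)]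
  simp only [map_sum, map_mul, smul_eq_mul, Finset.mul_sum]
  rw [← h2]
  refine Finset.sum_congr rfl fun f _ => ?_
  rw [← mul_assoc]
  exact congrArg (· * _) (hδχ f).symm

end Homogeneous

section Simple

variable {A : Type*} [CommRing A] [Algebra ℂ A] {V : Submodule ℂ A}

open MvPolynomial in
theorem exists_pow_mem_of_stabDer [IsDomain A] [Algebra.FiniteType ℂ A]
    (hrank : ∀ D : Derivation ℂ A A, ∃ t : A, t ≠ 0 ∧
      t • D ∈ Submodule.span A (stabDer V : Set (Derivation ℂ A A))) :
    ∃ T : A, T ≠ 0 ∧ ∀ I : Ideal A, (∀ δ ∈ stabDer V, ∀ a ∈ I, δ a ∈ I) → I ≠ ⊥ →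
      ∃ k, T ^ k ∈ I := by
  classical
  obtain ⟨s, g, hg, hgi⟩ := exists_integral_inj_algHom_of_fg ℂ A
  choose b hb D hD using fun i => AlgHom.exists_extend_derivation hg (pderiv (R := ℂ) i)
  choose t ht hts using fun i => hrank (D i)
  refine ⟨∏ i, t i * b i, Finset.prod_ne_zero_iff.2 fun i _ => mul_ne_zero (ht i) (hb i),
    fun I hI hI0 => ?_⟩
  set T := ∏ i, t i * b i with hT
  have hspan : ∀ E ∈ Submodule.span A (stabDer V : Set (Derivation ℂ A A)), ∀ a ∈ I,
      E a ∈ I := by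
    intro E hE
    induction hE using Submodule.span_induction with
    | mem δ hδ => exact hI δ hδ
    | zero => intro a _; simp
    | add E F _ _ hE hF => intro a ha; exact I.add_mem (hE a ha) (hF a ha)
    | smul r E _ hE => intro a ha; exact I.mul_mem_left r (hE a ha)
  let J : Set (MvPolynomial (Fin s) ℂ) := {x | ∃ k, T ^ k * g x ∈ I}
  have hJ : ∀ x ∈ J, ∀ i, pderiv i x ∈ J := by
    rintro x ⟨k, hk⟩ i
    obtain ⟨u, hu⟩ : t i * b i ∣ T := Finset.dvd_prod_of_mem _ (Finset.mem_univ i)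
    have h1 := hspan _ (hts i) (T ^ (k + 1) * g x) (by
      rw [pow_succ', mul_assoc]
      exact I.mul_mem_left _ hk)
    have h2 : (t i • D i) (T ^ (k + 1) * g x) =
        T ^ (k + 1) * (t i * b i * g (pderiv i x)) +
          (k + 1) * (t i * D i T) * (T ^ k * g x) := by
      rw [Derivation.smul_apply, Derivation.leibniz, Derivation.leibniz_pow, hD]
      simp only [smul_eq_mul, nsmul_eq_mul, Nat.add_sub_cancel]
      push_cast
      ring
    rw [h2] at h1
    have h3 := (I.add_mem_iff_left (I.mul_mem_left _ hk)).1 h1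
    refine ⟨k + 2, ?_⟩
    have h4 : T ^ (k + 2) * g (pderiv i x) = u * (T ^ (k + 1) * (t i * b i * g (pderiv i x))) := by
      rw [pow_succ T (k + 1)]
      nth_rewrite 2 [hu]
      ring
    rw [h4]
    exact I.mul_mem_left _ h3
  obtain ⟨a, ha, ha0⟩ := Submodule.exists_mem_ne_zero_of_ne_bot hI0
  obtain ⟨x, hx, hx0⟩ : ∃ x, g x ∈ I ∧ x ≠ 0 := by
    let : Algebra (MvPolynomial (Fin s) ℂ) A := g.toRingHom.toAlgebra
    obtain ⟨x, hx, hx0⟩ := Submodule.exists_mem_ne_zero_of_ne_bot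
      (Ideal.comap_ne_bot_of_integral_mem (R := MvPolynomial (Fin s) ℂ) ha0 ha (hgi a))
    exact ⟨x, hx, hx0⟩
  obtain ⟨c, hc, k, hk⟩ := exists_C_mem_of_pderiv_mem hJ (x := x) ⟨0, by simpa using hx⟩ hx0
  refine ⟨k, ?_⟩
  have h5 := I.mul_mem_left (algebraMap ℂ A c⁻¹) hk
  rw [← algebraMap_eq, AlgHom.commutes, mul_left_comm, ← map_mul, inv_mul_cancel₀ hc, map_one,
    mul_one] at h5
  exact h5

variable {Γ : Type*} [Group Γ] {act : Γ →* (A ≃ₐ[ℂ] A)} {O : Subalgebra ℂ (Γ → ℂ)}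

theorem exists_conj_mem_stabDer (hV : ∀ g, ∀ v ∈ V, act g v ∈ V) {δ : Derivation ℂ A A}
    (hδ : δ ∈ stabDer V) (x : Γ) :
    ∃ ε ∈ stabDer V, ∀ a, ε (act x a) = act x (δ a) := by
  have h1 : ∀ a, act x (act x⁻¹ a) = a := fun a => by
    rw [← AlgEquiv.mul_apply, ← map_mul, mul_inv_cancel, map_one, AlgEquiv.one_apply]
  have h2 : ∀ a, act x⁻¹ (act x a) = a := fun a => by
    rw [← AlgEquiv.mul_apply, ← map_mul, inv_mul_cancel, map_one, AlgEquiv.one_apply]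
  refine ⟨Derivation.mk'
    { toFun := fun a => act x (δ (act x⁻¹ a))
      map_add' := fun a b => by simp only [map_add]
      map_smul' := fun r a => by
        rw [map_smul, Derivation.map_smul, map_smul]
        rfl } fun a b => ?_, ?_, ?_⟩
  · change act x (δ (act x⁻¹ (a * b))) = a • act x (δ (act x⁻¹ b)) + b • act x (δ (act x⁻¹ a))
    rw [map_mul, Derivation.leibniz, map_add, smul_eq_mul, smul_eq_mul, map_mul, map_mul, h1, h1,
      smul_eq_mul, smul_eq_mul]
  · exact fun a ha => hV _ _ (hδ _ (hV _ _ ha))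
  · intro a
    change act x (δ (act x⁻¹ (act x a))) = _
    rw [h2]

theorem IsHomAction.simple (h : IsHomAction act O) [IsDomain A] [Algebra.FiniteType ℂ A]
    (hV : ∀ g, ∀ v ∈ V, act g v ∈ V) (I : Ideal A)
    (hI : ∀ δ ∈ stabDer V, ∀ a ∈ I, δ a ∈ I) : I = ⊥ ∨ I = ⊤ := by
  by_contra! hcon
  obtain ⟨T, hT, hTI⟩ := exists_pow_mem_of_stabDer (V := V) (h.rank hV)
  obtain ⟨p, hp⟩ := exists_algHom_apply_eq_zero hcon.2
  obtain ⟨q, hq⟩ := exists_algHom_apply_ne_zero hT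
  obtain ⟨x, hx⟩ := h.trans p q
  obtain ⟨k, hk⟩ := hTI (I.comap (act x)) (fun δ hδ a ha => by
    obtain ⟨ε, hε, hεx⟩ := exists_conj_mem_stabDer hV hδ x
    change act x (δ a) ∈ I
    rw [← hεx]
    exact hI ε hε _ ha) (by
    obtain ⟨a, ha, ha0⟩ := Submodule.exists_mem_ne_zero_of_ne_bot hcon.1
    intro hbot
    have : (act x).symm a ∈ I.comap (act x) := by
      change act x ((act x).symm a) ∈ I
      rwa [AlgEquiv.apply_symm_apply]
    rw [hbot, Ideal.mem_bot, map_eq_zero_iff _ (act x).symm.injective] at this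
    exact ha0 this)
  have h1 : q (T ^ k) = 0 := by
    rw [hx]
    exact hp _ hk
  rw [map_pow] at h1
  exact hq (eq_zero_of_pow_eq_zero h1)

theorem IsHomAction.exists_isHomSetup (h : IsHomAction act O) [IsDomain A]
    [Algebra.FiniteType ℂ A] : ∃ V : Submodule ℂ A, IsHomSetup V := by
  obtain ⟨V, hV, hVact⟩ := h.exists_isGenSpace
  obtain ⟨p, -⟩ := exists_algHom_apply_ne_zero (one_ne_zero (α := A))
  exact ⟨V, hV, h.rank hVact, h.simple hVact, ⟨p⟩⟩

end Simple

section Group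

variable {n : ℕ} (G : Subgroup (GLn n))

/-- The matrix entries and the inverse of the determinant, as functions on a linear group. -/
def glFunction : Option (Fin n × Fin n) → ↥G → ℂ
  | some ij => fun g => glEntries (g : GLn n) ij
  | none => fun g => ((g : GLn n) : Matrix (Fin n) (Fin n) ℂ).det⁻¹

/-- The algebra of regular functions on a linear group. -/
def glFunctionAlgebra : Subalgebra ℂ (↥G → ℂ) := Algebra.adjoin ℂ (Set.range (glFunction G))

variable {G}

theorem glFunction_mem (i : Option (Fin n × Fin n)) : glFunction G i ∈ glFunctionAlgebra G :=
  Algebra.subset_adjoin ⟨i, rfl⟩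

variable (G) in
/-- The inclusion of the polynomials in the matrix entries into the regular functions. -/
def glAeval : MvPolynomial (Fin n × Fin n) ℂ →ₐ[ℂ] glFunctionAlgebra G :=
  MvPolynomial.aeval fun ij => ⟨_, glFunction_mem (some ij)⟩

variable (G) in
/-- Evaluation of the regular functions at an element of the group. -/
def glEval (g : ↥G) : glFunctionAlgebra G →ₐ[ℂ] ℂ :=
  (Pi.evalAlgHom ℂ (fun _ : ↥G => ℂ) g).comp (glFunctionAlgebra G).val

theorem algHom_glAeval (φ : glFunctionAlgebra G →ₐ[ℂ] ℂ) (q : MvPolynomial (Fin n × Fin n) ℂ) :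
    φ (glAeval G q) =
      MvPolynomial.eval (fun ij => φ ⟨_, glFunction_mem (some ij)⟩) q := by
  rw [← MvPolynomial.coe_aeval_eq_eval]
  change φ.comp (glAeval G) q = MvPolynomial.aeval _ q
  congr 1
  ext ij
  simp [glAeval]

theorem glAeval_apply (q : MvPolynomial (Fin n × Fin n) ℂ) (g : ↥G) :
    (glAeval G q : ↥G → ℂ) g = MvPolynomial.eval (glEntries (g : GLn n)) q :=
  algHom_glAeval (glEval G g) q

theorem IsRegularOnSubgroup.mem {c : ↥G → ℂ} (hc : IsRegularOnSubgroup G c) :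
    c ∈ glFunctionAlgebra G := by
  obtain ⟨f, ⟨q, m, hf⟩, hcf⟩ := hc
  have : c = (glAeval G q * ⟨_, glFunction_mem none⟩ ^ m : glFunctionAlgebra G) := by
    ext g
    have hdet : ((g : GLn n) : Matrix (Fin n) (Fin n) ℂ).det ≠ 0 :=
      ((Matrix.isUnit_iff_isUnit_det _).1 (g : GLn n).isUnit).ne_zero
    change c g = (glAeval G q : ↥G → ℂ) g * (((g : GLn n) : Matrix (Fin n) (Fin n) ℂ).det⁻¹) ^ m
    rw [glAeval_apply, hcf, ← hf, mul_assoc, ← mul_pow, mul_inv_cancel₀ hdet, one_pow, mul_one]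
  rw [this]
  exact Subtype.property _

theorem finiteType_glFunctionAlgebra : Algebra.FiniteType ℂ (glFunctionAlgebra G) :=
  (Subalgebra.fg_iff_finiteType _).1 (Subalgebra.fg_def.2 ⟨_, Set.finite_range _, rfl⟩)

theorem exists_eval_eq_of_isZClosedInGL (hG : IsZClosedInGL (G : Set (GLn n)))
    (φ : glFunctionAlgebra G →ₐ[ℂ] ℂ) :
    ∃ g : ↥G, ∀ c : glFunctionAlgebra G, φ c = (c : ↥G → ℂ) g := by
  let e : Matrix (Fin n) (Fin n) (glFunctionAlgebra G) :=
    Matrix.of fun i j => ⟨_, glFunction_mem (some (i, j))⟩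
  let M : Matrix (Fin n) (Fin n) ℂ := Matrix.of fun i j => φ (e i j)
  let d : glFunctionAlgebra G := ⟨_, glFunction_mem none⟩
  have hed : e.det * d = 1 := by
    ext g
    have h1 : glEval G g e.det = ((g : GLn n) : Matrix (Fin n) (Fin n) ℂ).det :=
      AlgHom.map_det _ _
    have hdet : ((g : GLn n) : Matrix (Fin n) (Fin n) ℂ).det ≠ 0 :=
      ((Matrix.isUnit_iff_isUnit_det _).1 (g : GLn n).isUnit).ne_zero
    change glEval G g e.det * ((g : GLn n) : Matrix (Fin n) (Fin n) ℂ).det⁻¹ = 1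
    rw [h1, mul_inv_cancel₀ hdet]
  have hM : M.det * φ d = 1 := by
    have h1 : φ e.det = M.det := AlgHom.map_det _ _
    rw [← h1, ← map_mul, hed, map_one]
  have hM0 : M.det ≠ 0 := left_ne_zero_of_mul_eq_one hM
  let g : GLn n := Matrix.GeneralLinearGroup.mkOfDetNeZero M hM0
  have hg : g ∈ G := by
    obtain ⟨P, hP⟩ := hG
    refine (hP g).2 fun p hp => ?_
    have h1 : glAeval G p = 0 := by
      ext x
      rw [glAeval_apply]
      exact (hP x).1 x.2 p hp
    have h2 := algHom_glAeval φ p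
    rw [h1, map_zero] at h2
    exact h2.symm
  have hφ : φ = glEval G ⟨g, hg⟩ := by
    refine AlgHom.adjoin_ext ?_
    rintro _ ⟨_ | ij, rfl⟩
    · exact (inv_eq_of_mul_eq_one_right hM).symm
    · rfl
  exact ⟨⟨g, hg⟩, fun c => by rw [hφ]; rfl⟩

theorem AlgebraicAction.isHomAction {A : Type*} [CommRing A] [Algebra ℂ A]
    (hG : IsZClosedInGL (G : Set (GLn n))) (ρ : AlgebraicAction G A) (hρ : ρ.Transitive) :
    IsHomAction ρ.act (glFunctionAlgebra G) where
  regular a := by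
    obtain ⟨k, b, c, hc, hca⟩ := ρ.regular a
    refine ⟨k, b, fun i => ⟨c i, (hc i).mem⟩, fun g => ?_⟩
    simp only [hca, Algebra.smul_def]
  fg := finiteType_glFunctionAlgebra
  points := exists_eval_eq_of_isZClosedInGL hG
  trans p q := by
    obtain ⟨g, rfl⟩ := hρ p q
    exact ⟨g, fun a => rfl⟩

end Group

/-- A connected affine homogeneous space `X` of a linear algebraic group
`G` over ℂ which is isomorphic neither to the affine line nor to a torus `(ℂ*)^k` has the
algebraic density property. -/
theorem statement0 {n : ℕ} (G : Subgroup (GLn n))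
    (hGclosed : IsZClosedInGL (G : Set (GLn n)))
    (hGconn : IsConnected (G : Set (GLn n)))
    (A : Type) [CommRing A] [IsDomain A] [Algebra ℂ A]
    (hfg : Algebra.FiniteType ℂ A) (hsmooth : Algebra.FormallySmooth ℂ A)
    (ρ : AlgebraicAction G A) (htrans : ρ.Transitive)
    (hline : IsEmpty (A ≃ₐ[ℂ] Polynomial ℂ))
    (htorus : ∀ k : ℕ, IsEmpty (A ≃ₐ[ℂ] TorusRing k)) :
    HasADP A := by
  obtain ⟨V, hV⟩ := (ρ.isHomAction hGclosed htrans).exists_isHomSetup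
  refine hV.hasADP ?_
  by_cases hsolv : LieAlgebra.IsSolvable (stabDer V)
  · exact hV.modPart_ne_bot_of_isSolvable hline htorus
  · exact hV.toIsGenSpace.modPart_ne_bot_of_not_isSolvable hsolv
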